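/- If the R-order Λ has uncountably many isomorphism classes of indecomposable Λ-lattices, then Λ has strongly unbounded lattice type: there is an infinite strictly increasing sequence b_1 < b_2 < ⋯ of integers such that, for each i, there are infinitely many pairwise non-isomorphic indecomposable Λ-lattices of h-length b_i. -/

import Mathlib

universe u

open IsLocalRing

noncomputable section

namespace BT

/-- The length of a module, defined as the Krull dimension of its lattice of
submodules (which agrees with the usual composition-series length). -/
def moduleLength (A : Type u) [Ring A] (M : Type u) [AddCommGroup M] [Module A M] :
    WithBot ℕ∞ :=
  Order.krullDim (Submodule A M)

/-- `M` is a maximal Cohen-Macaulay module over the local ring `R`: it admits an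
`M`-regular sequence contained in the maximal ideal whose length is `dim R`
(i.e. `depth_R M = dim R`). -/
def IsMCM (R : Type u) [CommRing R] [IsLocalRing R]
    (M : Type u) [AddCommGroup M] [Module R M] : Prop :=
  ∃ rs : List R, (∀ r ∈ rs, r ∈ maximalIdeal R) ∧ RingTheory.Sequence.IsRegular M rs ∧
    (rs.length : WithBot ℕ∞) = ringKrullDim R

/-- The `n`-th Ext group of two `R`-modules. -/
def extGroup (R : Type u) [CommRing R] (n : ℕ)
    (A B : Type u) [AddCommGroup A] [Module R A] [AddCommGroup B] [Module R B] : Type u :=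
  ((Ext R (ModuleCat.{u} R) n).obj (Opposite.op (ModuleCat.of R A))).obj (ModuleCat.of R B)

instance (R : Type u) [CommRing R] (n : ℕ)
    (A B : Type u) [AddCommGroup A] [Module R A] [AddCommGroup B] [Module R B] :
    AddCommGroup (extGroup R n A B) :=
  inferInstanceAs (AddCommGroup
    (((Ext R (ModuleCat.{u} R) n).obj (Opposite.op (ModuleCat.of R A))).obj (ModuleCat.of R B)))

instance (R : Type u) [CommRing R] (n : ℕ)
    (A B : Type u) [AddCommGroup A] [Module R A] [AddCommGroup B] [Module R B] :
    Module R (extGroup R n A B) :=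
  inferInstanceAs (Module R
    (((Ext R (ModuleCat.{u} R) n).obj (Opposite.op (ModuleCat.of R A))).obj (ModuleCat.of R B)))

/-- `ω` is a canonical module for the Cohen-Macaulay local ring `R`: it is a
finitely generated module with `Ext^i_R(k, ω) = 0` for `i ≠ dim R` and
`Ext^{dim R}_R(k, ω) ≅ k`. -/
def IsCanonicalModule (R : Type u) [CommRing R] [IsLocalRing R]
    (ω : Type u) [AddCommGroup ω] [Module R ω] : Prop :=
  Module.Finite R ω ∧ ∃ d : ℕ, (d : WithBot ℕ∞) = ringKrullDim R ∧
    (∀ i : ℕ, i ≠ d → Subsingleton (extGroup R i (ResidueField R) ω)) ∧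
    Nonempty (extGroup R d (ResidueField R) ω ≃ₗ[R] ResidueField R)

/-- A homomorphism of `Λ`-modules factors through a projective `Λ`-module. -/
def FactorsThroughProjective (Λ : Type u) [Ring Λ] {M N : Type u}
    [AddCommGroup M] [Module Λ M] [AddCommGroup N] [Module Λ N] (f : M →ₗ[Λ] N) : Prop :=
  ∃ (P : Type u) (_ : AddCommGroup P) (_ : Module Λ P), Module.Projective Λ P ∧
    ∃ (g : M →ₗ[Λ] P) (h : P →ₗ[Λ] N), h.comp g = f

section StableHom

variable (R : Type u) [CommRing R] (Λ : Type u) [Ring Λ] [Algebra R Λ]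
variable (M N : Type u) [AddCommGroup M] [Module Λ M]
  [AddCommGroup N] [Module Λ N] [Module R N] [IsScalarTower R Λ N]

/-- The `R`-submodule of `Hom_Λ(M, N)` consisting of the homomorphisms that
factor through a projective `Λ`-module. -/
def projTrivial : Submodule R (M →ₗ[Λ] N) where
  carrier := {f | FactorsThroughProjective Λ f}
  zero_mem' := ⟨Λ, inferInstance, inferInstance, inferInstance, 0, 0, by ext; simp⟩
  add_mem' := by
    rintro f₁ f₂ ⟨P₁, _, _, hP₁, g₁, h₁, rfl⟩ ⟨P₂, _, _, hP₂, g₂, h₂, rfl⟩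
    exact ⟨P₁ × P₂, inferInstance, inferInstance, inferInstance,
      g₁.prod g₂, h₁.comp (LinearMap.fst Λ P₁ P₂) + h₂.comp (LinearMap.snd Λ P₁ P₂),
      by ext m; simp⟩
  smul_mem' := by
    rintro r f ⟨P, _, _, hP, g, h, rfl⟩
    exact ⟨P, inferInstance, inferInstance, hP, g, r • h, by ext m; simp⟩

/-- The stable Hom `Hom-bar_Λ(M, N)`: homomorphisms modulo those factoring
through projectives, as an `R`-module. -/
def stableHom : Type u := (M →ₗ[Λ] N) ⧸ projTrivial R Λ M N

instance : AddCommGroup (stableHom R Λ M N) :=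
  inferInstanceAs (AddCommGroup ((M →ₗ[Λ] N) ⧸ projTrivial R Λ M N))

instance : Module R (stableHom R Λ M N) :=
  inferInstanceAs (Module R ((M →ₗ[Λ] N) ⧸ projTrivial R Λ M N))

end StableHom

/-- The `h`-length of `M` (relative to a fixed module `G`): the length over `R`
of `h(M) = Hom-bar_Λ(M, M ⊕ G)`. -/
def hLength (R : Type u) [CommRing R] (Λ : Type u) [Ring Λ] [Algebra R Λ]
    (M : Type u) [AddCommGroup M] [Module Λ M] [Module R M] [IsScalarTower R Λ M]
    (G : Type u) [AddCommGroup G] [Module Λ G] [Module R G] [IsScalarTower R Λ G] :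
    WithBot ℕ∞ :=
  moduleLength R (stableHom R Λ M (M × G))

/-- A module is indecomposable if it is nonzero and admits no nontrivial direct
sum decomposition. -/
def IsIndecomposable (Λ : Type u) [Ring Λ] (M : Type u) [AddCommGroup M] [Module Λ M] : Prop :=
  Nontrivial M ∧ ∀ A B : Submodule Λ M, IsCompl A B → A = ⊥ ∨ B = ⊥

/-- `Ext¹_Λ(M, Y) = 0`, expressed by the splitting of extensions: every
surjection onto `M` with kernel isomorphic to `Y` splits. -/
def Ext1Vanishes (Λ : Type u) [Ring Λ] (M Y : Type u)
    [AddCommGroup M] [Module Λ M] [AddCommGroup Y] [Module Λ Y] : Prop :=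
  ∀ (E : Type u) (_ : AddCommGroup E) (_ : Module Λ E) (g : E →ₗ[Λ] M),
    Function.Surjective g → Nonempty ((LinearMap.ker g) ≃ₗ[Λ] Y) →
      ∃ s : M →ₗ[Λ] E, g.comp s = LinearMap.id

/-- A homomorphism `f : X → C` is right minimal if every endomorphism `g` of `X`
with `f ∘ g = f` is an isomorphism. -/
def RightMinimal (Λ : Type u) [Ring Λ] {X C : Type u} [AddCommGroup X] [Module Λ X]
    [AddCommGroup C] [Module Λ C] (f : X →ₗ[Λ] C) : Prop :=
  ∀ g : X →ₗ[Λ] X, f.comp g = f → Function.Bijective g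

/-- Multiplication by `s ∈ R` on `M` lifts along `g : E → M`. -/
def SmulLiftsAlong (R : Type u) [CommRing R] (Λ : Type u) [Ring Λ] [Algebra R Λ]
    {E M : Type u} [AddCommGroup E] [Module Λ E] [AddCommGroup M] [Module Λ M]
    (s : R) (g : E →ₗ[Λ] M) : Prop :=
  ∃ h : M →ₗ[Λ] E, ∀ m, g (h m) = algebraMap R Λ s • m

/-- The localization `M_p` of the finitely generated `Λ`-module `M` is a
projective `Λ_p`-module.  (For a finitely generated module over a noetherian
algebra this is equivalent to the following lifting property: for every
surjection of `Λ`-modules onto `M`, multiplication by some `s ∉ p` lifts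
along it.) -/
def LocallyProjectiveAt (R : Type u) [CommRing R] (Λ : Type u) [Ring Λ] [Algebra R Λ]
    (p : Ideal R) (M : Type u) [AddCommGroup M] [Module Λ M] : Prop :=
  ∀ (E : Type u) (_ : AddCommGroup E) (_ : Module Λ E) (g : E →ₗ[Λ] M),
    Function.Surjective g → ∃ s ∉ p, SmulLiftsAlong R Λ s g

/-- The action of `a : Λ` on a `Λ`-module `M`, as an `R`-linear map. -/
def actionMap (R : Type u) [CommRing R] (Λ : Type u) [Ring Λ] [Algebra R Λ]
    (M : Type u) [AddCommGroup M] [Module Λ M] [Module R M] [IsScalarTower R Λ M]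
    (a : Λ) : M →ₗ[R] M where
  toFun m := a • m
  map_add' := smul_add a
  map_smul' r m := smul_comm a r m

/-- For a left `Λ`-module `M`, the module `Hom_R(M, ω)` is a right `Λ`-module,
i.e. a left `Λᵐᵒᵖ`-module, via `(aᵒᵖ • f) m = f (a • m)`. -/
instance omegaDualModule (R : Type u) [CommRing R] (Λ : Type u) [Ring Λ] [Algebra R Λ]
    (ω : Type u) [AddCommGroup ω] [Module R ω]
    (M : Type u) [AddCommGroup M] [Module Λ M] [Module R M] [IsScalarTower R Λ M] :
    Module Λᵐᵒᵖ (M →ₗ[R] ω) where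
  smul a f := f.comp (actionMap R Λ M a.unop)
  one_smul f := LinearMap.ext fun m => congrArg f (one_smul Λ m)
  mul_smul a b f := LinearMap.ext fun m => congrArg f (mul_smul b.unop a.unop m)
  smul_zero _ := LinearMap.ext fun _ => rfl
  smul_add _ _ _ := LinearMap.ext fun _ => rfl
  add_smul a b f := LinearMap.ext fun m => by
    show f ((a.unop + b.unop) • m) = f (a.unop • m) + f (b.unop • m)
    rw [add_smul, map_add]
  zero_smul f := LinearMap.ext fun m => by
    show f ((0 : Λ) • m) = 0
    rw [zero_smul, map_zero]

/-- `M` is a `Λ`-lattice: it is finitely generated, maximal Cohen-Macaulay as an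
`R`-module, `M_p` is `Λ_p`-projective for every non-maximal prime `p`, and
`Hom_R(M, ω)_p` is `Λ_p^op`-projective for every non-maximal prime `p`. -/
def IsLattice (R : Type u) [CommRing R] [IsLocalRing R]
    (Λ : Type u) [Ring Λ] [Algebra R Λ]
    (ω : Type u) [AddCommGroup ω] [Module R ω]
    (M : Type u) [AddCommGroup M] [Module Λ M] [Module R M] [IsScalarTower R Λ M] : Prop :=
  Module.Finite Λ M ∧ IsMCM R M ∧
    (∀ p : Ideal R, p.IsPrime → p ≠ maximalIdeal R → LocallyProjectiveAt R Λ p M) ∧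
    (∀ p : Ideal R, p.IsPrime → p ≠ maximalIdeal R →
      LocallyProjectiveAt R Λᵐᵒᵖ p (M →ₗ[R] ω))

/-- `Y` is a lat-injective module: it is a lattice and `Ext¹_Λ(M, Y) = 0` for
every `Λ`-lattice `M`. -/
def IsLatInjective (R : Type u) [CommRing R] [IsLocalRing R]
    (Λ : Type u) [Ring Λ] [Algebra R Λ]
    (ω : Type u) [AddCommGroup ω] [Module R ω]
    (Y : Type u) [AddCommGroup Y] [Module Λ Y] [Module R Y] [IsScalarTower R Λ Y] : Prop :=
  IsLattice R Λ ω Y ∧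
    ∀ (M : Type u) (_ : AddCommGroup M) (_ : Module Λ M) (_ : Module R M)
      (_ : IsScalarTower R Λ M), IsLattice R Λ ω M → Ext1Vanishes Λ M Y

/-- `Y` admits a finite resolution `0 → L_t → ⋯ → L_0 → Y → 0` by lat-injective
modules. -/
def HasLatInjResOfLength (R : Type u) [CommRing R] [IsLocalRing R]
    (Λ : Type u) [Ring Λ] [Algebra R Λ]
    (ω : Type u) [AddCommGroup ω] [Module R ω] :
    ℕ → ∀ (Y : Type u) [AddCommGroup Y] [Module Λ Y] [Module R Y] [IsScalarTower R Λ Y], Prop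
  | 0, Y, _, _, _, _ => IsLatInjective R Λ ω Y
  | (t + 1), Y, _, _, _, _ =>
      ∃ (L : Type u) (_ : AddCommGroup L) (_ : Module Λ L) (_ : Module R L)
        (_ : IsScalarTower R Λ L) (π : L →ₗ[Λ] Y), IsLatInjective R Λ ω L ∧
          Function.Surjective π ∧ HasLatInjResOfLength R Λ ω t (LinearMap.ker π)

/-- `α : X → C` is a minimal lat-approximation of the `Λ`-module `C`: `X` is a
lattice, `α` is surjective and right minimal, and its kernel admits a finite
resolution by lat-injectives. -/
def IsMinimalLatApprox (R : Type u) [CommRing R] [IsLocalRing R]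
    (Λ : Type u) [Ring Λ] [Algebra R Λ] (ω : Type u) [AddCommGroup ω] [Module R ω]
    {X : Type u} [AddCommGroup X] [Module Λ X] [Module R X] [IsScalarTower R Λ X]
    {C : Type u} [AddCommGroup C] [Module Λ C] (α : X →ₗ[Λ] C) : Prop :=
  IsLattice R Λ ω X ∧ Function.Surjective α ∧
    (∃ t : ℕ, HasLatInjResOfLength R Λ ω t (LinearMap.ker α)) ∧ RightMinimal Λ α

/-- `Sfam` is a complete set of pairwise non-isomorphic simple `Λ`-modules, and
`α : G → S` is a minimal lat-approximation of their direct sum `S = ⨁ i, Sfam i`. -/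
def IsSimplesApprox (R : Type u) [CommRing R] [IsLocalRing R]
    (Λ : Type u) [Ring Λ] [Algebra R Λ] (ω : Type u) [AddCommGroup ω] [Module R ω]
    (ι : Type u) [Fintype ι] (Sfam : ι → Type u) [∀ i, AddCommGroup (Sfam i)]
    [∀ i, Module Λ (Sfam i)]
    (G : Type u) [AddCommGroup G] [Module Λ G] [Module R G] [IsScalarTower R Λ G]
    (α : G →ₗ[Λ] ∀ i, Sfam i) : Prop :=
  (∀ i, IsSimpleModule Λ (Sfam i)) ∧
  (∀ i j, i ≠ j → IsEmpty (Sfam i ≃ₗ[Λ] Sfam j)) ∧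
  (∀ (T : Type u) (_ : AddCommGroup T) (_ : Module Λ T),
      IsSimpleModule Λ T → ∃ i, Nonempty (T ≃ₗ[Λ] Sfam i)) ∧
  IsMinimalLatApprox R Λ ω α

/-- There are infinitely many pairwise non-isomorphic indecomposable
`Λ`-lattices of `h`-length `t`. -/
def InfManyIndecLatticesOfHLength (R : Type u) [CommRing R] [IsLocalRing R]
    (Λ : Type u) [Ring Λ] [Algebra R Λ] (ω : Type u) [AddCommGroup ω] [Module R ω]
    (G : Type u) [AddCommGroup G] [Module Λ G] [Module R G] [IsScalarTower R Λ G]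
    (t : ℕ) : Prop :=
  ∃ (F : ℕ → Type u) (_ : ∀ n, AddCommGroup (F n)) (_ : ∀ n, Module Λ (F n))
    (_ : ∀ n, Module R (F n)) (_ : ∀ n, IsScalarTower R Λ (F n)),
    (∀ n, IsLattice R Λ ω (F n) ∧ IsIndecomposable Λ (F n) ∧
      hLength R Λ (F n) G = (t : WithBot ℕ∞)) ∧
    ∀ m n : ℕ, m ≠ n → IsEmpty (F m ≃ₗ[Λ] F n)

/-- `Λ` has strongly unbounded lattice type: there is an infinite strictly
increasing sequence `b 0 < b 1 < ⋯` of integers such that for each `i` there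
are infinitely many pairwise non-isomorphic indecomposable `Λ`-lattices of
`h`-length `b i`. -/
def StronglyUnboundedLatType (R : Type u) [CommRing R] [IsLocalRing R]
    (Λ : Type u) [Ring Λ] [Algebra R Λ] (ω : Type u) [AddCommGroup ω] [Module R ω]
    (G : Type u) [AddCommGroup G] [Module Λ G] [Module R G] [IsScalarTower R Λ G] : Prop :=
  ∃ b : ℕ → ℕ, StrictMono b ∧ ∀ i, InfManyIndecLatticesOfHLength R Λ ω G (b i)

/-- `Λ` is of finite lattice type: there are only finitely many isomorphism
classes of indecomposable `Λ`-lattices. -/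
def FiniteLatType (R : Type u) [CommRing R] [IsLocalRing R]
    (Λ : Type u) [Ring Λ] [Algebra R Λ] (ω : Type u) [AddCommGroup ω] [Module R ω] : Prop :=
  ∃ (n : ℕ) (F : Fin n → Type u) (_ : ∀ i, AddCommGroup (F i)) (_ : ∀ i, Module Λ (F i)),
    ∀ (M : Type u) (_ : AddCommGroup M) (_ : Module Λ M) (_ : Module R M)
      (_ : IsScalarTower R Λ M), IsLattice R Λ ω M → IsIndecomposable Λ M →
        ∃ i, Nonempty (M ≃ₗ[Λ] F i)

section

open RingTheory.Sequence Pointwise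

section Regularity

variable {R : Type u} [CommRing R]

lemma isSMulRegular_zero_iff' {M : Type u} [AddCommGroup M] [Module R M] {x : R} :
    IsSMulRegular M x ↔ ∀ m : M, x • m = 0 → m = 0 := isSMulRegular_iff_right_eq_zero_of_smul

lemma isWeaklyRegular_retract {A B : Type u} [AddCommGroup A] [Module R A] [AddCommGroup B]
    [Module R B] (i : A →ₗ[R] B) (p : B →ₗ[R] A) (h : p ∘ₗ i = LinearMap.id) (xs : List R)
    (hB : IsWeaklyRegular B xs) : IsWeaklyRegular A xs := by
  induction xs generalizing A B with
  | nil => simp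
  | cons x xs ih =>
    rw [isWeaklyRegular_cons_iff] at hB ⊢
    refine ⟨?_, ih (QuotSMulTop.map x i) (QuotSMulTop.map x p) ?_ hB.2⟩
    · intro a b hab
      have := hB.1 (show x • i a = x • i b by rw [← map_smul, ← map_smul]; exact congrArg i hab)
      simpa [← LinearMap.comp_apply, h] using congrArg p this
    · rw [← QuotSMulTop.map_comp, h, QuotSMulTop.map_id]

lemma isWeaklyRegular_extension {A B C : Type u} [AddCommGroup A] [Module R A] [AddCommGroup B]
    [Module R B] [AddCommGroup C] [Module R C] (f : A →ₗ[R] B) (g : B →ₗ[R] C)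
    (hf : Function.Injective f) (hg : Function.Surjective g) (hfg : Function.Exact f g)
    (xs : List R) (hA : IsWeaklyRegular A xs) (hC : IsWeaklyRegular C xs) :
    IsWeaklyRegular B xs := by
  induction xs generalizing A B C with
  | nil => simp
  | cons x xs ih =>
    rw [isWeaklyRegular_cons_iff] at hA hC ⊢
    have hC0 := isSMulRegular_zero_iff'.1 hC.1
    have hA0 := isSMulRegular_zero_iff'.1 hA.1
    refine ⟨isSMulRegular_zero_iff'.2 fun b hb => ?_,
      ih (QuotSMulTop.map x f) (QuotSMulTop.map x g) ?_ (QuotSMulTop.map_surjective x hg)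
      (QuotSMulTop.map_exact x hfg hg) hA.2 hC.2⟩
    · have h1 : g b = 0 := hC0 _ (by rw [← map_smul, hb, map_zero])
      obtain ⟨a, rfl⟩ := (hfg b).1 h1
      rw [hA0 a (hf (by rw [map_smul, hb, map_zero])), map_zero]
    · rw [injective_iff_map_eq_zero]
      intro a ha
      obtain ⟨a, rfl⟩ := Submodule.Quotient.mk_surjective _ a
      rw [QuotSMulTop.map_apply_mk, Submodule.Quotient.mk_eq_zero,
        Submodule.mem_smul_pointwise_iff_exists] at ha
      obtain ⟨b, -, hb⟩ := ha
      have h1 : g b = 0 := hC0 _ (by rw [← map_smul, hb]; exact (hfg _).2 ⟨a, rfl⟩)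
      obtain ⟨a', rfl⟩ := (hfg b).1 h1
      rw [← map_smul] at hb
      rw [Submodule.Quotient.mk_eq_zero, ← hf hb]
      exact Submodule.smul_mem_pointwise_smul _ _ _ trivial

lemma isWeaklyRegular_kernel {A B C : Type u} [AddCommGroup A] [Module R A] [AddCommGroup B]
    [Module R B] [AddCommGroup C] [Module R C] (f : A →ₗ[R] B) (g : B →ₗ[R] C)
    (hf : Function.Injective f) (hg : Function.Surjective g) (hfg : Function.Exact f g)
    (xs : List R) (hB : IsWeaklyRegular B xs) (hC : IsWeaklyRegular C xs) :
    IsWeaklyRegular A xs := by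
  induction xs generalizing A B C with
  | nil => simp
  | cons x xs ih =>
    rw [isWeaklyRegular_cons_iff] at hB hC ⊢
    have hC0 := isSMulRegular_zero_iff'.1 hC.1
    have hB0 := isSMulRegular_zero_iff'.1 hB.1
    refine ⟨isSMulRegular_zero_iff'.2 fun a ha => ?_,
      ih (QuotSMulTop.map x f) (QuotSMulTop.map x g) ?_ (QuotSMulTop.map_surjective x hg)
      (QuotSMulTop.map_exact x hfg hg) hB.2 hC.2⟩
    · exact hf (by rw [map_zero]; exact hB0 _ (by rw [← map_smul, ha, map_zero]))
    · rw [injective_iff_map_eq_zero]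
      intro a ha
      obtain ⟨a, rfl⟩ := Submodule.Quotient.mk_surjective _ a
      rw [QuotSMulTop.map_apply_mk, Submodule.Quotient.mk_eq_zero,
        Submodule.mem_smul_pointwise_iff_exists] at ha
      obtain ⟨b, -, hb⟩ := ha
      have h1 : g b = 0 := hC0 _ (by rw [← map_smul, hb]; exact (hfg _).2 ⟨a, rfl⟩)
      obtain ⟨a', rfl⟩ := (hfg b).1 h1
      rw [← map_smul] at hb
      rw [Submodule.Quotient.mk_eq_zero, ← hf hb]
      exact Submodule.smul_mem_pointwise_smul _ _ _ trivial

lemma isWeaklyRegular_of_subsingleton {A : Type u} [AddCommGroup A] [Module R A] [Subsingleton A]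
    (xs : List R) : IsWeaklyRegular A xs := by
  induction xs generalizing A with
  | nil => simp
  | cons x xs ih =>
    rw [isWeaklyRegular_cons_iff]
    exact ⟨fun _ _ _ => Subsingleton.elim _ _, ih⟩

lemma isWeaklyRegular_quot_pow {M : Type u} [AddCommGroup M] [Module R M] {x : R} {xs : List R}
    (hx : IsSMulRegular M x) (h : IsWeaklyRegular (QuotSMulTop x M) xs) (a : ℕ) :
    IsWeaklyRegular (QuotSMulTop (x ^ a) M) xs := by
  induction a with
  | zero =>
    have : Subsingleton (QuotSMulTop (x ^ 0) M) := by
      rw [pow_zero, Submodule.Quotient.subsingleton_iff, one_smul]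
    exact isWeaklyRegular_of_subsingleton _
  | succ a ih =>
    have hle : x • (⊤ : Submodule R M) ≤
        (x ^ (a + 1) • (⊤ : Submodule R M)).comap (LinearMap.lsmul R M (x ^ a)) := by
      intro m hm
      obtain ⟨m', -, rfl⟩ := (Submodule.mem_smul_pointwise_iff_exists _ _ _).1 hm
      rw [Submodule.mem_comap, LinearMap.lsmul_apply, smul_smul, ← pow_succ]
      exact Submodule.smul_mem_pointwise_smul _ _ _ trivial
    have hle2 : x ^ (a + 1) • (⊤ : Submodule R M) ≤
        (x ^ a • (⊤ : Submodule R M)).comap LinearMap.id := by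
      intro m hm
      obtain ⟨m', -, rfl⟩ := (Submodule.mem_smul_pointwise_iff_exists _ _ _).1 hm
      rw [Submodule.mem_comap, LinearMap.id_apply, pow_succ, mul_smul]
      exact Submodule.smul_mem_pointwise_smul _ _ _ trivial
    refine isWeaklyRegular_extension (Submodule.mapQ _ _ (LinearMap.lsmul R M (x ^ a)) hle)
      (Submodule.mapQ _ _ LinearMap.id hle2) ?_ ?_ ?_ xs h ih
    · rw [injective_iff_map_eq_zero]
      intro m hm
      obtain ⟨m, rfl⟩ := Submodule.Quotient.mk_surjective _ m
      rw [Submodule.mapQ_apply, Submodule.Quotient.mk_eq_zero,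
        Submodule.mem_smul_pointwise_iff_exists] at hm
      obtain ⟨m', -, hm⟩ := hm
      rw [LinearMap.lsmul_apply, pow_succ, mul_smul] at hm
      rw [Submodule.Quotient.mk_eq_zero, ← (hx.pow a) hm]
      exact Submodule.smul_mem_pointwise_smul _ _ _ trivial
    · intro m
      obtain ⟨m, rfl⟩ := Submodule.Quotient.mk_surjective _ m
      exact ⟨Submodule.Quotient.mk m, by simp⟩
    · intro m
      obtain ⟨m, rfl⟩ := Submodule.Quotient.mk_surjective _ m
      rw [Submodule.mapQ_apply, Submodule.Quotient.mk_eq_zero,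
        Submodule.mem_smul_pointwise_iff_exists]
      constructor
      · rintro ⟨m', -, hm⟩
        exact ⟨Submodule.Quotient.mk m', by
          rw [Submodule.mapQ_apply]; exact congrArg _ (by simpa using hm)⟩
      · rintro ⟨m', hm⟩
        obtain ⟨m', rfl⟩ := Submodule.Quotient.mk_surjective _ m'
        rw [Submodule.mapQ_apply, Submodule.Quotient.eq,
          Submodule.mem_smul_pointwise_iff_exists] at hm
        obtain ⟨m'', -, hm⟩ := hm
        refine ⟨m' - x • m'', trivial, ?_⟩
        rw [smul_sub, smul_smul, ← pow_succ, hm]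
        simp

lemma isWeaklyRegular_pow {M : Type u} [AddCommGroup M] [Module R M] {xs : List R}
    (h : IsWeaklyRegular M xs) (a : ℕ) : IsWeaklyRegular M (xs.map (· ^ a)) := by
  induction xs generalizing M with
  | nil => simp
  | cons x xs ih =>
    rw [isWeaklyRegular_cons_iff] at h
    rw [List.map_cons, isWeaklyRegular_cons_iff]
    exact ⟨h.1.pow a, ih (isWeaklyRegular_quot_pow h.1 h.2 a)⟩

end Regularity

section Rees

open CategoryTheory Abelian Limits

variable {R : Type u} [CommRing R] [IsLocalRing R]

lemma isWeaklyRegular_of_ext {xs : List R} (hxs : ∀ x ∈ xs, x ∈ maximalIdeal R)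
    {M : Type u} [AddCommGroup M] [Module R M] (k : ℕ)
    (hext : ∀ i < xs.length,
      Subsingleton (Ext (ModuleCat.of R (ResidueField R)) (ModuleCat.of R M) i))
    (hW : ∀ s ∈ maximalIdeal R ^ k, ∃ (W : Type u) (_ : AddCommGroup W) (_ : Module R W)
      (a : M →ₗ[R] W) (b : W →ₗ[R] M), IsWeaklyRegular W xs ∧ ∀ m, b (a m) = s • m) :
    IsWeaklyRegular M xs := by
  induction xs generalizing M with
  | nil => simp
  | cons x xs ih =>
    have hx : IsSMulRegular M x := by
      rw [isSMulRegular_zero_iff']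
      intro m hm
      have h0 : Subsingleton (ResidueField R →ₗ[R] M) := by
        have := hext 0 (by simp)
        have : Subsingleton (ModuleCat.of R (ResidueField R) ⟶ ModuleCat.of R M) :=
          Ext.addEquiv₀.symm.subsingleton
        exact (ModuleCat.homAddEquiv (M := ModuleCat.of R (ResidueField R))
          (N := ModuleCat.of R M)).symm.subsingleton
      have hsoc : ∀ v : M, (∀ s ∈ maximalIdeal R, s • v = 0) → v = 0 := by
        intro v hv
        have hle : maximalIdeal R ≤ LinearMap.ker (LinearMap.toSpanSingleton R M v) :=
          fun s hs => by simpa using hv s hs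
        have h1 : (Submodule.liftQ (maximalIdeal R) (LinearMap.toSpanSingleton R M v) hle :
            R ⧸ maximalIdeal R →ₗ[R] M) = 0 := h0.elim _ _
        have h2 := LinearMap.congr_fun h1 (Submodule.Quotient.mk (1 : R))
        rwa [Submodule.liftQ_apply, LinearMap.toSpanSingleton_apply, one_smul] at h2
      have hpow : ∀ j, ∀ v : M, (∀ s ∈ maximalIdeal R ^ j, s • v = 0) → v = 0 := by
        intro j
        induction j with
        | zero => intro v hv; simpa using hv 1 (by simp)
        | succ j ihj =>
          intro v hv
          refine ihj v fun s hs => hsoc _ fun t ht => ?_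
          rw [smul_smul, mul_comm]
          exact hv _ (by rw [pow_succ]; exact Ideal.mul_mem_mul hs ht)
      refine hpow k m fun s hs => ?_
      obtain ⟨W, _, _, a, b, hWr, hab⟩ := hW s hs
      rw [← hab, isSMulRegular_zero_iff'.1 ((isWeaklyRegular_cons_iff _ _ _).1 hWr).1 (a m)
        (by rw [← map_smul, hm, map_zero]), map_zero]
    rw [isWeaklyRegular_cons_iff]
    refine ⟨hx, ih (fun y hy => hxs y (by simp [hy])) ?_ ?_⟩
    · intro i hi
      have zero1 := AddCommGrpCat.isZero_of_iff_subsingleton.mpr (hext i (by simp; omega))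
      have zero2 := AddCommGrpCat.isZero_of_iff_subsingleton.mpr (hext (i + 1) (by simp; omega))
      exact AddCommGrpCat.subsingleton_of_isZero <| ShortComplex.Exact.isZero_of_both_zeros
        ((Ext.covariant_sequence_exact₃' (ModuleCat.of R (ResidueField R))
          (IsSMulRegular.smulShortComplex_shortExact (M := ModuleCat.of R M) hx)) i (i + 1) rfl)
        (zero1.eq_zero_of_src _) (zero2.eq_zero_of_tgt _)
    · intro s hs
      obtain ⟨W, _, _, a, b, hWr, hab⟩ := hW s hs
      refine ⟨QuotSMulTop x W, inferInstance, inferInstance, QuotSMulTop.map x a,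
        QuotSMulTop.map x b, ((isWeaklyRegular_cons_iff _ _ _).1 hWr).2, fun m => ?_⟩
      obtain ⟨m, rfl⟩ := Submodule.Quotient.mk_surjective _ m
      rw [QuotSMulTop.map_apply_mk, QuotSMulTop.map_apply_mk, hab]
      rfl

variable [IsNoetherianRing R]

lemma IsMCM.isWeaklyRegular {M : Type u} [AddCommGroup M] [Module R M] [Module.Finite R M]
    (hM : IsMCM R M) {xs : List R} (hxs : ∀ x ∈ xs, x ∈ maximalIdeal R)
    (hlen : (xs.length : WithBot ℕ∞) = ringKrullDim R) (k : ℕ)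
    (hW : ∀ s ∈ maximalIdeal R ^ k, ∃ (W : Type u) (_ : AddCommGroup W) (_ : Module R W)
      (a : M →ₗ[R] W) (b : W →ₗ[R] M), IsWeaklyRegular W xs ∧ ∀ m, b (a m) = s • m) :
    IsWeaklyRegular M xs := by
  obtain ⟨rs, hrs, hreg, hl⟩ := hM
  have hlen' : rs.length = xs.length := by
    rw [← hlen] at hl
    exact_mod_cast hl
  have := hreg.nontrivial
  refine isWeaklyRegular_of_ext hxs k ?_ hW
  rw [← hlen']
  refine ModuleCat.subsingleton_ext_of_exists_isRegular (maximalIdeal R)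
    (ModuleCat.of R (ResidueField R)) ?_ (ModuleCat.of R M) ?_ rs hrs hreg
  · change Module.support R (R ⧸ maximalIdeal R) ⊆ _
    rw [Module.support_eq_zeroLocus, Ideal.annihilator_quotient]
  · refine lt_top_iff_ne_top.2 fun h => ?_
    have := Submodule.eq_bot_of_le_smul_of_le_jacobson_bot (maximalIdeal R)
      (⊤ : Submodule R M) (Module.Finite.fg_top) h.ge
      (IsLocalRing.maximalIdeal_le_jacobson _)
    exact top_ne_bot this

end Rees

lemma exists_pow_le_of_prime {R : Type u} [CommRing R] [IsNoetherianRing R] [IsLocalRing R]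
    (I : Ideal R) (h : ∀ p : Ideal R, p.IsPrime → p ≠ maximalIdeal R → ∃ s ∉ p, s ∈ I) :
    ∃ k, maximalIdeal R ^ k ≤ I := by
  apply Ideal.exists_pow_le_of_le_radical_of_fg _ (IsNoetherian.noetherian _)
  rw [Ideal.radical_eq_sInf]
  refine le_sInf fun p hp => ?_
  by_contra hne
  obtain ⟨s, hs, hsI⟩ := h p hp.2 (fun e => hne e.ge)
  exact hs (hp.1 hsI)

end

section

open RingTheory.Sequence Pointwise

section Stab

variable {R : Type u} [CommRing R] {Λ : Type u} [Ring Λ] [Algebra R Λ]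
variable {M N L : Type u} [AddCommGroup M] [Module Λ M] [AddCommGroup N] [Module Λ N]
  [AddCommGroup L] [Module Λ L]

lemma FactorsThroughProjective.comp_right {f : M →ₗ[Λ] N} (hf : FactorsThroughProjective Λ f)
    (g : L →ₗ[Λ] M) : FactorsThroughProjective Λ (f ∘ₗ g) := by
  obtain ⟨P, _, _, hP, a, b, rfl⟩ := hf
  exact ⟨P, _, _, hP, a ∘ₗ g, b, rfl⟩

lemma FactorsThroughProjective.comp_left {f : M →ₗ[Λ] N} (hf : FactorsThroughProjective Λ f)
    (g : N →ₗ[Λ] L) : FactorsThroughProjective Λ (g ∘ₗ f) := by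
  obtain ⟨P, _, _, hP, a, b, rfl⟩ := hf
  exact ⟨P, _, _, hP, a, g ∘ₗ b, rfl⟩

lemma FactorsThroughProjective.lift {f : M →ₗ[Λ] N} (hf : FactorsThroughProjective Λ f)
    {g : L →ₗ[Λ] N} (hg : Function.Surjective g) : ∃ h : M →ₗ[Λ] L, g ∘ₗ h = f := by
  obtain ⟨P, _, _, hP, a, b, rfl⟩ := hf
  obtain ⟨c, hc⟩ := Module.projective_lifting_property g b hg
  exact ⟨c ∘ₗ a, by rw [← LinearMap.comp_assoc, hc]⟩

variable [Module R M] [IsScalarTower R Λ M]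

variable (R Λ M) in
/-- The ideal of scalars `s` such that multiplication by `s` on `M` factors through a
projective module. -/
def stabIdeal : Ideal R :=
  (projTrivial R Λ M M).comap (LinearMap.toSpanSingleton R _ (LinearMap.id))

lemma mem_stabIdeal {s : R} :
    s ∈ stabIdeal R Λ M ↔ FactorsThroughProjective Λ (s • (LinearMap.id : M →ₗ[Λ] M)) := by
  rfl

lemma exists_lift_of_mem_stabIdeal {s : R} (hs : s ∈ stabIdeal R Λ M) {g : L →ₗ[Λ] M}
    (hg : Function.Surjective g) : ∃ h : M →ₗ[Λ] L, ∀ m, g (h m) = s • m := by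
  obtain ⟨h, hh⟩ := (mem_stabIdeal.1 hs).lift hg
  exact ⟨h, fun m => by simpa using LinearMap.congr_fun hh m⟩

lemma mem_stabIdeal_of_lift {s : R} [Module.Projective Λ L] {g : L →ₗ[Λ] M} {h : M →ₗ[Λ] L}
    (H : ∀ m, g (h m) = s • m) : s ∈ stabIdeal R Λ M :=
  mem_stabIdeal.2 ⟨L, _, _, inferInstance, h, g, LinearMap.ext fun m => by simp [H]⟩

variable [Module R N] [IsScalarTower R Λ N] [Module R L] [IsScalarTower R Λ L]

lemma stabIdeal_mul_le_kernel (f : L →ₗ[Λ] M) (g : M →ₗ[Λ] N) (hf : Function.Injective f)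
    (hg : Function.Surjective g) (hfg : Function.Exact f g) :
    stabIdeal R Λ M * stabIdeal R Λ N ≤ stabIdeal R Λ L := by
  rw [Ideal.mul_le]
  intro s hs t ht
  obtain ⟨h, hh⟩ := exists_lift_of_mem_stabIdeal ht hg
  have hr : ∀ m, (t • LinearMap.id - h ∘ₗ g : M →ₗ[Λ] M) m ∈ LinearMap.range f := by
    intro m
    refine (hfg _).1 ?_
    simp [hh, LinearMap.map_smul_of_tower]
  let e := LinearEquiv.ofInjective f hf
  let r : M →ₗ[Λ] L := e.symm.toLinearMap ∘ₗ LinearMap.codRestrict _ _ hr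
  have hfr : ∀ m, f (r m) = t • m - h (g m) := fun m => by
    have : f (r m) = (e (r m) : M) := rfl
    rw [this]
    simp [r]
  have key : (s * t) • (LinearMap.id : L →ₗ[Λ] L) = r ∘ₗ (s • LinearMap.id) ∘ₗ f := by
    ext l
    apply hf
    simp [LinearMap.map_smul_of_tower, hfr, hfg.apply_apply_eq_zero, mul_smul, smul_comm s t]
  rw [mem_stabIdeal, key]
  exact ((mem_stabIdeal.1 hs).comp_right f).comp_left r

lemma stabIdeal_mul_le_extension (f : L →ₗ[Λ] M) (g : M →ₗ[Λ] N) (hf : Function.Injective f)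
    (hg : Function.Surjective g) (hfg : Function.Exact f g) :
    (stabIdeal R Λ L ⊓ stabIdeal R Λ N) * stabIdeal R Λ N ≤ stabIdeal R Λ M := by
  rw [Ideal.mul_le]
  intro s hs t ht
  obtain ⟨h, hh⟩ := exists_lift_of_mem_stabIdeal ht hg
  have hr : ∀ m, (t • LinearMap.id - h ∘ₗ g : M →ₗ[Λ] M) m ∈ LinearMap.range f := by
    intro m
    refine (hfg _).1 ?_
    simp [hh, LinearMap.map_smul_of_tower]
  let e := LinearEquiv.ofInjective f hf
  let r : M →ₗ[Λ] L := e.symm.toLinearMap ∘ₗ LinearMap.codRestrict _ _ hr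
  have hfr : ∀ m, f (r m) = t • m - h (g m) := fun m => by
    have : f (r m) = (e (r m) : M) := rfl
    rw [this]
    simp [r]
  have key : (s * t) • (LinearMap.id : M →ₗ[Λ] M) =
      f ∘ₗ (s • LinearMap.id) ∘ₗ r + h ∘ₗ (s • LinearMap.id) ∘ₗ g := by
    ext l
    simp [LinearMap.map_smul_of_tower, hfr, mul_smul, ← smul_add]
  rw [mem_stabIdeal, key]
  exact (projTrivial R Λ M M).add_mem (((mem_stabIdeal.1 hs.1).comp_right r).comp_left f)
    (((mem_stabIdeal.1 hs.2).comp_right g).comp_left h)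

lemma stabIdeal_le_retract (i : L →ₗ[Λ] M) (p : M →ₗ[Λ] L) (h : p ∘ₗ i = LinearMap.id) :
    stabIdeal R Λ M ≤ stabIdeal R Λ L := by
  intro s hs
  have key : s • (LinearMap.id : L →ₗ[Λ] L) = p ∘ₗ (s • LinearMap.id) ∘ₗ i := by
    rw [← h]
    ext l
    simp [LinearMap.map_smul_of_tower]
  rw [mem_stabIdeal, key]
  exact ((mem_stabIdeal.1 hs).comp_right i).comp_left p

lemma stabIdeal_of_projective [Module.Projective Λ M] : stabIdeal R Λ M = ⊤ :=
  (Ideal.eq_top_iff_one _).2 (mem_stabIdeal.2 ⟨M, _, _, inferInstance, LinearMap.id,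
    (1 : R) • LinearMap.id, by ext; simp⟩)

end Stab

section Lat

variable {R : Type u} [CommRing R] [IsLocalRing R] (xs : List R)
  (Λ : Type u) [Ring Λ] [Algebra R Λ]

/-- The working form of the notion of a lattice, relative to a fixed sequence `xs` of length
`dim R` in the maximal ideal; the zero module is allowed. -/
def IsLat (M : Type u) [AddCommGroup M] [Module Λ M] [Module R M] [IsScalarTower R Λ M] : Prop :=
  Module.Finite Λ M ∧ IsWeaklyRegular M xs ∧ ∃ k, maximalIdeal R ^ k ≤ stabIdeal R Λ M

variable {xs Λ}
variable {M N L : Type u} [AddCommGroup M] [Module Λ M] [AddCommGroup N] [Module Λ N]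
  [AddCommGroup L] [Module Λ L]
variable [Module R M] [IsScalarTower R Λ M] [Module R N] [IsScalarTower R Λ N]
  [Module R L] [IsScalarTower R Λ L]

lemma IsLat.retract (hM : IsLat xs Λ M) (i : L →ₗ[Λ] M) (p : M →ₗ[Λ] L)
    (h : p ∘ₗ i = LinearMap.id) : IsLat xs Λ L := by
  obtain ⟨h1, h2, k, hk⟩ := hM
  refine ⟨Module.Finite.of_surjective p fun l => ⟨i l, LinearMap.congr_fun h l⟩,
    isWeaklyRegular_retract (i.restrictScalars R) (p.restrictScalars R) ?_ xs h2,
    k, hk.trans (stabIdeal_le_retract i p h)⟩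
  ext l
  exact LinearMap.congr_fun h l

lemma IsLat.equiv (hM : IsLat xs Λ M) (e : M ≃ₗ[Λ] L) : IsLat xs Λ L :=
  hM.retract e.symm.toLinearMap e.toLinearMap (by ext; simp)

lemma IsLat.kernel [IsNoetherianRing Λ] (hM : IsLat xs Λ M) (hN : IsLat xs Λ N)
    (f : L →ₗ[Λ] M) (g : M →ₗ[Λ] N)
    (hf : Function.Injective f) (hg : Function.Surjective g) (hfg : Function.Exact f g) :
    IsLat xs Λ L := by
  obtain ⟨h1, h2, k, hk⟩ := hM
  obtain ⟨h1', h2', k', hk'⟩ := hN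
  refine ⟨Module.Finite.of_injective f hf, isWeaklyRegular_kernel (f.restrictScalars R)
    (g.restrictScalars R) hf hg hfg xs h2 h2', k + k', ?_⟩
  rw [pow_add]
  exact (Ideal.mul_mono hk hk').trans (stabIdeal_mul_le_kernel f g hf hg hfg)

lemma IsLat.ker [IsNoetherianRing Λ] (hM : IsLat xs Λ M) (hN : IsLat xs Λ N)
    (g : M →ₗ[Λ] N) (hg : Function.Surjective g) : IsLat xs Λ (LinearMap.ker g) :=
  hM.kernel hN (LinearMap.ker g).subtype g (Submodule.subtype_injective _) hg
    (LinearMap.exact_subtype_ker_map g)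

lemma IsLat.extension (hL : IsLat xs Λ L) (hN : IsLat xs Λ N)
    (f : L →ₗ[Λ] M) (g : M →ₗ[Λ] N)
    (hf : Function.Injective f) (hg : Function.Surjective g) (hfg : Function.Exact f g) :
    IsLat xs Λ M := by
  obtain ⟨h1, h2, k, hk⟩ := hL
  obtain ⟨h1', h2', k', hk'⟩ := hN
  refine ⟨?_, isWeaklyRegular_extension (f.restrictScalars R)
    (g.restrictScalars R) hf hg hfg xs h2 h2', max k k' + k', ?_⟩
  · have := Module.Finite.range f
    have e := g.quotKerEquivOfSurjective hg
    have hker : LinearMap.ker g = LinearMap.range f := hfg.linearMap_ker_eq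
    have : Module.Finite Λ (LinearMap.ker g) := hker ▸ this
    have : Module.Finite Λ (M ⧸ LinearMap.ker g) := Module.Finite.equiv e.symm
    exact Module.Finite.of_submodule_quotient (LinearMap.ker g)
  · rw [pow_add]
    exact (Ideal.mul_mono (le_inf ((Ideal.pow_le_pow_right (le_max_left _ _)).trans hk)
      ((Ideal.pow_le_pow_right (le_max_right _ _)).trans hk')) hk').trans
      (stabIdeal_mul_le_extension f g hf hg hfg)

lemma IsLat.prod (hM : IsLat xs Λ M) (hN : IsLat xs Λ N) : IsLat xs Λ (M × N) :=
  hM.extension hN (LinearMap.inl Λ M N) (LinearMap.snd Λ M N) LinearMap.inl_injective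
    LinearMap.snd_surjective Function.Exact.inl_snd

lemma IsLat.of_subsingleton [Subsingleton M] : IsLat xs Λ M :=
  ⟨inferInstance, isWeaklyRegular_of_subsingleton _, 0,
    (stabIdeal_of_projective (R := R) (Λ := Λ) (M := M)).symm ▸ le_top⟩

lemma IsLat.free (hΛ : IsWeaklyRegular Λ xs) (n : ℕ) : IsLat xs Λ (Fin n → Λ) := by
  induction n with
  | zero => exact IsLat.of_subsingleton
  | succ n ih =>
    have h1 : IsLat xs Λ Λ := ⟨inferInstance, hΛ, 0,
      (stabIdeal_of_projective (R := R) (Λ := Λ) (M := Λ)).symm ▸ le_top⟩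
    exact (h1.prod ih).equiv (Fin.consLinearEquiv Λ fun _ => Λ)

end Lat

end

section

open RingTheory.Sequence Pointwise

section LatticeIff

variable {R : Type u} [CommRing R] [IsLocalRing R] [IsNoetherianRing R] {xs : List R}
  {Λ : Type u} [Ring Λ] [Algebra R Λ] [Module.Finite R Λ]
  {ω : Type u} [AddCommGroup ω] [Module R ω]

section

variable {M : Type u} [AddCommGroup M] [Module Λ M] [Module R M] [IsScalarTower R Λ M]

lemma IsLattice.isLat (hM : IsLattice R Λ ω M) (hxs : ∀ x ∈ xs, x ∈ maximalIdeal R)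
    (hlen : (xs.length : WithBot ℕ∞) = ringKrullDim R) (hΛ : IsWeaklyRegular Λ xs) :
    IsLat xs Λ M := by
  obtain ⟨h1, h2, h3, -⟩ := hM
  have hfin : Module.Finite R M := Module.Finite.trans Λ M
  obtain ⟨n, q, hq⟩ := Module.Finite.exists_fin' Λ M
  have hst : ∃ k, maximalIdeal R ^ k ≤ stabIdeal R Λ M := by
    refine exists_pow_le_of_prime _ fun p hp hpm => ?_
    obtain ⟨s, hs, h, hh⟩ := h3 p hp hpm _ _ _ q hq
    exact ⟨s, hs, mem_stabIdeal_of_lift (g := q) (h := h) fun m => by rw [hh, algebraMap_smul]⟩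
  refine ⟨h1, ?_, hst⟩
  obtain ⟨k, hk⟩ := hst
  refine h2.isWeaklyRegular hxs hlen k fun s hs => ?_
  obtain ⟨h, hh⟩ := exists_lift_of_mem_stabIdeal (hk hs) hq
  exact ⟨Fin n → Λ, _, _, h.restrictScalars R, q.restrictScalars R,
    (IsLat.free hΛ n).2.1, hh⟩

end

omit [IsNoetherianRing R] [Module.Finite R Λ] in
lemma exists_notMem_of_pow_le {p I : Ideal R} (hp : p.IsPrime) (hpm : p ≠ maximalIdeal R) {k : ℕ}
    (hk : maximalIdeal R ^ k ≤ I) : ∃ s ∉ p, s ∈ I := by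
  by_contra! h
  have h1 : maximalIdeal R ≤ p := hp.le_of_pow_le fun s hs => by
    by_contra hsp
    exact h s hsp (hk hs)
  exact hpm ((maximalIdeal.isMaximal R).eq_of_le hp.ne_top h1).symm

/-- Precomposition, as a map of right modules on the duals. -/
def dualMap {M N : Type u} [AddCommGroup M] [Module Λ M] [Module R M] [IsScalarTower R Λ M]
    [AddCommGroup N] [Module Λ N] [Module R N] [IsScalarTower R Λ N] (f : M →ₗ[Λ] N) :
    (N →ₗ[R] ω) →ₗ[Λᵐᵒᵖ] (M →ₗ[R] ω) where
  toFun φ := φ ∘ₗ f.restrictScalars R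
  map_add' _ _ := rfl
  map_smul' a φ := LinearMap.ext fun m => congrArg φ (map_smul f a.unop m).symm

omit [IsLocalRing R] [IsNoetherianRing R] [Module.Finite R Λ] in
lemma dual_algebraMap_smul {M : Type u} [AddCommGroup M] [Module Λ M] [Module R M]
    [IsScalarTower R Λ M] (s : R) (φ : M →ₗ[R] ω) :
    algebraMap R Λᵐᵒᵖ s • φ = s • φ := by
  ext m
  change φ ((algebraMap R Λᵐᵒᵖ s).unop • m) = s • φ m
  rw [MulOpposite.algebraMap_apply, MulOpposite.unop_op, algebraMap_smul, map_smul]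

omit [IsNoetherianRing R] [Module.Finite R Λ] in
lemma IsLat.dual_locallyProjectiveAt {M : Type u} [AddCommGroup M] [Module Λ M] [Module R M]
    [IsScalarTower R Λ M] (hM : IsLat xs Λ M) {p : Ideal R} (hp : p.IsPrime)
    (hpm : p ≠ maximalIdeal R) (hd : LocallyProjectiveAt R Λᵐᵒᵖ p (Λ →ₗ[R] ω)) :
    LocallyProjectiveAt R Λᵐᵒᵖ p (M →ₗ[R] ω) := by
  intro E _ _ g hg
  obtain ⟨h1, -, k, hk⟩ := hM
  obtain ⟨s, hsp, hs⟩ := exists_notMem_of_pow_le hp hpm hk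
  obtain ⟨n, q, hq⟩ := Module.Finite.exists_fin' Λ M
  obtain ⟨h, hh⟩ := exists_lift_of_mem_stabIdeal hs hq
  have key : ∀ j : Fin n, ∃ t ∉ p, ∃ u : (Λ →ₗ[R] ω) →ₗ[Λᵐᵒᵖ] E, ∀ φ,
      g (u φ) = t • dualMap (LinearMap.proj j ∘ₗ h) φ := by
    intro j
    let D : (Λ →ₗ[R] ω) →ₗ[Λᵐᵒᵖ] (M →ₗ[R] ω) := dualMap (LinearMap.proj j ∘ₗ h)
    let P : Submodule Λᵐᵒᵖ ((Λ →ₗ[R] ω) × E) :=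
      LinearMap.ker (D ∘ₗ LinearMap.fst _ _ _ - g ∘ₗ LinearMap.snd _ _ _)
    obtain ⟨t, ht, u, hu⟩ := hd P _ _ (LinearMap.fst _ _ _ ∘ₗ P.subtype) (fun φ => by
      obtain ⟨e, he⟩ := hg (D φ)
      exact ⟨⟨(φ, e), by simp [P, he]⟩, rfl⟩)
    refine ⟨t, ht, LinearMap.snd _ _ _ ∘ₗ P.subtype ∘ₗ u, fun φ => ?_⟩
    have h2 := (u φ).2
    simp only [P, LinearMap.mem_ker, LinearMap.sub_apply, LinearMap.comp_apply, sub_eq_zero,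
      LinearMap.fst_apply, LinearMap.snd_apply] at h2
    have h3 := hu φ
    simp only [LinearMap.comp_apply, Submodule.subtype_apply, LinearMap.fst_apply,
      LinearMap.snd_apply] at h3 ⊢
    rw [← h2, h3, dual_algebraMap_smul]
    rfl
  choose t ht u hu using key
  let e (j : Fin n) : Λ →ₗ[Λ] (Fin n → Λ) := LinearMap.single Λ (fun _ => Λ) j
  refine ⟨s * ∏ j, t j, hp.mul_notMem hsp (fun h => ?_), 
    ∑ j, u j ∘ₗ dualMap ((∏ i ∈ Finset.univ.erase j, t i) • (q ∘ₗ e j)), fun φ => ?_⟩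
  · obtain ⟨j, -, hj⟩ := (hp.prod_mem_iff).1 h
    exact ht j hj
  · rw [LinearMap.sum_apply, map_sum, dual_algebraMap_smul]
    ext m
    have hsum : h m = ∑ j, e j (h m j) := by
      ext i
      simp [e, Finset.sum_apply, Pi.single_apply]
    rw [LinearMap.smul_apply, mul_comm, mul_smul, ← map_smul, ← hh, hsum, map_sum, map_sum,
      Finset.smul_sum, LinearMap.sum_apply]
    refine Finset.sum_congr rfl fun j _ => ?_
    rw [LinearMap.comp_apply, hu, ← Finset.mul_prod_erase _ _ (Finset.mem_univ j), mul_smul]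
    change t j • φ ((∏ i ∈ Finset.univ.erase j, t i) • q (e j (h m j))) = _
    rw [map_smul]

omit [IsNoetherianRing R] in
lemma IsLat.isLattice {M : Type u} [AddCommGroup M] [Module Λ M] [Module R M]
    [IsScalarTower R Λ M] [Nontrivial M] (hM : IsLat xs Λ M)
    (hxs : ∀ x ∈ xs, x ∈ maximalIdeal R)
    (hlen : (xs.length : WithBot ℕ∞) = ringKrullDim R) (hord : IsLattice R Λ ω Λ) :
    IsLattice R Λ ω M := by
  have := hM.1
  have hfin : Module.Finite R M := Module.Finite.trans Λ M
  refine ⟨hM.1, ⟨xs, hxs, (IsLocalRing.isRegular_iff_isWeaklyRegular_of_subset_maximalIdeal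
    hxs).2 hM.2.1, hlen⟩, ?_, fun p hp hpm => hM.dual_locallyProjectiveAt hp hpm
      (hord.2.2.2 p hp hpm)⟩
  intro p hp hpm E _ _ g hg
  obtain ⟨k, hk⟩ := hM.2.2
  obtain ⟨s, hsp, hs⟩ := exists_notMem_of_pow_le hp hpm hk
  obtain ⟨h, hh⟩ := exists_lift_of_mem_stabIdeal hs hg
  exact ⟨s, hsp, h, fun m => by rw [hh, algebraMap_smul]⟩

end LatticeIff

end

section FiniteLength

variable {R : Type u} [CommRing R] [IsLocalRing R] [IsNoetherianRing R]

omit [IsNoetherianRing R] in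
lemma isArtinian_of_maximalIdeal_smul (M : Type u) [AddCommGroup M] [Module R M]
    [Module.Finite R M] (h : ∀ s ∈ maximalIdeal R, ∀ m : M, s • m = 0) : IsArtinian R M := by
  obtain ⟨n, q, hq⟩ := Module.Finite.exists_fin' R M
  have : IsSimpleModule R (R ⧸ maximalIdeal R) :=
    isSimpleModule_iff_isCoatom.2 (Ideal.isMaximal_def.1 inferInstance)
  have : IsArtinian R (Fin n → R ⧸ maximalIdeal R) := inferInstance
  let v (i : Fin n) : R ⧸ maximalIdeal R →ₗ[R] M :=
    Submodule.liftQ (maximalIdeal R) (LinearMap.toSpanSingleton R M (q (Pi.single i 1)))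
      fun s hs => h s hs _
  refine isArtinian_of_surjective _ (∑ i, v i ∘ₗ LinearMap.proj i) fun m => ?_
  obtain ⟨a, rfl⟩ := hq m
  refine ⟨fun i => Submodule.Quotient.mk (a i), ?_⟩
  have : a = ∑ i, a i • (Pi.single i 1 : Fin n → R) := by
    ext j
    simp [Finset.sum_apply, Pi.single_apply]
  conv_rhs => rw [this, map_sum]
  rw [LinearMap.sum_apply]
  refine Finset.sum_congr rfl fun i _ => ?_
  rw [map_smul]
  rfl

lemma isArtinian_of_pow_smul (k : ℕ) (M : Type u) [AddCommGroup M] [Module R M]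
    [Module.Finite R M] (h : ∀ s ∈ maximalIdeal R ^ k, ∀ m : M, s • m = 0) : IsArtinian R M := by
  induction k generalizing M with
  | zero =>
    have : Subsingleton M := subsingleton_of_forall_eq 0 fun m => by
      simpa using h 1 (by simp) m
    infer_instance
  | succ k ih =>
    let N : Submodule R M := maximalIdeal R • ⊤
    refine (isArtinian_iff_submodule_quotient N).2 ⟨ih N fun s hs => ?_,
      isArtinian_of_maximalIdeal_smul _ fun s hs m => ?_⟩
    · have hN : N ≤ LinearMap.ker (LinearMap.lsmul R M s) := by
        refine Submodule.smul_le.2 fun t ht m _ => ?_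
        rw [LinearMap.mem_ker, LinearMap.lsmul_apply, smul_smul]
        exact h _ (by rw [pow_succ]; exact Ideal.mul_mem_mul hs ht) m
      exact fun m => Subtype.ext (hN m.2)
    · obtain ⟨m, rfl⟩ := Submodule.Quotient.mk_surjective _ m
      rw [← Submodule.Quotient.mk_smul, Submodule.Quotient.mk_eq_zero]
      exact Submodule.smul_mem_smul hs trivial

end FiniteLength

section Fitting

variable {R : Type u} [CommRing R] [IsNoetherianRing R] [IsLocalRing R]
  [IsAdicComplete (maximalIdeal R) R]

lemma isAdicComplete_of_finite (M : Type u) [AddCommGroup M] [Module R M] [Module.Finite R M] :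
    IsAdicComplete (maximalIdeal R) M := by
  have hH : IsHausdorff (maximalIdeal R) M :=
    IsHausdorff.of_le_jacobson _ _ (IsLocalRing.maximalIdeal_le_jacobson _)
  refine AdicCompletion.of_bijective_iff.1 ⟨AdicCompletion.of_injective _ _, fun x => ?_⟩
  obtain ⟨t, rfl⟩ := AdicCompletion.ofTensorProduct_surjective_of_finite (maximalIdeal R) M x
  induction t with
  | zero => exact ⟨0, by simp⟩
  | add a b ha hb =>
    obtain ⟨a', ha⟩ := ha
    obtain ⟨b', hb⟩ := hb
    exact ⟨a' + b', by simp [ha, hb]⟩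
  | tmul r m =>
    obtain ⟨s, rfl⟩ := AdicCompletion.of_surjective (maximalIdeal R) R r
    refine ⟨s • m, ?_⟩
    rw [AdicCompletion.ofTensorProduct_tmul, map_smul]
    exact (algebraMap_smul (AdicCompletion (maximalIdeal R) R) s _).symm

lemma exists_idempotent_split {B : Type u} [CommRing B] [Algebra R B] [Module.Finite R B] (b : B) :
    ∃ e c v : B, e * e = e ∧ e = e * (b * c) ∧ 1 - e = (1 - e) * ((1 - b) * v) := by
  let J : Ideal B := (maximalIdeal R).map (algebraMap R B)
  have hB : IsAdicComplete (maximalIdeal R) B := isAdicComplete_of_finite B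
  have hJ : IsAdicComplete J B := (IsAdicComplete.map_algebraMap_iff _ _).2 hB
  have hH : HenselianRing B J := inferInstance
  have hart : IsArtinianRing (B ⧸ J) := by
    have : IsArtinian R (B ⧸ J) := isArtinian_of_maximalIdeal_smul _ fun s hs m => by
      obtain ⟨m, rfl⟩ := Ideal.Quotient.mk_surjective m
      rw [← Ideal.Quotient.mk_eq_mk, ← Submodule.Quotient.mk_smul, Submodule.Quotient.mk_eq_zero,
        Algebra.smul_def]
      exact J.mul_mem_right _ (Ideal.mem_map_of_mem _ hs)
    exact isArtinian_of_tower R this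
  have hunit : ∀ j ∈ J, IsUnit (1 - j) := fun j hj => by
    have := Ideal.mem_jacobson_bot.1 (hH.jac (J.neg_mem hj)) 1
    rwa [mul_one, add_comm, ← sub_eq_add_neg] at this
  obtain ⟨n, y, hy⟩ := IsArtinian.exists_pow_succ_smul_dvd (M := B ⧸ J) (Ideal.Quotient.mk J b) 1
  obtain ⟨y, rfl⟩ := Ideal.Quotient.mk_surjective y
  have hstep : ∀ N, (Ideal.Quotient.mk J b) ^ (n + N) * (Ideal.Quotient.mk J y) ^ N =
      (Ideal.Quotient.mk J b) ^ n := by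
    intro N
    induction N with
    | zero => simp
    | succ N ih =>
      simp only [smul_eq_mul, mul_one, Nat.succ_eq_add_one] at hy
      calc _ = (Ideal.Quotient.mk J b ^ (n + 1) * Ideal.Quotient.mk J y) *
            (Ideal.Quotient.mk J b) ^ N * (Ideal.Quotient.mk J y) ^ N := by ring
        _ = _ := by rw [hy, ← pow_add, ih]
  set β := Ideal.Quotient.mk J b with hβ
  set η := Ideal.Quotient.mk J y with hη
  set N := n + 1 with hN
  have h2 : β ^ (2 * N) * η ^ N = β ^ N := by
    have := hstep N
    calc _ = β * (β ^ (n + N) * η ^ N) := by rw [hN]; ring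
      _ = _ := by rw [this, hN]; ring
  let x : B := b ^ n * y ^ N
  let a₀ : B := b * x
  have ha₀ : Ideal.Quotient.mk J a₀ = β ^ N * η ^ N := by
    simp only [a₀, x, map_mul, map_pow, ← hβ, ← hη, hN]; ring
  have hid : Ideal.Quotient.mk J a₀ * Ideal.Quotient.mk J a₀ = Ideal.Quotient.mk J a₀ := by
    rw [ha₀]
    calc _ = (β ^ (2 * N) * η ^ N) * η ^ N := by ring
      _ = _ := by rw [h2]
  obtain ⟨e, he, hea⟩ := hH.is_henselian (Polynomial.X ^ 2 - Polynomial.X)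
    (Polynomial.monic_X_pow_sub
      (lt_of_le_of_lt Polynomial.degree_X_le (by norm_num))) a₀ (by
      rw [← Ideal.Quotient.eq_zero_iff_mem]
      simp [pow_two, hid]) (by
      refine IsUnit.of_mul_eq_one (Ideal.Quotient.mk J (2 * a₀ - 1)) ?_
      simp only [Polynomial.derivative_sub, Polynomial.derivative_X_pow, Polynomial.derivative_X]
      simp only [Nat.cast_ofNat, Polynomial.eval_sub, Polynomial.eval_mul, Polynomial.eval_ofNat,
        Nat.add_one_sub_one, pow_one,
        Polynomial.eval_X, Polynomial.eval_one, map_sub, map_mul, map_one, map_ofNat]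
      linear_combination 4 * hid)
  have hee : e * e = e := by
    have : e ^ 2 - e = 0 := by simpa [Polynomial.IsRoot] using he
    linear_combination this
  have hqe : Ideal.Quotient.mk J e = β ^ N * η ^ N := by
    rw [← ha₀, Ideal.Quotient.eq]
    exact hea
  have hj' : (1 - e) * b ^ N ∈ J := by
    rw [← Ideal.Quotient.eq_zero_iff_mem, map_mul, map_sub, hqe, map_pow, map_one, ← hβ]
    linear_combination -h2
  obtain ⟨w, hw⟩ := (hunit _ hea).exists_right_inv
  obtain ⟨w', hw'⟩ := (hunit _ hj').exists_right_inv
  refine ⟨e, x * w, (∑ i ∈ Finset.range N, b ^ i) * w', hee, ?_, ?_⟩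
  · have : a₀ = b * x := rfl
    linear_combination (-e) * hw + (-w) * hee + e * w * this
  · have hg := mul_neg_geom_sum b N
    linear_combination (-(1 - e)) * hw' + w' * (-(1 - e)) * hg - w' * b ^ N * hee

section EndFitting

variable {Λ : Type u} [Ring Λ] [Algebra R Λ] [Module.Finite R Λ]
  {M : Type u} [AddCommGroup M] [Module Λ M] [Module R M] [IsScalarTower R Λ M] [Module.Finite Λ M]

omit [IsAdicComplete (maximalIdeal R) R] [IsLocalRing R] in
variable (R Λ M) in
lemma finite_linearMap {N : Type u} [AddCommGroup N] [Module Λ N] [Module R N]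
    [IsScalarTower R Λ N] [Module.Finite Λ N] : Module.Finite R (M →ₗ[Λ] N) := by
  have : Module.Finite R M := Module.Finite.trans Λ M
  have : Module.Finite R N := Module.Finite.trans Λ N
  let φ : (M →ₗ[Λ] N) →ₗ[R] (M →ₗ[R] N) :=
    { toFun := fun f => f.restrictScalars R
      map_add' := fun _ _ => rfl
      map_smul' := fun _ _ => rfl }
  exact Module.Finite.of_injective φ (LinearMap.restrictScalars_injective R)

variable (R) in
include R in
lemma exists_fitting (u : Module.End Λ M) : ∃ e c v : Module.End Λ M, e * e = e ∧
    e = e * (u * c) ∧ 1 - e = (1 - e) * ((1 - u) * v) ∧ Commute u c ∧ Commute e u ∧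
    Commute u v ∧ Commute e v := by
  have : Module.Finite R (Module.End Λ M) := finite_linearMap R Λ M
  let φ : Polynomial R →ₐ[R] Module.End Λ M := Polynomial.aeval u
  let B := Polynomial R ⧸ RingHom.ker φ
  let ψ : B →ₐ[R] Module.End Λ M := Ideal.kerLiftAlg φ
  have : Module.Finite R B := Module.Finite.of_injective ψ.toLinearMap
    (Ideal.kerLiftAlg_injective φ)
  have hu : ψ (Ideal.Quotient.mk _ Polynomial.X) = u := Polynomial.aeval_X u
  obtain ⟨e, c, v, h1, h2, h3⟩ := exists_idempotent_split (R := R)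
    (Ideal.Quotient.mk _ Polynomial.X : B)
  refine ⟨ψ e, ψ c, ψ v, ?_, ?_, ?_, ?_, ?_, ?_, ?_⟩
  · rw [← map_mul, h1]
  · nth_rw 1 [h2, map_mul, map_mul, hu]
  · have := congrArg ψ h3
    simpa only [map_sub, map_one, map_mul, hu] using this
  all_goals
    try nth_rw 1 [← hu]
    exact (Commute.all _ _).map ψ

end EndFitting

end Fitting

section LocalEnd

variable {Λ : Type u} [Ring Λ] {M Y Z : Type u} [AddCommGroup M] [Module Λ M]
  [AddCommGroup Y] [Module Λ Y] [AddCommGroup Z] [Module Λ Z]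

variable (Λ M) in
/-- A nonzero module whose endomorphism ring is local. -/
def EndLocal : Prop :=
  Nontrivial M ∧ ∀ u : Module.End Λ M, Function.Bijective u ∨
    Function.Bijective (1 - u : Module.End Λ M)

lemma isCompl_ker_range_of_idempotent {e : Module.End Λ M} (he : e * e = e) :
    IsCompl (LinearMap.ker e) (LinearMap.range e) := by
  have he' : ∀ m, e (e m) = e m := fun m => LinearMap.congr_fun he m
  refine ⟨Submodule.disjoint_def.2 ?_, codisjoint_iff_le_sup.2 fun m _ => ?_⟩
  · rintro _ h ⟨m, rfl⟩
    rwa [← he' m]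
  · refine Submodule.mem_sup.2 ⟨m - e m, ?_, e m, ⟨m, rfl⟩, by abel⟩
    simp [he']

lemma IsIndecomposable.eq_zero_or_eq_one (hM : IsIndecomposable Λ M) {e : Module.End Λ M}
    (he : e * e = e) : e = 0 ∨ e = 1 := by
  rcases hM.2 _ _ (isCompl_ker_range_of_idempotent he) with h | h
  · right
    refine LinearMap.ext fun m => LinearMap.ker_eq_bot.1 h ?_
    exact LinearMap.congr_fun he m
  · exact Or.inl (LinearMap.range_eq_bot.1 h)

lemma isIndecomposable_of_idempotent [Nontrivial M]
    (h : ∀ e : Module.End Λ M, e * e = e → e = 0 ∨ e = 1) : IsIndecomposable Λ M := by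
  refine ⟨inferInstance, fun A B hAB => ?_⟩
  have hA : ∀ a ∈ A, A.projection B hAB a = a := fun a ha =>
    Submodule.projection_apply_of_mem_left hAB ha
  have hB : ∀ b ∈ B, A.projection B hAB b = 0 := fun b hb =>
    Submodule.projection_apply_of_mem_right hAB hb
  rcases h (A.projection B hAB) (LinearMap.ext fun m =>
    hA _ (Submodule.projection_apply_mem hAB m)) with h0 | h1
  · left
    exact (Submodule.eq_bot_iff _).2 fun a ha => by rw [← hA a ha, h0]; rfl
  · right
    exact (Submodule.eq_bot_iff _).2 fun b hb => by rw [← hB b hb, h1]; rfl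

lemma bijective_of_comp_bijective (hZ : IsIndecomposable Λ Z) [Nontrivial Y] {f : Y →ₗ[Λ] Z}
    {g : Z →ₗ[Λ] Y} (h : Function.Bijective (g ∘ₗ f)) :
    Function.Bijective f ∧ Function.Bijective g := by
  let w := LinearEquiv.ofBijective _ h
  have hw : ∀ y, g (f (w.symm y)) = y := fun y => w.apply_symm_apply y
  let e : Module.End Λ Z := f ∘ₗ w.symm.toLinearMap ∘ₗ g
  have he : e * e = e := LinearMap.ext fun z => by
    simp only [e, Module.End.mul_apply, LinearMap.comp_apply, LinearEquiv.coe_coe, hw]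
  rcases hZ.eq_zero_or_eq_one he with h0 | h1
  · exfalso
    obtain ⟨y, hy⟩ := exists_ne (0 : Y)
    refine hy (w.injective ?_)
    have : f y = 0 := by
      have h1 := LinearMap.congr_fun h0 (f y)
      have h2 : w.symm (g (f y)) = y := w.symm_apply_apply y
      simpa only [e, LinearMap.comp_apply, LinearEquiv.coe_coe, h2,
        LinearMap.zero_apply] using h1
    change g (f y) = w 0
    simp [this]
  · have hf : Function.Bijective f := by
      refine ⟨fun a b hab => h.1 (congrArg g hab), fun z => ⟨w.symm (g z), ?_⟩⟩
      exact LinearMap.congr_fun h1 z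
    refine ⟨hf, ?_⟩
    exact (Function.Bijective.of_comp_iff g hf).1 h

lemma EndLocal.exists_bijective_of_sum (hM : EndLocal Λ M) {ι : Type*} (l : List ι)
    (u : ι → Module.End Λ M) (h : Function.Bijective ((l.map u).sum : Module.End Λ M)) :
    ∃ i ∈ l, Function.Bijective (u i) := by
  induction l generalizing u with
  | nil =>
    exfalso
    obtain ⟨x, y, hxy⟩ := hM.1.exists_pair_ne
    exact hxy (h.1 (by simp))
  | cons a l ih =>
    rw [List.map_cons, List.sum_cons] at h
    let w := LinearEquiv.ofBijective _ h
    let v : Module.End Λ M := w.symm.toLinearMap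
    have hv : v * (u a + (l.map u).sum) = 1 := LinearMap.ext fun m => w.symm_apply_apply m
    have hbv : ∀ x : Module.End Λ M, Function.Bijective (v * x) → Function.Bijective x :=
      fun x hx => (Function.Bijective.of_comp_iff' w.symm.bijective x).1 hx
    rcases hM.2 (v * u a) with h1 | h1
    · exact ⟨a, List.mem_cons_self, hbv _ h1⟩
    · have : 1 - v * u a = (l.map fun i => v * u i).sum := by
        rw [← hv, mul_add, add_sub_cancel_left, List.sum_map_mul_left]
      rw [this] at h1
      obtain ⟨i, hi, hb⟩ := ih _ h1
      exact ⟨i, List.mem_cons_of_mem _ hi, hbv _ hb⟩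

lemma EndLocal.isIndecomposable (hM : EndLocal Λ M) : IsIndecomposable Λ M := by
  have := hM.1
  refine isIndecomposable_of_idempotent fun e he => ?_
  rcases hM.2 e with h | h
  · right
    exact LinearMap.ext fun m => h.1 (LinearMap.congr_fun he m)
  · left
    refine LinearMap.ext fun m => h.1 ?_
    have := LinearMap.congr_fun he m
    simp only [Module.End.mul_apply] at this
    simp [this]

lemma exists_section_of_comp_bijective {f : Y →ₗ[Λ] M} {s : M →ₗ[Λ] Y}
    (h : Function.Bijective (f ∘ₗ s)) : ∃ s' : M →ₗ[Λ] Y, f ∘ₗ s' = LinearMap.id :=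
  ⟨s ∘ₗ (LinearEquiv.ofBijective _ h).symm.toLinearMap,
    LinearMap.ext fun m => (LinearEquiv.ofBijective _ h).apply_symm_apply m⟩

end LocalEnd

section Decomposition

variable {R : Type u} [CommRing R] [IsNoetherianRing R] [IsLocalRing R]
  [IsAdicComplete (maximalIdeal R) R]
  {Λ : Type u} [Ring Λ] [Algebra R Λ] [Module.Finite R Λ]

variable (R) in
include R in
lemma IsIndecomposable.endLocal {M : Type u} [AddCommGroup M] [Module Λ M] [Module R M]
    [IsScalarTower R Λ M] [Module.Finite Λ M] (hM : IsIndecomposable Λ M) : EndLocal Λ M := by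
  refine ⟨hM.1, fun u => ?_⟩
  obtain ⟨e, c, v, he, h1, h2, hc, -, hv, -⟩ := exists_fitting R u
  rw [← Module.End.isUnit_iff, ← Module.End.isUnit_iff]
  rcases hM.eq_zero_or_eq_one he with rfl | rfl
  · right
    rw [sub_zero, one_mul] at h2
    have : Commute (1 - u) v := (Commute.one_left v).sub_left hv
    exact ⟨⟨1 - u, v, h2.symm, by rw [← this.eq, ← h2]⟩, rfl⟩
  · left
    rw [one_mul] at h1
    exact ⟨⟨u, c, h1.symm, by rw [← hc.eq, ← h1]⟩, rfl⟩


variable (R Λ) in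
/-- A `Λ`-module bundled with its compatible `R`-module structure. -/
structure LMod where
  carrier : Type u
  [grp : AddCommGroup carrier]
  [mod : Module Λ carrier]
  [rmod : Module R carrier]
  [tower : IsScalarTower R Λ carrier]

attribute [instance] LMod.grp LMod.mod LMod.rmod LMod.tower

instance : CoeSort (LMod R Λ) (Type u) := ⟨LMod.carrier⟩

variable (R Λ) in
/-- The bundled form of a module. -/
abbrev LMod.of (M : Type u) [AddCommGroup M] [Module Λ M] [Module R M] [IsScalarTower R Λ M] :
    LMod R Λ := ⟨M⟩

variable (R Λ) in
/-- A direct summand of `M`, given by an inclusion and a projection. -/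
structure Summand (M : Type u) [AddCommGroup M] [Module Λ M] where
  obj : LMod R Λ
  inc : obj →ₗ[Λ] M
  proj : M →ₗ[Λ] obj
  proj_inc : proj ∘ₗ inc = LinearMap.id

namespace Summand

variable {M N : Type u} [AddCommGroup M] [Module Λ M] [AddCommGroup N] [Module Λ N]

/-- The idempotent endomorphism attached to a direct summand. -/
def idem (x : Summand R Λ M) : Module.End Λ M := x.inc ∘ₗ x.proj

/-- A direct summand of a direct summand. -/
def trans (i : N →ₗ[Λ] M) (p : M →ₗ[Λ] N) (h : p ∘ₗ i = LinearMap.id) (x : Summand R Λ N) :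
    Summand R Λ M where
  obj := x.obj
  inc := i ∘ₗ x.inc
  proj := x.proj ∘ₗ p
  proj_inc := LinearMap.ext fun z => by
    have h1 := LinearMap.congr_fun h (x.inc z)
    have h2 := LinearMap.congr_fun x.proj_inc z
    simp only [LinearMap.comp_apply, LinearMap.id_apply] at h1 h2 ⊢
    rw [h1, h2]

omit [IsNoetherianRing R] [IsLocalRing R] [IsAdicComplete (maximalIdeal R) R]
  [Module.Finite R Λ] in
lemma sum_idem_trans (i : N →ₗ[Λ] M) (p : M →ₗ[Λ] N) (h : p ∘ₗ i = LinearMap.id)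
    (l : List (Summand R Λ N)) :
    ((l.map (trans i p h)).map idem).sum = i ∘ₗ (l.map idem).sum ∘ₗ p := by
  induction l with
  | nil => simp
  | cons x l ih =>
    simp only [List.map_cons, List.sum_cons, ih, LinearMap.add_comp, LinearMap.comp_add]
    rfl

end Summand

variable (R Λ) in
/-- `M` is a finite direct sum of indecomposable modules. -/
def HasDecomposition (M : Type u) [AddCommGroup M] [Module Λ M] : Prop :=
  ∃ l : List (Summand R Λ M), (∀ x ∈ l, IsIndecomposable Λ x.obj) ∧ (l.map Summand.idem).sum = 1

omit [IsNoetherianRing R] [IsLocalRing R] [IsAdicComplete (maximalIdeal R) R]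
  [Module.Finite R Λ] in
lemma HasDecomposition.of_isCompl {M : Type u} [AddCommGroup M] [Module Λ M]
    {A B : Submodule Λ M} (hAB : IsCompl A B) (hA : HasDecomposition R Λ A)
    (hB : HasDecomposition R Λ B) : HasDecomposition R Λ M := by
  obtain ⟨l, h1, h2⟩ := hA
  obtain ⟨l', h1', h2'⟩ := hB
  have hP : (A.projectionOnto B hAB) ∘ₗ A.subtype = LinearMap.id :=
    LinearMap.ext fun a => Submodule.projectionOnto_apply_left hAB a
  have hP' : (B.projectionOnto A hAB.symm) ∘ₗ B.subtype = LinearMap.id :=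
    LinearMap.ext fun a => Submodule.projectionOnto_apply_left hAB.symm a
  refine ⟨l.map (Summand.trans _ _ hP) ++ l'.map (Summand.trans _ _ hP'), ?_, ?_⟩
  · intro x hx
    simp only [List.mem_append, List.mem_map] at hx
    rcases hx with ⟨y, hy, rfl⟩ | ⟨y, hy, rfl⟩
    · exact h1 y hy
    · exact h1' y hy
  · rw [List.map_append, List.sum_append, Summand.sum_idem_trans, Summand.sum_idem_trans, h2, h2']
    exact LinearMap.ext fun m => Submodule.projection_add_projection_eq_self hAB m

omit [IsNoetherianRing R] [IsLocalRing R] [IsAdicComplete (maximalIdeal R) R]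
  [Module.Finite R Λ] in
variable (R) in
lemma hasDecomposition (M : Type u) [AddCommGroup M] [Module Λ M] [Module R M]
    [IsScalarTower R Λ M] [IsNoetherian Λ M] : HasDecomposition R Λ M := by
  suffices H : ∀ (K : Submodule Λ M) (B : LMod R Λ) (p : M →ₗ[Λ] B), Function.Surjective p →
      LinearMap.ker p = K → HasDecomposition R Λ B from
    H _ (.of R Λ M) LinearMap.id Function.surjective_id rfl
  intro K
  induction K using WellFoundedGT.induction with
  | ind K ih =>
    rintro B p hp rfl
    rcases subsingleton_or_nontrivial B with hB | hB
    · exact ⟨[], by simp, LinearMap.ext fun b => Subsingleton.elim _ _⟩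
    by_cases hi : IsIndecomposable Λ B
    · exact ⟨[⟨B, LinearMap.id, LinearMap.id, rfl⟩], by simpa using hi, by simp [Summand.idem]; rfl⟩
    · have : ∃ C D : Submodule Λ B, IsCompl C D ∧ C ≠ ⊥ ∧ D ≠ ⊥ := by
        by_contra! h
        exact hi ⟨hB, fun C D hCD => or_iff_not_imp_left.2 (h C D hCD)⟩
      have key : ∀ C D : Submodule Λ B, IsCompl C D → D ≠ ⊥ → HasDecomposition R Λ C := by
        intro C D hCD hD
        refine ih (LinearMap.ker (C.projectionOnto D hCD ∘ₗ p)) (lt_of_le_of_ne ?_ ?_)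
          (.of R Λ C) (C.projectionOnto D hCD ∘ₗ p) ?_ rfl
        · exact LinearMap.ker_le_ker_comp _ _
        · intro he
          refine hD ((Submodule.eq_bot_iff _).2 fun d hd => ?_)
          obtain ⟨m, rfl⟩ := hp d
          have hm : m ∈ LinearMap.ker p := by
            rw [he, LinearMap.mem_ker]
            exact (Submodule.projectionOnto_apply_eq_zero_iff hCD).2 hd
          exact hm
        · exact (Submodule.projectionOnto_surjective hCD).comp hp
      obtain ⟨C, D, hCD, hC, hD⟩ := this
      exact HasDecomposition.of_isCompl hCD (key C D hCD hD) (key D C hCD.symm hC)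

omit [IsNoetherianRing R] [IsLocalRing R] [IsAdicComplete (maximalIdeal R) R]
  [Module.Finite R Λ] in
/-- An indecomposable direct summand with local endomorphism ring occurs in every decomposition. -/
lemma EndLocal.exists_summand {M Y : Type u} [AddCommGroup M] [Module Λ M]
    [AddCommGroup Y] [Module Λ Y] (hY : EndLocal Λ Y) {i : Y →ₗ[Λ] M} {p : M →ₗ[Λ] Y}
    (h : Function.Bijective (p ∘ₗ i)) {l : List (Summand R Λ M)}
    (hl : ∀ x ∈ l, IsIndecomposable Λ x.obj) (hs : (l.map Summand.idem).sum = 1) :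
    ∃ x ∈ l, Function.Bijective (x.proj ∘ₗ i) ∧ Function.Bijective (p ∘ₗ x.inc) := by
  have hsum : (l.map fun x => p ∘ₗ x.idem ∘ₗ i).sum = p ∘ₗ i := by
    have : ∀ l : List (Summand R Λ M), (l.map fun x => p ∘ₗ x.idem ∘ₗ i).sum =
        p ∘ₗ (l.map Summand.idem).sum ∘ₗ i := fun l => by
      induction l with
      | nil => simp
      | cons x l ih =>
        simp only [List.map_cons, List.sum_cons, LinearMap.add_comp, LinearMap.comp_add]
        rw [ih]
    rw [this, hs]
    rfl
  obtain ⟨x, hx, hb⟩ := hY.exists_bijective_of_sum l (fun x => p ∘ₗ x.idem ∘ₗ i) (by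
    rw [hsum]; exact h)
  have := hY.1
  exact ⟨x, hx, bijective_of_comp_bijective (hl x hx) (f := x.proj ∘ₗ i) (g := p ∘ₗ x.inc) hb⟩

end Decomposition

section Minimal

variable {R : Type u} [CommRing R] [IsNoetherianRing R] [IsLocalRing R]
  [IsAdicComplete (maximalIdeal R) R]
  {Λ : Type u} [Ring Λ] [Algebra R Λ] [Module.Finite R Λ]

variable (R) in
lemma exists_rightMinimal {E M : Type u} [AddCommGroup E] [Module Λ E] [Module R E]
    [IsScalarTower R Λ E] [Module.Finite Λ E] [AddCommGroup M] [Module Λ M] (g : E →ₗ[Λ] M) :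
    ∃ (B : LMod R Λ) (p : E →ₗ[Λ] B) (s : B →ₗ[Λ] E) (g' : B →ₗ[Λ] M),
      p ∘ₗ s = LinearMap.id ∧ g' ∘ₗ p = g ∧ RightMinimal Λ g' := by
  have : IsNoetherianRing Λ := IsNoetherianRing.of_finite R Λ
  let 𝒮 : Set (Submodule Λ E) := {K | ∃ (B : LMod R Λ) (p : E →ₗ[Λ] B) (s : B →ₗ[Λ] E)
    (g' : B →ₗ[Λ] M), p ∘ₗ s = LinearMap.id ∧ g' ∘ₗ p = g ∧ LinearMap.ker p = K}
  have h𝒮 : 𝒮.Nonempty := ⟨_, .of R Λ E, LinearMap.id, LinearMap.id, g, rfl, rfl, rfl⟩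
  obtain ⟨K, ⟨B, p, s, g', hps, hg, rfl⟩, hmax⟩ := set_has_maximal_iff_noetherian.2
    (inferInstanceAs (IsNoetherian Λ E)) 𝒮 h𝒮
  have hps' : ∀ b, p (s b) = b := fun b => LinearMap.congr_fun hps b
  have : Module.Finite Λ B := Module.Finite.of_surjective p fun b => ⟨s b, hps' b⟩
  refine ⟨B, p, s, g', hps, hg, fun u hu => ?_⟩
  obtain ⟨e, c, v, he, h1, h2, hc, heu, -, hev⟩ := exists_fitting R u
  have hu' : ∀ b, g' (u b) = g' b := fun b => LinearMap.congr_fun hu b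
  have he' : ∀ b, e (e b) = e b := fun b => LinearMap.congr_fun he b
  have hcomm : (1 - e) * ((1 - u) * v) = (1 - u) * v * (1 - e) :=
    (((Commute.one_right (1 - e)).sub_right ((Commute.one_left u).sub_left heu)).mul_right
      ((Commute.one_left v).sub_left hev)).eq
  have hge : ∀ b, g' (e b) = g' b := by
    intro b
    have h3 := LinearMap.congr_fun (h2.trans hcomm) b
    simp only [LinearMap.sub_apply, Module.End.one_apply, Module.End.mul_apply] at h3
    have h4 := congrArg g' h3
    rw [map_sub, map_sub, hu', sub_self, sub_eq_zero] at h4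
    exact h4.symm
  have he1 : e = 1 := by
    by_contra hne
    refine hmax (LinearMap.ker (e.rangeRestrict ∘ₗ p)) ⟨.of R Λ (LinearMap.range e),
      e.rangeRestrict ∘ₗ p, s ∘ₗ (LinearMap.range e).subtype,
      g' ∘ₗ (LinearMap.range e).subtype, ?_, ?_, rfl⟩ ?_
    · refine LinearMap.ext ?_
      rintro ⟨_, b, rfl⟩
      exact Subtype.ext (by simp [hps', he'])
    · rw [← hg]
      exact LinearMap.ext fun m => hge _
    · refine lt_of_le_of_ne (LinearMap.ker_le_ker_comp _ _) fun hk => hne ?_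
      refine LinearMap.ext fun b => ?_
      have : s (b - e b) ∈ LinearMap.ker p := by
        rw [hk, LinearMap.mem_ker]
        exact Subtype.ext (by simp [hps', he'])
      rw [LinearMap.mem_ker, hps', sub_eq_zero] at this
      exact this.symm
  rw [he1, one_mul] at h1
  rw [← Module.End.isUnit_iff]
  exact ⟨⟨u, c, h1.symm, by rw [← hc.eq, ← h1]⟩, rfl⟩

end Minimal

section Pushout

variable {Λ : Type u} [Ring Λ] {N E M Z T : Type u} [AddCommGroup N] [Module Λ N]
  [AddCommGroup E] [Module Λ E] [AddCommGroup M] [Module Λ M] [AddCommGroup Z] [Module Λ Z]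
  [AddCommGroup T] [Module Λ T]

/-- The pushout of two module homomorphisms. -/
abbrev Pushout (i : N →ₗ[Λ] E) (j : N →ₗ[Λ] Z) : Type u :=
  (Z × E) ⧸ LinearMap.range (j.prod (-i))

variable (i : N →ₗ[Λ] E) (j : N →ₗ[Λ] Z)

namespace Pushout

/-- The first structure map of the pushout. -/
def inl : Z →ₗ[Λ] Pushout i j := (Submodule.mkQ _) ∘ₗ LinearMap.inl Λ Z E

/-- The second structure map of the pushout. -/
def inr : E →ₗ[Λ] Pushout i j := (Submodule.mkQ _) ∘ₗ LinearMap.inr Λ Z E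

/-- The universal property of the pushout. -/
def desc (a : Z →ₗ[Λ] T) (b : E →ₗ[Λ] T) (h : a ∘ₗ j = b ∘ₗ i) : Pushout i j →ₗ[Λ] T :=
  Submodule.liftQ _ (a.coprod b) (by
    rintro _ ⟨n, rfl⟩
    have := LinearMap.congr_fun h n
    simp only [LinearMap.comp_apply] at this
    simp [this])

variable {i j}

lemma condition (n : N) : inl i j (j n) = inr i j (i n) := by
  rw [← sub_eq_zero]
  simp only [inl, inr, LinearMap.comp_apply, ← map_sub]
  exact (Submodule.Quotient.mk_eq_zero _).2 ⟨n, by simp⟩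

lemma exists_rep (w : Pushout i j) : ∃ z e, w = inl i j z + inr i j e := by
  obtain ⟨⟨z, e⟩, rfl⟩ := Submodule.Quotient.mk_surjective _ w
  refine ⟨z, e, ?_⟩
  simp only [inl, inr, LinearMap.comp_apply, ← map_add]
  simp

@[simp] lemma desc_inl {a : Z →ₗ[Λ] T} {b : E →ₗ[Λ] T} (h : a ∘ₗ j = b ∘ₗ i) (z : Z) :
    desc i j a b h (inl i j z) = a z := by
  simp [desc, inl]

@[simp] lemma desc_inr {a : Z →ₗ[Λ] T} {b : E →ₗ[Λ] T} (h : a ∘ₗ j = b ∘ₗ i) (e : E) :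
    desc i j a b h (inr i j e) = b e := by
  simp [desc, inr]

lemma inl_injective (hi : Function.Injective i) : Function.Injective (inl i j) := by
  refine (injective_iff_map_eq_zero _).2 fun z hz => ?_
  obtain ⟨n, hn⟩ := (Submodule.Quotient.mk_eq_zero _).1 hz
  have h1 : j n = z := congrArg Prod.fst hn
  have h2 : -i n = 0 := congrArg Prod.snd hn
  rw [← h1, hi ((neg_eq_zero.1 h2).trans (map_zero i).symm), map_zero]

variable {g : E →ₗ[Λ] M} (hig : ∀ n, g (i n) = 0)

variable (j) in
/-- The map from the pushout to the cokernel of `i`. -/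
def toCoker : Pushout i j →ₗ[Λ] M := desc i j 0 g (by ext n; simp [hig])

lemma toCoker_surjective (hg : Function.Surjective g) : Function.Surjective (toCoker j hig) :=
  fun m => (hg m).elim fun e he => ⟨inr i j e, by rw [toCoker, desc_inr, he]⟩

lemma exact_toCoker (hex : Function.Exact i g) : Function.Exact (inl i j) (toCoker j hig) := by
  intro w
  constructor
  · obtain ⟨z, e, rfl⟩ := exists_rep w
    intro h
    rw [toCoker, map_add, desc_inl, desc_inr, LinearMap.zero_apply, zero_add] at h
    obtain ⟨n, rfl⟩ := (hex e).1 h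
    exact ⟨z + j n, by rw [map_add, condition]⟩
  · rintro ⟨z, rfl⟩
    simp [toCoker]

end Pushout
end Pushout

section Snake

variable {Λ : Type u} [Ring Λ] {X₁ X X₂ C₁ C C₂ : Type u} [AddCommGroup X₁] [Module Λ X₁]
  [AddCommGroup X] [Module Λ X] [AddCommGroup X₂] [Module Λ X₂] [AddCommGroup C₁] [Module Λ C₁]
  [AddCommGroup C] [Module Λ C] [AddCommGroup C₂] [Module Λ C₂]
  {f : X₁ →ₗ[Λ] X} {g : X →ₗ[Λ] X₂} {f' : C₁ →ₗ[Λ] C} {g' : C →ₗ[Λ] C₂}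
  {π₁ : X₁ →ₗ[Λ] C₁} {π : X →ₗ[Λ] C} {π₂ : X₂ →ₗ[Λ] C₂}

lemma surjective_of_extension (hg : Function.Surjective g) (hex' : Function.Exact f' g')
    (h₁ : ∀ x, π (f x) = f' (π₁ x)) (h₂ : ∀ x, g' (π x) = π₂ (g x))
    (hπ₁ : Function.Surjective π₁) (hπ₂ : Function.Surjective π₂) : Function.Surjective π := by
  intro c
  obtain ⟨x₂, hx₂⟩ := hπ₂ (g' c)
  obtain ⟨x, rfl⟩ := hg x₂
  obtain ⟨c₁, hc₁⟩ := (hex' (c - π x)).1 (by rw [map_sub, h₂, hx₂, sub_self])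
  obtain ⟨x₁, rfl⟩ := hπ₁ c₁
  exact ⟨x + f x₁, by rw [map_add, h₁, hc₁, add_sub_cancel]⟩

lemma exists_kernel_extension (hf : Function.Injective f) (hg : Function.Surjective g)
    (hex : Function.Exact f g)
    (hf' : Function.Injective f') (hex' : Function.Exact f' g')
    (h₁ : ∀ x, π (f x) = f' (π₁ x)) (h₂ : ∀ x, g' (π x) = π₂ (g x))
    (hπ₁ : Function.Surjective π₁) :
    ∃ h : LinearMap.ker π →ₗ[Λ] LinearMap.ker π₂, Function.Surjective h ∧
      Nonempty (LinearMap.ker π₁ ≃ₗ[Λ] LinearMap.ker h) := by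
  have hm : ∀ x ∈ LinearMap.ker π, g x ∈ LinearMap.ker π₂ := fun x hx => by
    rw [LinearMap.mem_ker, ← h₂, LinearMap.mem_ker.1 hx, map_zero]
  refine ⟨g.restrict hm, ?_, ⟨?_⟩⟩
  · rintro ⟨x₂, hx₂⟩
    obtain ⟨x, rfl⟩ := hg x₂
    rw [LinearMap.mem_ker] at hx₂
    obtain ⟨c₁, hc₁⟩ := (hex' (π x)).1 (by rw [h₂, hx₂])
    obtain ⟨x₁, rfl⟩ := hπ₁ c₁
    exact ⟨⟨x - f x₁, by rw [LinearMap.mem_ker, map_sub, h₁, hc₁, sub_self]⟩,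
      Subtype.ext (by simp [hex.apply_apply_eq_zero])⟩
  · let k : LinearMap.ker π₁ →ₗ[Λ] LinearMap.ker π := f.restrict fun x hx => by
      rw [LinearMap.mem_ker, h₁, LinearMap.mem_ker.1 hx, map_zero]
    let k' : LinearMap.ker π₁ →ₗ[Λ] LinearMap.ker (g.restrict hm) := k.codRestrict _ fun x => by
      rw [LinearMap.mem_ker]
      exact Subtype.ext (hex.apply_apply_eq_zero x.1)
    refine LinearEquiv.ofBijective k' ⟨fun a b hab => ?_, ?_⟩
    · exact Subtype.ext (hf (congrArg (fun z => z.1.1) hab))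
    · rintro ⟨⟨x, hx⟩, hx'⟩
      rw [LinearMap.mem_ker] at hx'
      obtain ⟨x₁, rfl⟩ := (hex x).1 (congrArg Subtype.val hx')
      refine ⟨⟨x₁, ?_⟩, rfl⟩
      rw [LinearMap.mem_ker, h₁] at hx
      exact hf' (hx.trans (map_zero f').symm)

end Snake

section RelInj

variable {R : Type u} [CommRing R] [IsLocalRing R] (xs : List R)
  (Λ : Type u) [Ring Λ] [Algebra R Λ]

/-- Injectivity of `Y` relative to the lattices: `Ext¹(T, Y) = 0` for all lattices `T`, phrased
through free presentations of `T`. -/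
def RelInj (Y : Type u) [AddCommGroup Y] [Module Λ Y] : Prop :=
  ∀ (T : LMod R Λ), IsLat xs Λ T → ∀ (n : ℕ) (q : (Fin n → Λ) →ₗ[Λ] T), Function.Surjective q →
    ∀ φ : LinearMap.ker q →ₗ[Λ] Y, ∃ ψ : (Fin n → Λ) →ₗ[Λ] Y, ∀ x : LinearMap.ker q, ψ x = φ x

/-- `Y` is the quotient of a relatively injective lattice by a relatively injective module. -/
def LatResolved (Y : Type u) [AddCommGroup Y] [Module Λ Y] : Prop :=
  ∃ (L : LMod R Λ) (p : L →ₗ[Λ] Y), IsLat xs Λ L ∧ Function.Surjective p ∧ RelInj xs Λ L ∧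
    RelInj xs Λ (LinearMap.ker p)

/-- `C` has a lattice approximation. -/
def HasApprox (C : Type u) [AddCommGroup C] [Module Λ C] : Prop :=
  ∃ (X : LMod R Λ) (p : X →ₗ[Λ] C), IsLat xs Λ X ∧ Function.Surjective p ∧
    LatResolved xs Λ (LinearMap.ker p)

variable {xs Λ}
variable {Y E C : Type u} [AddCommGroup Y] [Module Λ Y] [AddCommGroup E] [Module Λ E]
  [AddCommGroup C] [Module Λ C]

lemma RelInj.of_subsingleton [Subsingleton Y] : RelInj xs Λ Y :=
  fun _ _ _ _ _ _ => ⟨0, fun _ => Subsingleton.elim _ _⟩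

lemma RelInj.equiv (hY : RelInj xs Λ Y) (e : Y ≃ₗ[Λ] E) : RelInj xs Λ E := by
  intro T hT n q hq φ
  obtain ⟨ψ, hψ⟩ := hY T hT n q hq (e.symm.toLinearMap ∘ₗ φ)
  exact ⟨e.toLinearMap ∘ₗ ψ, fun x => by simp [hψ]⟩

lemma RelInj.exists_lift {g : E →ₗ[Λ] C} (hg : Function.Surjective g)
    (h : RelInj xs Λ (LinearMap.ker g)) {T : Type u} [AddCommGroup T] [Module Λ T] [Module R T]
    [IsScalarTower R Λ T] (hT : IsLat xs Λ T) (f : T →ₗ[Λ] C) : ∃ k : T →ₗ[Λ] E, g ∘ₗ k = f := by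
  have := hT.1
  obtain ⟨n, q, hq⟩ := Module.Finite.exists_fin' Λ T
  obtain ⟨γ, hγ⟩ := Module.projective_lifting_property g (f ∘ₗ q) hg
  have hγ' : ∀ x, g (γ x) = f (q x) := fun x => LinearMap.congr_fun hγ x
  obtain ⟨ψ, hψ⟩ := h (.of R Λ T) hT n q hq (γ.restrict fun x hx => by
    rw [LinearMap.mem_ker, hγ', LinearMap.mem_ker.1 hx, map_zero])
  let δ : (Fin n → Λ) →ₗ[Λ] E := γ - (LinearMap.ker g).subtype ∘ₗ ψ
  have hδ : LinearMap.ker q ≤ LinearMap.ker δ := fun x hx => by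
    have := hψ ⟨x, hx⟩
    simp only at this
    rw [LinearMap.mem_ker]
    simp [δ, this]
  refine ⟨(LinearMap.ker q).liftQ δ hδ ∘ₗ (q.quotKerEquivOfSurjective hq).symm.toLinearMap,
    LinearMap.ext fun t => ?_⟩
  obtain ⟨x, rfl⟩ := hq t
  have h1 : (q.quotKerEquivOfSurjective hq).symm (q x) = Submodule.Quotient.mk x := by
    rw [LinearEquiv.symm_apply_eq]
    rfl
  simp only [LinearMap.comp_apply, LinearEquiv.coe_coe, h1]
  have h2 : g (ψ x) = 0 := (ψ x).2
  simp [δ, hγ', h2]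

lemma RelInj.extension {p : E →ₗ[Λ] C} (hp : Function.Surjective p)
    (h1 : RelInj xs Λ (LinearMap.ker p)) (h2 : RelInj xs Λ C) : RelInj xs Λ E := by
  intro T hT n q hq φ
  obtain ⟨ψ', hψ'⟩ := h2 T hT n q hq (p ∘ₗ φ)
  obtain ⟨ψ, rfl⟩ := Module.projective_lifting_property p ψ' hp
  obtain ⟨χ, hχ⟩ := h1 T hT n q hq ((φ - ψ ∘ₗ (LinearMap.ker q).subtype).codRestrict _ fun x => by
    have := hψ' x
    simp only [LinearMap.comp_apply] at this
    simp [this])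
  refine ⟨ψ + (LinearMap.ker p).subtype ∘ₗ χ, fun x => ?_⟩
  have h3 : (χ x : E) = φ x - ψ x := congrArg Subtype.val (hχ x)
  simp [h3]

lemma RelInj.prod (h1 : RelInj xs Λ E) (h2 : RelInj xs Λ C) : RelInj xs Λ (E × C) := by
  intro T hT n q hq φ
  obtain ⟨ψ, hψ⟩ := h1 T hT n q hq (LinearMap.fst Λ E C ∘ₗ φ)
  obtain ⟨χ, hχ⟩ := h2 T hT n q hq (LinearMap.snd Λ E C ∘ₗ φ)
  exact ⟨ψ.prod χ, fun x => Prod.ext (hψ x) (hχ x)⟩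

lemma RelInj.of_surjective [IsNoetherianRing Λ] (hΛ : RingTheory.Sequence.IsWeaklyRegular Λ xs)
    {p : E →ₗ[Λ] C}
    (hp : Function.Surjective p)
    (h1 : RelInj xs Λ E) (h2 : RelInj xs Λ (LinearMap.ker p)) : RelInj xs Λ C := by
  intro T hT n q hq φ
  obtain ⟨k, rfl⟩ := h2.exists_lift hp ((IsLat.free hΛ n).ker hT q hq) φ
  obtain ⟨ψ, hψ⟩ := h1 T hT n q hq k
  exact ⟨p ∘ₗ ψ, fun x => by simp [hψ]⟩

lemma LatResolved.relInj [IsNoetherianRing Λ] (hΛ : RingTheory.Sequence.IsWeaklyRegular Λ xs)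
    (hY : LatResolved xs Λ Y) : RelInj xs Λ Y := by
  obtain ⟨L, p, -, hp, h1, h2⟩ := hY
  exact RelInj.of_surjective hΛ hp h1 h2

lemma LatResolved.equiv (hY : LatResolved xs Λ Y) (e : Y ≃ₗ[Λ] E) : LatResolved xs Λ E := by
  obtain ⟨L, p, hL, hp, h1, h2⟩ := hY
  refine ⟨L, e.toLinearMap ∘ₗ p, hL, e.surjective.comp hp, h1, ?_⟩
  exact h2.equiv (LinearEquiv.ofEq _ _ (LinearEquiv.ker_comp e p).symm)

lemma LatResolved.of_subsingleton [Subsingleton Y] : LatResolved xs Λ Y :=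
  ⟨.of R Λ PUnit, 0, IsLat.of_subsingleton, fun _ => ⟨0, Subsingleton.elim _ _⟩,
    RelInj.of_subsingleton, RelInj.of_subsingleton⟩

lemma LatResolved.extension [IsNoetherianRing Λ] (hΛ : RingTheory.Sequence.IsWeaklyRegular Λ xs)
    {p : E →ₗ[Λ] C}
    (hp : Function.Surjective p)
    (h1 : LatResolved xs Λ (LinearMap.ker p)) (h2 : LatResolved xs Λ C) : LatResolved xs Λ E := by
  have hr := h1.relInj hΛ
  obtain ⟨L₁, p₁, hL₁, hp₁, hi₁, hk₁⟩ := h1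
  obtain ⟨L₂, p₂, hL₂, hp₂, hi₂, hk₂⟩ := h2
  obtain ⟨k, rfl⟩ := hr.exists_lift hp hL₂ p₂
  let π : (L₁ × L₂) →ₗ[Λ] E := ((LinearMap.ker p).subtype ∘ₗ p₁).coprod k
  have c₁ : ∀ x, π (LinearMap.inl Λ L₁ L₂ x) = (LinearMap.ker p).subtype (p₁ x) := by simp [π]
  have c₂ : ∀ x, p (π x) = (p ∘ₗ k) (LinearMap.snd Λ L₁ L₂ x) := by simp [π]
  have hex := LinearMap.exact_subtype_ker_map p
  refine ⟨.of R Λ (L₁ × L₂), π, hL₁.prod hL₂, surjective_of_extension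
    LinearMap.snd_surjective hex c₁ c₂ hp₁ hp₂, hi₁.prod hi₂, ?_⟩
  obtain ⟨h, hh, ⟨e⟩⟩ := exists_kernel_extension LinearMap.inl_injective LinearMap.snd_surjective
    Function.Exact.inl_snd (Submodule.subtype_injective _) hex c₁ c₂ hp₁
  exact RelInj.extension hh (hk₁.equiv e) hk₂

lemma HasApprox.equiv (hY : HasApprox xs Λ Y) (e : Y ≃ₗ[Λ] E) : HasApprox xs Λ E := by
  obtain ⟨L, p, hL, hp, h1⟩ := hY
  refine ⟨L, e.toLinearMap ∘ₗ p, hL, e.surjective.comp hp, ?_⟩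
  exact h1.equiv (LinearEquiv.ofEq _ _ (LinearEquiv.ker_comp e p).symm)

lemma HasApprox.of_subsingleton [Subsingleton Y] : HasApprox xs Λ Y :=
  ⟨.of R Λ PUnit, 0, IsLat.of_subsingleton, fun _ => ⟨0, Subsingleton.elim _ _⟩,
    LatResolved.of_subsingleton⟩

lemma HasApprox.extension [IsNoetherianRing Λ] (hΛ : RingTheory.Sequence.IsWeaklyRegular Λ xs)
    {p : E →ₗ[Λ] C}
    (hp : Function.Surjective p)
    (h1 : HasApprox xs Λ (LinearMap.ker p)) (h2 : HasApprox xs Λ C) : HasApprox xs Λ E := by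
  obtain ⟨X₁, π₁, hX₁, hπ₁, hk₁⟩ := h1
  obtain ⟨X₂, π₂, hX₂, hπ₂, hk₂⟩ := h2
  have := hX₂.1
  obtain ⟨n, q, hq⟩ := Module.Finite.exists_fin' Λ X₂
  obtain ⟨γ, hγ⟩ := Module.projective_lifting_property p (π₂ ∘ₗ q) hp
  have hγ' : ∀ x, p (γ x) = π₂ (q x) := fun x => LinearMap.congr_fun hγ x
  obtain ⟨δ, hδ⟩ := (hk₁.relInj hΛ).exists_lift hπ₁ ((IsLat.free hΛ n).ker hX₂ q hq)
    (γ.restrict fun x hx => by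
      rw [LinearMap.mem_ker, hγ', LinearMap.mem_ker.1 hx, map_zero])
  have hδ' : ∀ x, (π₁ (δ x) : E) = γ x := fun x => congrArg Subtype.val (LinearMap.congr_fun hδ x)
  let i := (LinearMap.ker q).subtype
  have hig : ∀ x, q (i x) = 0 := fun x => x.2
  let π : Pushout i δ →ₗ[Λ] E := Pushout.desc i δ ((LinearMap.ker p).subtype ∘ₗ π₁) γ
    (LinearMap.ext hδ')
  have hex := LinearMap.exact_subtype_ker_map p
  have hinj : Function.Injective (Pushout.inl i δ) :=
    Pushout.inl_injective (Submodule.subtype_injective _)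
  have hsur := Pushout.toCoker_surjective (j := δ) hig hq
  have hex' := Pushout.exact_toCoker (j := δ) hig (LinearMap.exact_subtype_ker_map q)
  have c₁ : ∀ x, π (Pushout.inl i δ x) = (LinearMap.ker p).subtype (π₁ x) := by simp [π]
  have c₂ : ∀ x, p (π x) = π₂ (Pushout.toCoker δ hig x) := fun x => by
    obtain ⟨z, e, rfl⟩ := Pushout.exists_rep x
    simp [π, Pushout.toCoker, hγ']
  refine ⟨.of R Λ (Pushout i δ), π, hX₁.extension hX₂ (Pushout.inl i δ) (Pushout.toCoker δ hig)
    hinj hsur hex', surjective_of_extension hsur hex c₁ c₂ hπ₁ hπ₂, ?_⟩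
  obtain ⟨h, hh, ⟨e⟩⟩ := exists_kernel_extension hinj hsur hex' (Submodule.subtype_injective _)
    hex c₁ c₂ hπ₁
  exact LatResolved.extension hΛ hh (hk₁.equiv e) hk₂

end RelInj

section FiniteLengthApprox

variable {R : Type u} [CommRing R] [IsLocalRing R] {xs : List R}
  {Λ : Type u} [Ring Λ] [Algebra R Λ]

lemma relInj_of_ext1Vanishes {Y : Type u} [AddCommGroup Y] [Module Λ Y]
    (h : ∀ T : LMod R Λ, Nontrivial T → IsLat xs Λ T → Ext1Vanishes Λ T Y) : RelInj xs Λ Y := by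
  intro T hT n q hq φ
  rcases subsingleton_or_nontrivial T with hs | hs
  · exact ⟨φ ∘ₗ LinearMap.id.codRestrict _ fun x => Subsingleton.elim _ _, fun x => rfl⟩
  let i := (LinearMap.ker q).subtype
  have hig : ∀ x, q (i x) = 0 := fun x => x.2
  have hinj : Function.Injective (Pushout.inl i φ) :=
    Pushout.inl_injective (Submodule.subtype_injective _)
  have hex := Pushout.exact_toCoker (j := φ) hig (LinearMap.exact_subtype_ker_map q)
  have hr : LinearMap.ker (Pushout.toCoker φ hig) = LinearMap.range (Pushout.inl i φ) :=
    LinearMap.exact_iff.1 hex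
  let e : Y ≃ₗ[Λ] LinearMap.ker (Pushout.toCoker φ hig) :=
    (LinearEquiv.ofInjective _ hinj).trans (LinearEquiv.ofEq _ _ hr.symm)
  have he : ∀ y, (e y : Pushout i φ) = Pushout.inl i φ y := fun y => rfl
  obtain ⟨s, hs⟩ := h T hs hT _ _ _ (Pushout.toCoker φ hig)
    (Pushout.toCoker_surjective hig hq) ⟨e.symm⟩
  have hs' : ∀ t, Pushout.toCoker φ hig (s t) = t := fun t => LinearMap.congr_fun hs t
  let ρ : Pushout i φ →ₗ[Λ] LinearMap.ker (Pushout.toCoker φ hig) :=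
    (LinearMap.id - s ∘ₗ Pushout.toCoker φ hig).codRestrict _ fun w => by simp [hs']
  refine ⟨e.symm.toLinearMap ∘ₗ ρ ∘ₗ Pushout.inr i φ, fun x => ?_⟩
  simp only [LinearMap.comp_apply, LinearEquiv.coe_coe, LinearEquiv.symm_apply_eq]
  refine Subtype.ext ?_
  rw [he, Pushout.condition]
  have h0 : Pushout.toCoker φ hig (Pushout.inr i φ (i x)) = 0 := by
    simp [Pushout.toCoker, hig]
  simp [ρ, i] at h0 ⊢
  simp [h0]

lemma latResolved_of_hasLatInjRes [IsNoetherianRing R] [Module.Finite R Λ]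
    {ω : Type u} [AddCommGroup ω] [Module R ω] (hord : IsLattice R Λ ω Λ)
    (hΛ : RingTheory.Sequence.IsWeaklyRegular Λ xs) (hxs : ∀ x ∈ xs, x ∈ maximalIdeal R)
    (hlen : (xs.length : WithBot ℕ∞) = ringKrullDim R) (t : ℕ) (Y : Type u) [AddCommGroup Y]
    [Module Λ Y] [Module R Y] [IsScalarTower R Λ Y] (hY : HasLatInjResOfLength R Λ ω t Y) :
    LatResolved xs Λ Y := by
  have : IsNoetherianRing Λ := IsNoetherianRing.of_finite R Λ
  have key : ∀ (L : Type u) [AddCommGroup L] [Module Λ L] [Module R L] [IsScalarTower R Λ L],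
      IsLatInjective R Λ ω L → IsLat xs Λ L ∧ RelInj xs Λ L := fun L _ _ _ _ hL =>
    ⟨hL.1.isLat hxs hlen hΛ, relInj_of_ext1Vanishes fun T _ hT =>
      hL.2 T _ _ _ inferInstance (hT.isLattice hxs hlen hord)⟩
  induction t generalizing Y with
  | zero =>
    obtain ⟨h1, h2⟩ := key Y hY
    have : Subsingleton (LinearMap.ker (LinearMap.id : Y →ₗ[Λ] Y)) := by
      rw [LinearMap.ker_id]
      infer_instance
    exact ⟨.of R Λ Y, LinearMap.id, h1, Function.surjective_id, h2, RelInj.of_subsingleton⟩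
  | succ t ih =>
    obtain ⟨L, _, _, _, _, π, hL, hπ, hk⟩ := hY
    obtain ⟨h1, h2⟩ := key L hL
    exact ⟨.of R Λ L, π, h1, hπ, h2, (ih _ hk).relInj hΛ⟩

variable {ι : Type u} {Sfam : ι → Type u} [∀ i, AddCommGroup (Sfam i)]
  [∀ i, Module Λ (Sfam i)]

lemma exists_hasApprox_prod [IsNoetherianRing Λ]
    (hΛ : RingTheory.Sequence.IsWeaklyRegular Λ xs)
    (hS : ∀ (T : Type u) (_ : AddCommGroup T) (_ : Module Λ T),
      IsSimpleModule Λ T → ∃ i, Nonempty (T ≃ₗ[Λ] Sfam i))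
    (happ : HasApprox xs Λ (∀ i, Sfam i)) {C : Type u} [AddCommGroup C] [Module Λ C]
    (hC : IsFiniteLength Λ C) : ∃ (C' : Type u) (_ : AddCommGroup C') (_ : Module Λ C'),
      HasApprox xs Λ (C × C') := by
  classical
  induction hC with
  | of_subsingleton => exact ⟨PUnit, inferInstance, inferInstance, HasApprox.of_subsingleton⟩
  | @of_simple_quotient C _ _ N hN _ ih =>
    obtain ⟨C₁, _, _, h₁⟩ := ih
    obtain ⟨i, ⟨e⟩⟩ := hS _ _ _ hN
    let V := LinearMap.ker (LinearMap.proj i : (∀ i, Sfam i) →ₗ[Λ] Sfam i)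
    refine ⟨C₁ × V, inferInstance, inferInstance, ?_⟩
    let p₁ : C →ₗ[Λ] Sfam i := e.toLinearMap ∘ₗ N.mkQ
    let p : C × C₁ × V →ₗ[Λ] ∀ i, Sfam i :=
      (LinearMap.single Λ Sfam i ∘ₗ p₁).coprod (V.subtype ∘ₗ LinearMap.snd Λ C₁ V)
    have hp' : ∀ x, p x = Pi.single i (p₁ x.1) + x.2.2 := fun x => rfl
    have hp : Function.Surjective p := by
      intro s
      obtain ⟨c, hc⟩ := (e.surjective.comp N.mkQ_surjective) (s i)
      have hc' : p₁ c = s i := hc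
      refine ⟨⟨c, 0, ⟨s - Pi.single i (s i), by simp [V]⟩⟩, ?_⟩
      rw [hp', hc']
      simp
    have hk : ∀ x, p x = 0 ↔ x.1 ∈ N ∧ x.2.2 = 0 := fun x => by
      have hN' : ∀ c, p₁ c = 0 ↔ c ∈ N := fun c => by simp [p₁]
      rw [hp', ← hN']
      constructor
      · intro h
        have h1 : p₁ x.1 = 0 := by
          have h2 := congrFun h i
          have h3 : (x.2.2 : ∀ i, Sfam i) i = 0 := x.2.2.2
          simpa [h3] using h2
        exact ⟨h1, Subtype.ext (by simpa [h1] using h)⟩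
      · rintro ⟨h1, h2⟩
        simp [h1, h2]
    let w : N × C₁ →ₗ[Λ] LinearMap.ker p :=
      ((N.subtype.prodMap (LinearMap.inl Λ C₁ V))).codRestrict _ fun x => by
        rw [LinearMap.mem_ker, hk]
        exact ⟨x.1.2, rfl⟩
    refine HasApprox.extension hΛ hp (h₁.equiv (LinearEquiv.ofBijective w ⟨?_, ?_⟩)) happ
    · intro a b hab
      have h1 : (N.subtype.prodMap (LinearMap.inl Λ C₁ V)) a =
        (N.subtype.prodMap (LinearMap.inl Λ C₁ V)) b := congrArg Subtype.val hab
      simpa [Prod.ext_iff] using h1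
    · rintro ⟨⟨c, c₁, v⟩, hx⟩
      obtain ⟨h1, h2⟩ := (hk _).1 hx
      refine ⟨(⟨c, h1⟩, c₁), Subtype.ext ?_⟩
      simp only at h2
      subst h2
      rfl

end FiniteLengthApprox

section

open RingTheory.Sequence Pointwise

section SmulTop

variable {R : Type u} [CommRing R] {Λ : Type u} [Ring Λ] [Algebra R Λ]
  {N M : Type u} [AddCommGroup N] [Module Λ N] [Module R N] [IsScalarTower R Λ N]
  [AddCommGroup M] [Module Λ M] [Module R M] [IsScalarTower R Λ M]

variable (Λ N) in
/-- The `Λ`-submodule `I N` of `N`, for an ideal `I` of `R`. -/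
def smulTop (I : Ideal R) : Submodule Λ N where
  __ := (I • ⊤ : Submodule R N)
  smul_mem' a x hx := by
    induction hx using Submodule.smul_induction_on' with
    | smul r hr n _ =>
      rw [smul_comm]
      exact Submodule.smul_mem_smul hr trivial
    | add x _ y _ hx hy =>
      rw [smul_add]
      exact (I • ⊤ : Submodule R N).add_mem hx hy

lemma mem_smulTop {I : Ideal R} {x : N} : x ∈ smulTop Λ N I ↔ x ∈ (I • ⊤ : Submodule R N) := Iff.rfl

lemma smul_mem_smulTop {I : Ideal R} {s : R} (hs : s ∈ I) (x : N) : s • x ∈ smulTop Λ N I :=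
  mem_smulTop.2 (Submodule.smul_mem_smul hs trivial)

lemma smulTop_le {I : Ideal R} {K : Submodule Λ N} (h : ∀ s ∈ I, ∀ x : N, s • x ∈ K) :
    smulTop Λ N I ≤ K := fun _ hx =>
  Submodule.smul_induction_on (mem_smulTop.1 hx) (fun r hr n _ => h r hr n)
    fun _ _ hx hy => K.add_mem hx hy

lemma map_mem_smulTop {I : Ideal R} (f : N →ₗ[Λ] M) {x : N} (hx : x ∈ smulTop Λ N I) :
    f x ∈ smulTop Λ M I := by
  have : smulTop Λ N I ≤ (smulTop Λ M I).comap f := smulTop_le fun s hs x => by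
    rw [Submodule.mem_comap, LinearMap.map_smul_of_tower]
    exact smul_mem_smulTop hs _
  exact this hx

lemma exists_preimage_mem_smulTop {I : Ideal R} {f : N →ₗ[Λ] M} (hf : Function.Surjective f)
    {y : M} (hy : y ∈ smulTop Λ M I) : ∃ x ∈ smulTop Λ N I, f x = y := by
  have : smulTop Λ M I ≤ (smulTop Λ N I).map f := smulTop_le fun s hs y => by
    obtain ⟨x, rfl⟩ := hf y
    exact ⟨s • x, smul_mem_smulTop hs _, LinearMap.map_smul_of_tower f s x⟩
  exact this hy

lemma smulTop_sup (I J : Ideal R) : smulTop Λ N (I ⊔ J) = smulTop Λ N I ⊔ smulTop Λ N J := by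
  refine le_antisymm (smulTop_le fun s hs x => ?_) (sup_le ?_ ?_)
  · obtain ⟨a, ha, b, hb, rfl⟩ := Submodule.mem_sup.1 hs
    rw [add_smul]
    exact Submodule.add_mem_sup (smul_mem_smulTop ha x) (smul_mem_smulTop hb x)
  · exact smulTop_le fun s hs x => smul_mem_smulTop (le_sup_left (a := I) hs) x
  · exact smulTop_le fun s hs x => smul_mem_smulTop (le_sup_right (a := I) hs) x

lemma mem_smulTop_span_singleton {r : R} {x : N} :
    x ∈ smulTop Λ N (Ideal.span {r}) ↔ ∃ y, r • y = x := by
  rw [mem_smulTop, Submodule.ideal_span_singleton_smul]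
  simp [Submodule.mem_smul_pointwise_iff_exists]

lemma smul_mem_of_one_mem {I : Ideal R} {s : R}
    (hs : algebraMap R Λ s ∈ smulTop Λ Λ I) (x : N) : s • x ∈ smulTop Λ N I := by
  have := map_mem_smulTop (LinearMap.toSpanSingleton Λ N x) hs
  simpa using this

lemma isWeaklyRegular_quotient_smulTop {r : R} {rs : List R} (h : IsWeaklyRegular N (r :: rs)) :
    IsWeaklyRegular (N ⧸ smulTop Λ N (Ideal.span {r})) rs := by
  have h1 := ((isWeaklyRegular_cons_iff N r rs).1 h).2
  have h2 : r • (⊤ : Submodule R N) = (smulTop Λ N (Ideal.span {r})).restrictScalars R := by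
    rw [← Submodule.ideal_span_singleton_smul]
    rfl
  exact ((LinearEquiv.isWeaklyRegular_congr ((Submodule.quotEquivOfEq _ _ h2).trans
    (Submodule.Quotient.restrictScalarsEquiv R _)) rs).1 h1)

lemma exists_pow_algebraMap_mem_smulTop [IsNoetherianRing R] [IsLocalRing R] [Module.Finite R Λ]
    {zs : List R} (hzs : ∀ z ∈ zs, z ∈ maximalIdeal R) (hreg : IsWeaklyRegular Λ zs)
    (hlen : (zs.length : WithBot ℕ∞) = ringKrullDim R) :
    ∃ n, ∀ s ∈ maximalIdeal R ^ n, algebraMap R Λ s ∈ smulTop Λ Λ (Ideal.ofList zs) := by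
  rcases subsingleton_or_nontrivial Λ with h | h
  · exact ⟨0, fun s _ => by rw [Subsingleton.elim (algebraMap R Λ s) 0]; exact zero_mem _⟩
  have hreg' : IsRegular Λ zs :=
    (IsLocalRing.isRegular_iff_isWeaklyRegular_of_subset_maximalIdeal hzs).2 hreg
  let Q := Λ ⧸ (Ideal.ofList zs • ⊤ : Submodule R Λ)
  have hdim : Module.supportDim R Q + zs.length = Module.supportDim R Λ :=
    Module.supportDim_add_length_eq_supportDim_of_isRegular zs hreg'
  have hle : Module.supportDim R Q ≤ 0 := by
    have h1 : Module.supportDim R Q + zs.length ≤ 0 + zs.length := by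
      rw [hdim, zero_add, hlen]
      exact Module.supportDim_le_ringKrullDim R Λ
    generalize Module.supportDim R Q = c at h1
    cases c with
    | bot => exact bot_le
    | coe c =>
      have h2 : c + (zs.length : ℕ∞) ≤ 0 + (zs.length : ℕ∞) := by exact_mod_cast h1
      exact_mod_cast (ENat.add_le_add_iff_right (ENat.natCast_ne_top _)).1 h2
  obtain ⟨n, hn⟩ := exists_pow_le_of_prime (Module.annihilator R Q) fun p hp hpm => by
    by_contra! hc
    have hpI : Module.annihilator R Q ≤ p := fun s hs => by
      by_contra hsp
      exact hc s hsp hs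
    have hlt : (⟨p, hp⟩ : PrimeSpectrum R) < ⟨maximalIdeal R, inferInstance⟩ :=
      lt_of_le_of_ne (IsLocalRing.le_maximalIdeal hp.ne_top) fun h => hpm (congrArg (·.1) h)
    have h1 : (⟨p, hp⟩ : PrimeSpectrum R) ∈ Module.support R Q :=
      Module.mem_support_iff_of_finite.2 hpI
    have h2 : (⟨maximalIdeal R, inferInstance⟩ : PrimeSpectrum R) ∈ Module.support R Q :=
      Module.mem_support_iff_of_finite.2 (hpI.trans (IsLocalRing.le_maximalIdeal hp.ne_top))
    have : 0 < Module.supportDim R Q :=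
      Order.krullDim_pos_iff.2 ⟨⟨_, h1⟩, ⟨_, h2⟩, hlt⟩
    exact absurd this (not_lt.2 hle)
  refine ⟨n, fun s hs => ?_⟩
  have h1 := Module.mem_annihilator.1 (hn hs) (Submodule.Quotient.mk 1)
  rw [← Submodule.Quotient.mk_smul, Submodule.Quotient.mk_eq_zero] at h1
  rwa [Algebra.algebraMap_eq_smul_one]

end SmulTop

section Maranda

variable {R : Type u} [CommRing R] {Λ : Type u} [Ring Λ] [Algebra R Λ]
  {M : Type u} [AddCommGroup M] [Module Λ M] [Module R M] [IsScalarTower R Λ M]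

lemma exists_lift_mod {N : Type u} [AddCommGroup N] [Module Λ N] [Module R N] [IsScalarTower R Λ N]
    {y : R} (hy : y ∈ stabIdeal R Λ M) (hreg : IsSMulRegular N y)
    (ψ : M →ₗ[Λ] N ⧸ smulTop Λ N (Ideal.span {y ^ 2})) :
    ∃ f : M →ₗ[Λ] N, ∀ m n, ψ m = Submodule.Quotient.mk n →
      f m - n ∈ smulTop Λ N (Ideal.span {y}) := by
  obtain ⟨P, _, _, hP, a, b, hab⟩ := mem_stabIdeal.1 hy
  have hab' : ∀ m, b (a m) = y • m := fun m => LinearMap.congr_fun hab m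
  obtain ⟨c, hc⟩ := Module.projective_lifting_property
    (smulTop Λ N (Ideal.span {y ^ 2})).mkQ (ψ ∘ₗ b) (Submodule.mkQ_surjective _)
  have key : ∀ m n, ψ m = Submodule.Quotient.mk n → ∃ k, c (a m) = y • (n + y • k) := by
    intro m n hmn
    have h1 : Submodule.Quotient.mk (c (a m)) = ψ (b (a m)) := LinearMap.congr_fun hc (a m)
    rw [hab', LinearMap.map_smul_of_tower, hmn, ← Submodule.Quotient.mk_smul,
      Submodule.Quotient.eq, mem_smulTop_span_singleton] at h1
    obtain ⟨k, hk⟩ := h1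
    exact ⟨k, by rw [smul_add, smul_smul, ← pow_two, hk, add_sub_cancel]⟩
  have hex : ∀ m, ∃ n, y • n = c (a m) := fun m => by
    obtain ⟨n, hn⟩ := Submodule.Quotient.mk_surjective _ (ψ m)
    obtain ⟨k, hk⟩ := key m n hn.symm
    exact ⟨_, hk.symm⟩
  choose f hf using hex
  refine ⟨{ toFun := f, map_add' := fun m m' => hreg ?_, map_smul' := fun r m => hreg ?_ },
    fun m n hmn => ?_⟩
  · simp only [smul_add, hf, map_add]
  · simp only [hf, map_smul, RingHom.id_apply]
    rw [smul_comm, hf]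
  · obtain ⟨k, hk⟩ := key m n hmn
    rw [mem_smulTop_span_singleton]
    have : f m = n + y • k := hreg ((hf m).trans hk)
    exact ⟨k, by simp [this]⟩

lemma exists_lift_mod_list (ys : List R) (hys : ∀ y ∈ ys, y ∈ stabIdeal R Λ M)
    {N : Type u} [AddCommGroup N] [Module Λ N] [Module R N] [IsScalarTower R Λ N]
    (hN : IsWeaklyRegular N (ys.map (· ^ 2)))
    {C : Type u} [AddCommGroup C] [Module Λ C] [Module R C] [IsScalarTower R Λ C]
    {q : N →ₗ[Λ] C} (hq : Function.Surjective q)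
    (hk : LinearMap.ker q = smulTop Λ N (Ideal.ofList (ys.map (· ^ 2)))) (φ : M →ₗ[Λ] C) :
    ∃ f : M →ₗ[Λ] N, ∀ m, φ m - q (f m) ∈ smulTop Λ C (Ideal.ofList ys) := by
  induction ys generalizing N with
  | nil =>
    have hinj : Function.Injective q := by
      rw [← LinearMap.ker_eq_bot, hk, eq_bot_iff]
      exact smulTop_le fun s hs x => by
        have : s = 0 := by simpa using hs
        simp [this]
    refine ⟨(LinearEquiv.ofBijective q ⟨hinj, hq⟩).symm.toLinearMap ∘ₗ φ, fun m => ?_⟩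
    have : q ((LinearEquiv.ofBijective q ⟨hinj, hq⟩).symm (φ m)) = φ m :=
      (LinearEquiv.ofBijective q ⟨hinj, hq⟩).apply_symm_apply _
    simp [this]
  | cons y ys ih =>
    simp only [List.map_cons] at hN hk
    rw [Ideal.ofList_cons, smulTop_sup] at hk
    let K := smulTop Λ N (Ideal.span {y ^ 2})
    have hKq : K ≤ LinearMap.ker q := hk ▸ le_sup_left
    let q' : N ⧸ K →ₗ[Λ] C := K.liftQ q hKq
    have hq' : Function.Surjective q' := fun c =>
      (hq c).elim fun n hn => ⟨K.mkQ n, by simpa [q'] using hn⟩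
    have hk' : LinearMap.ker q' = smulTop Λ (N ⧸ K) (Ideal.ofList (ys.map (· ^ 2))) := by
      refine le_antisymm (fun x hx => ?_) (smulTop_le fun s hs x => ?_)
      · obtain ⟨n, rfl⟩ := K.mkQ_surjective x
        have hn : n ∈ LinearMap.ker q := by simpa [q'] using hx
        rw [hk] at hn
        obtain ⟨a, ha, b, hb, rfl⟩ := Submodule.mem_sup.1 hn
        have ha' : K.mkQ a = 0 := by simpa using ha
        rw [map_add, ha', zero_add]
        exact map_mem_smulTop _ hb
      · obtain ⟨n, rfl⟩ := K.mkQ_surjective x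
        have : s • n ∈ LinearMap.ker q := by
          rw [hk]
          exact Submodule.mem_sup_right (smul_mem_smulTop hs n)
        rw [← LinearMap.map_smul_of_tower]
        simpa [q'] using this
    obtain ⟨f', hf'⟩ := ih (fun z hz => hys z (List.mem_cons_of_mem _ hz))
      (isWeaklyRegular_quotient_smulTop hN) hq' hk'
    obtain ⟨f, hf⟩ := exists_lift_mod (hys y List.mem_cons_self)
      (N := N) (fun a b hab => ((isWeaklyRegular_cons_iff N _ _).1 hN).1 (by
        simp only at hab ⊢
        rw [pow_two, mul_smul, mul_smul, hab])) f'
    refine ⟨f, fun m => ?_⟩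
    obtain ⟨n, hn⟩ := K.mkQ_surjective (f' m)
    have h1 := map_mem_smulTop q (hf m n hn.symm)
    have h2 := hf' m
    have h3 : q' (f' m) = q n := by rw [← hn]; simp [q']
    rw [Ideal.ofList_cons, smulTop_sup]
    have h4 : φ m - q (f m) = -(q (f m - n)) + (φ m - q' (f' m)) := by
      rw [h3, map_sub]
      abel
    rw [h4]
    exact Submodule.add_mem_sup (neg_mem h1) h2

end Maranda

end

section Hull

variable {R : Type u} [CommRing R]

lemma exists_injective_module (K : Type u) [AddCommGroup K] [Module R K] :
    ∃ (I : Type u) (_ : AddCommGroup I) (_ : Module R I) (j : K →ₗ[R] I),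
      Module.Injective R I ∧ Function.Injective j := by
  let X := CategoryTheory.Injective.under (ModuleCat.of R K)
  have h1 : CategoryTheory.Injective (ModuleCat.of R X) :=
    inferInstanceAs (CategoryTheory.Injective X)
  exact ⟨X, inferInstance, inferInstance,
    (CategoryTheory.Injective.ι (ModuleCat.of R K)).hom,
    (Module.injective_iff_injective_object R X).2 h1,
    (ModuleCat.mono_iff_injective _).1 inferInstance⟩

variable [IsLocalRing R]

/-- A maximal essential extension of `R e` inside an injective module is injective. -/
lemma exists_injective_essential {I : Type u} [AddCommGroup I] [Module R I]
    (hI : Module.Injective R I) (e : I) (he : ∀ r ∈ maximalIdeal R, r • e = 0) :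
    ∃ E : Submodule R I, e ∈ E ∧ (∀ x ∈ E, x ≠ 0 → ∃ r : R, r • x = e) ∧
      Module.Injective R E := by
  let s : Set (Submodule R I) := {E | ∀ x ∈ E, x ≠ 0 → ∃ r : R, r • x = e}
  obtain ⟨E, hle, hE, hmax⟩ := zorn_le_nonempty₀ s (fun c hc hch y hy =>
    ⟨sSup c, fun x hx hx0 => by
      obtain ⟨z, hz, hxz⟩ := (Submodule.mem_sSup_of_directed ⟨y, hy⟩ hch.directedOn).1 hx
      exact hc hz x hxz hx0, fun z hz => le_sSup hz⟩) (Submodule.span R {e}) (by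
      intro x hx hx0
      obtain ⟨a, rfl⟩ := Submodule.mem_span_singleton.1 hx
      have ha : IsUnit a := by
        by_contra h
        exact hx0 (he a ((mem_maximalIdeal a).2 h))
      obtain ⟨b, hb⟩ := ha.exists_left_inv
      exact ⟨b, by rw [smul_smul, hb, one_smul]⟩)
  obtain ⟨W, -, hW, hWmax⟩ := zorn_le_nonempty₀ {W : Submodule R I | ∀ x ∈ W, x ∈ E → x = 0}
    (fun c hc hch y hy => ⟨sSup c, fun x hx hxE => by
      obtain ⟨z, hz, hxz⟩ := (Submodule.mem_sSup_of_directed ⟨y, hy⟩ hch.directedOn).1 hx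
      exact hc hz x hxz hxE, fun z hz => le_sSup hz⟩) ⊥ (fun x hx _ => by simpa using hx)
  obtain ⟨h, hh⟩ := hI.out (W.mkQ ∘ₗ E.subtype) (by
    rw [← LinearMap.ker_eq_bot, eq_bot_iff]
    intro x hx
    exact Subtype.ext (hW x (by simpa using hx) x.2)) E.subtype
  have hh' : ∀ x ∈ E, h (W.mkQ x) = x := fun x hx => hh ⟨x, hx⟩
  have hker : ∀ x, h (W.mkQ x) = 0 → x ∈ W := by
    have : LinearMap.ker (h ∘ₗ W.mkQ) ≤ W := hWmax (fun x hx hxE => by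
      rw [← hh' x hxE]
      exact hx) (fun x hx => by
        have : W.mkQ x = 0 := by simpa using hx
        simp only [LinearMap.mem_ker, LinearMap.comp_apply, this, map_zero])
    exact fun x hx => this hx
  have hrange : LinearMap.range (h ∘ₗ W.mkQ) ≤ E := by
    refine hmax ?_ (fun x hx => ⟨x, hh' x hx⟩)
    rintro _ ⟨x, rfl⟩ hx0
    have hxW : ¬ W ⊔ Submodule.span R {x} ≤ W := fun hc => hx0 (by
      have : W.mkQ x = 0 := by
        simpa using hc (Submodule.mem_sup_right (Submodule.mem_span_singleton_self x))
      simp only [LinearMap.comp_apply, this, map_zero])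
    have : ∃ z ∈ W ⊔ Submodule.span R {x}, z ∈ E ∧ z ≠ 0 := by
      by_contra! hc
      exact hxW (hWmax (fun z hz hzE => hc z hz hzE) le_sup_left)
    obtain ⟨z, hz, hzE, hz0⟩ := this
    obtain ⟨r', hr'⟩ := hE z hzE hz0
    obtain ⟨w, hw, v, hv, rfl⟩ := Submodule.mem_sup.1 hz
    obtain ⟨r, rfl⟩ := Submodule.mem_span_singleton.1 hv
    have hw0 : W.mkQ w = 0 := by simpa using hw
    have h2 := hh' _ hzE
    rw [map_add, hw0, zero_add, map_smul, map_smul] at h2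
    exact ⟨r' * r, by rw [mul_smul, LinearMap.comp_apply, h2, hr']⟩
  refine ⟨E, hle (Submodule.mem_span_singleton_self e), hE, ⟨fun X Y _ _ _ _ f hf g => ?_⟩⟩
  obtain ⟨k, hk⟩ := hI.out f hf (E.subtype ∘ₗ g)
  refine ⟨((h ∘ₗ W.mkQ).codRestrict E fun x => hrange ⟨x, rfl⟩) ∘ₗ k, fun x => ?_⟩
  apply Subtype.ext
  simp only [LinearMap.comp_apply, LinearMap.codRestrict_apply, hk]
  exact hh' _ (g x).2

variable (R) in
/-- An injective hull of the residue field of a local ring. -/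
lemma exists_injectiveHull : ∃ (E : Type u) (_ : AddCommGroup E) (_ : Module R E) (e : E),
    Module.Injective R E ∧ e ≠ 0 ∧ (∀ r ∈ maximalIdeal R, r • e = 0) ∧
      ∀ x : E, x ≠ 0 → ∃ r : R, r • x = e := by
  obtain ⟨I, _, _, j, hI, hj⟩ := exists_injective_module (R := R) (ResidueField R)
  have he : ∀ r ∈ maximalIdeal R, r • j 1 = 0 := fun r hr => by
    have h0 : r • (1 : ResidueField R) = 0 := by
      rw [Algebra.smul_def, mul_one]
      exact (residue_eq_zero_iff r).2 hr
    rw [← map_smul, h0, map_zero]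
  obtain ⟨E, heE, hess, hE⟩ := exists_injective_essential hI (j 1) he
  refine ⟨E, inferInstance, inferInstance, ⟨j 1, heE⟩, hE, fun h0 => ?_, fun r hr =>
    Subtype.ext (he r hr), fun x hx => ?_⟩
  · exact one_ne_zero (hj ((congrArg Subtype.val h0).trans (map_zero j).symm))
  · obtain ⟨r, hr⟩ := hess x x.2 fun h => hx (Subtype.ext h)
    exact ⟨r, Subtype.ext hr⟩

variable {E : Type u} [AddCommGroup E] [Module R E]

variable (R E) in
/-- The elements of `E` killed by `𝔪 ^ n`. -/
def torsionPow (n : ℕ) : Submodule R E where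
  carrier := {x | ∀ s ∈ maximalIdeal R ^ n, s • x = 0}
  zero_mem' := fun _ _ => smul_zero _
  add_mem' := fun ha hb s hs => by rw [smul_add, ha s hs, hb s hs, add_zero]
  smul_mem' := fun r x hx s hs => by rw [smul_comm, hx s hs, smul_zero]

lemma fg_torsionPow [IsNoetherianRing R] {e : E} (he0 : e ≠ 0)
    (hess : ∀ x : E, x ≠ 0 → ∃ r : R, r • x = e) (n : ℕ) : (torsionPow R E n).FG := by
  induction n with
  | zero =>
    have : torsionPow R E 0 = ⊥ := by
      rw [eq_bot_iff]
      intro x hx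
      simpa using hx 1 (by simp)
    rw [this]
    exact Submodule.fg_bot
  | succ n ih =>
    obtain ⟨S, hS⟩ := (isNoetherianRing_iff_ideal_fg R).1 ‹_› (maximalIdeal R)
    have hSm : ∀ a ∈ S, a ∈ maximalIdeal R := fun a ha => hS ▸ Submodule.subset_span ha
    let f : E →ₗ[R] (S → E) := LinearMap.pi fun a => (a : R) • LinearMap.id
    refine Submodule.fg_of_fg_map_of_fg_inf_ker f ?_ ?_
    · refine (Submodule.fg_pi (fun _ : S => ih)).of_le ?_
      rintro _ ⟨x, hx, rfl⟩ a -
      intro s hs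
      have := hx (s * a) (by
        rw [pow_succ]
        exact Ideal.mul_mem_mul hs (hSm a a.2))
      rwa [mul_smul] at this
    · refine (Submodule.fg_span_singleton e).of_le ?_
      rintro x ⟨-, hx⟩
      by_cases hx0 : x = 0
      · simp [hx0]
      have hx' : ∀ a ∈ maximalIdeal R, a • x = 0 := by
        intro a ha
        rw [← hS] at ha
        induction ha using Submodule.span_induction with
        | mem a ha => exact congrFun hx ⟨a, ha⟩
        | zero => simp
        | add a b _ _ ha hb => rw [add_smul, ha, hb, add_zero]
        | smul c a _ ha => rw [smul_eq_mul, mul_smul, ha, smul_zero]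
      obtain ⟨r, hr⟩ := hess x hx0
      have hru : IsUnit r := by
        by_contra h
        exact he0 (by rw [← hr]; exact hx' r ((mem_maximalIdeal r).2 h))
      obtain ⟨b, hb⟩ := hru.exists_left_inv
      exact Submodule.mem_span_singleton.2 ⟨b, by rw [← hr, smul_smul, hb, one_smul]⟩

omit [IsLocalRing R] in
lemma exists_factor_of_ker_le (hE : Module.Injective R E) {X Y : Type u} [AddCommGroup X]
    [Module R X] [AddCommGroup Y] [Module R Y] (L : X →ₗ[R] Y) (σ : X →ₗ[R] E)
    (h : LinearMap.ker L ≤ LinearMap.ker σ) : ∃ τ : Y →ₗ[R] E, τ ∘ₗ L = σ := by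
  obtain ⟨τ, hτ⟩ := hE.out ((LinearMap.ker L).liftQ L le_rfl)
    (LinearMap.ker_eq_bot.1 (Submodule.ker_liftQ_eq_bot _ _ _ le_rfl))
    ((LinearMap.ker L).liftQ σ h)
  exact ⟨τ, LinearMap.ext fun x => by simpa using hτ (Submodule.Quotient.mk x)⟩

lemma exists_linearMap_apply_eq (hE : Module.Injective R E) {e : E}
    (he : ∀ r ∈ maximalIdeal R, r • e = 0) {Q : Type u} [AddCommGroup Q] [Module R Q] (q : Q)
    (hq : ∀ r : R, r • q = 0 → r ∈ maximalIdeal R) : ∃ φ : Q →ₗ[R] E, φ q = e := by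
  obtain ⟨τ, hτ⟩ := exists_factor_of_ker_le hE (LinearMap.toSpanSingleton R Q q)
    (LinearMap.toSpanSingleton R E e) fun r hr => he r (hq r hr)
  exact ⟨τ, by simpa using LinearMap.congr_fun hτ 1⟩

end Hull

section Coind

variable (R : Type u) [CommRing R] (Λ : Type u) [Ring Λ] [Algebra R Λ]
  (E : Type u) [AddCommGroup E] [Module R E]

/-- The coinduced left `Λ`-module `Hom_R(Λ, E)`, with `(a • θ) μ = θ (μ * a)`. -/
def Coind : Type u := Λ →ₗ[R] E

instance : AddCommGroup (Coind R Λ E) := inferInstanceAs (AddCommGroup (Λ →ₗ[R] E))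

instance : Module R (Coind R Λ E) := inferInstanceAs (Module R (Λ →ₗ[R] E))

variable {R Λ E}

/-- The linear map underlying an element of the coinduced module. -/
def Coind.toHom (θ : Coind R Λ E) : Λ →ₗ[R] E := θ

lemma Coind.ext' {θ η : Coind R Λ E} (h : ∀ μ, θ.toHom μ = η.toHom μ) : θ = η :=
  LinearMap.ext h

lemma Coind.toHom_smul (r : R) (θ : Coind R Λ E) (μ : Λ) : (r • θ).toHom μ = r • θ.toHom μ := rfl

instance : Module Λ (Coind R Λ E) where
  smul a θ := θ.toHom ∘ₗ LinearMap.mulRight R a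
  one_smul θ := Coind.ext' fun μ => congrArg θ.toHom (mul_one μ)
  mul_smul a b θ := Coind.ext' fun μ => congrArg θ.toHom (mul_assoc μ a b).symm
  smul_zero _ := rfl
  smul_add _ _ _ := rfl
  add_smul a b θ := Coind.ext' fun μ =>
    (congrArg θ.toHom (mul_add μ a b)).trans (map_add θ.toHom _ _)
  zero_smul θ := Coind.ext' fun μ => (congrArg θ.toHom (mul_zero μ)).trans (map_zero θ.toHom)

lemma Coind.toHom_smul' (a : Λ) (θ : Coind R Λ E) (μ : Λ) :
    (a • θ).toHom μ = θ.toHom (μ * a) := rfl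

instance : IsScalarTower R Λ (Coind R Λ E) where
  smul_assoc r a θ := Coind.ext' fun μ => by
    rw [Coind.toHom_smul, Coind.toHom_smul', Coind.toHom_smul', mul_smul_comm, map_smul]

instance [IsNoetherianRing R] [Module.Finite R Λ] [Module.Finite R E] :
    Module.Finite R (Coind R Λ E) :=
  inferInstanceAs (Module.Finite R (Λ →ₗ[R] E))

variable {T : Type u} [AddCommGroup T] [Module Λ T] [Module R T] [IsScalarTower R Λ T]

/-- The `Λ`-linear map to the coinduced module given by an `R`-linear map. -/
def Coind.lift (σ : T →ₗ[R] E) : T →ₗ[Λ] Coind R Λ E where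
  toFun t := σ ∘ₗ (LinearMap.toSpanSingleton Λ T t).restrictScalars R
  map_add' s t := Coind.ext' fun μ => (congrArg σ (smul_add μ s t)).trans (map_add σ _ _)
  map_smul' a t := Coind.ext' fun μ => congrArg σ (mul_smul μ a t).symm

/-- Precomposition with left multiplication on the coinduced module. -/
def Coind.mulLeft (a : Λ) : Coind R Λ E →ₗ[Λ] Coind R Λ E where
  toFun θ := θ.toHom ∘ₗ LinearMap.mulLeft R a
  map_add' _ _ := rfl
  map_smul' b θ := Coind.ext' fun μ => congrArg θ.toHom (mul_assoc a μ b)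

/-- Evaluation at `μ`. -/
def Coind.eval (μ : Λ) : Coind R Λ E →ₗ[R] E where
  toFun θ := θ.toHom μ
  map_add' _ _ := rfl
  map_smul' _ _ := rfl

lemma Coind.eval_apply (μ : Λ) (θ : Coind R Λ E) : Coind.eval μ θ = θ.toHom μ := rfl

end Coind

section Detector

lemma exists_factor_of_surjective {Λ : Type u} [Ring Λ] {F M T : Type u} [AddCommGroup F]
    [Module Λ F] [AddCommGroup M] [Module Λ M] [AddCommGroup T] [Module Λ T]
    {q : F →ₗ[Λ] M} (hq : Function.Surjective q) (f : F →ₗ[Λ] T)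
    (h : LinearMap.ker q ≤ LinearMap.ker f) : ∃ g : M →ₗ[Λ] T, g ∘ₗ q = f :=
  ⟨(LinearMap.ker q).liftQ f h ∘ₗ (q.quotKerEquivOfSurjective hq).symm.toLinearMap,
    LinearMap.ext fun x => by
      have : (q.quotKerEquivOfSurjective hq).symm (q x) = (LinearMap.ker q).mkQ x := by
        rw [LinearEquiv.symm_apply_eq]
        rfl
      simp [this]⟩

lemma EndLocal.bijective_of_add {Λ : Type u} [Ring Λ] {M : Type u} [AddCommGroup M] [Module Λ M]
    (hM : EndLocal Λ M) {u v : Module.End Λ M} (h : Function.Bijective (u + v)) :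
    Function.Bijective u ∨ Function.Bijective v := by
  obtain ⟨i, hi, h'⟩ := EndLocal.exists_bijective_of_sum hM [u, v] id (by simpa using h)
  simp only [List.mem_cons, List.not_mem_nil, or_false] at hi
  rcases hi with rfl | rfl
  · exact Or.inl h'
  · exact Or.inr h'

variable {R : Type u} [CommRing R] [IsNoetherianRing R] [IsLocalRing R]
  {Λ : Type u} [Ring Λ] [Algebra R Λ] [Module.Finite R Λ]
  {M : Type u} [AddCommGroup M] [Module Λ M] [Module R M] [IsScalarTower R Λ M]

omit [IsNoetherianRing R] in
/-- An `R`-linear functional on `M ^ p` which kills `J M ^ p` and all `g (m₁, …, mₚ)`, with `g` a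
non-bijective endomorphism, but not `(m₁, …, mₚ)` itself. -/
lemma exists_trace [Module.Finite Λ M] (hM : EndLocal Λ M) {p : ℕ} {q : (Fin p → Λ) →ₗ[Λ] M}
    (hq : Function.Surjective q) {J : Ideal R} (hJ : J ≤ maximalIdeal R)
    {E : Type u} [AddCommGroup E] [Module R E] (hE : Module.Injective R E) {e : E}
    (he : ∀ r ∈ maximalIdeal R, r • e = 0) :
    ∃ σ : (Fin p → M) →ₗ[R] E, σ (fun k => q (Pi.single k 1)) = e ∧
      (∀ v : Fin p → M, (∀ k, v k ∈ smulTop Λ M J) → σ v = 0) ∧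
      ∀ g : Module.End Λ M, ¬ Function.Bijective g →
        σ (fun k => g (q (Pi.single k 1))) = 0 := by
  have := hM.1
  let m : Fin p → M := fun k => q (Pi.single k 1)
  have h0 : ¬ Function.Bijective (0 : Module.End Λ M) := fun h => by
    obtain ⟨x, hx⟩ := exists_ne (0 : M)
    exact hx (h.1 rfl)
  let W : Submodule R (Fin p → M) :=
    { carrier := {v | ∃ g : Module.End Λ M, ¬ Function.Bijective g ∧
        ∀ k, v k - g (m k) ∈ smulTop Λ M J}
      zero_mem' := ⟨0, h0, fun k => by simp⟩
      add_mem' := by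
        rintro v w ⟨g, hg, hgv⟩ ⟨g', hg', hgw⟩
        refine ⟨g + g', fun h => (hM.bijective_of_add h).elim hg hg', fun k => ?_⟩
        have : (v + w) k - (g + g') (m k) = (v k - g (m k)) + (w k - g' (m k)) := by
          simp only [Pi.add_apply, LinearMap.add_apply]
          abel
        rw [this]
        exact add_mem (hgv k) (hgw k)
      smul_mem' := by
        rintro r v ⟨g, hg, hgv⟩
        refine ⟨r • g, fun h => hg ⟨fun x y hxy => h.1 ?_, fun y => ?_⟩, fun k => ?_⟩
        · simp [hxy]
        · obtain ⟨x, hx⟩ := h.2 y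
          exact ⟨r • x, by rw [LinearMap.map_smul_of_tower]; exact hx⟩
        · rw [Pi.smul_apply, LinearMap.smul_apply, ← smul_sub]
          exact (smulTop Λ M J).smul_of_tower_mem r (hgv k) }
  obtain ⟨φ, hφ⟩ := exists_linearMap_apply_eq hE he (W.mkQ m) (fun r hr => by
    by_contra hru
    have hru : IsUnit r := by simpa using hru
    rw [← map_smul] at hr
    obtain ⟨g, hg, hgm⟩ : r • m ∈ W := (Submodule.Quotient.mk_eq_zero W).1 hr
    let h : Module.End Λ M := r • LinearMap.id - g
    have hh : ∀ x, h x ∈ smulTop Λ M J := fun x => by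
      have : LinearMap.range (h ∘ₗ q) ≤ smulTop Λ M J := by
        rw [LinearMap.range_eq_map, ← (Pi.basisFun Λ (Fin p)).span_eq, Submodule.map_span_le]
        rintro _ ⟨k, rfl⟩
        simpa [h, m] using hgm k
      obtain ⟨y, rfl⟩ := hq x
      exact this ⟨y, rfl⟩
    have hhb : ¬ Function.Bijective h := fun hb => by
      have hfin : Module.Finite R M := Module.Finite.trans Λ M
      have : (⊤ : Submodule R M) = ⊥ := by
        refine Submodule.eq_bot_of_le_smul_of_le_jacobson_bot J ⊤ hfin.1 (fun x _ => ?_)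
          (hJ.trans (IsLocalRing.maximalIdeal_le_jacobson ⊥))
        obtain ⟨y, rfl⟩ := hb.2 x
        exact mem_smulTop.1 (hh y)
      obtain ⟨x, hx⟩ := exists_ne (0 : M)
      exact hx (by simpa [this] using (Submodule.mem_top : x ∈ (⊤ : Submodule R M)))
    have hsum : Function.Bijective (h + g) := by
      have : (h + g : Module.End Λ M) = r • LinearMap.id := by simp [h]
      rw [this]
      obtain ⟨b, hb⟩ := hru.exists_left_inv
      refine ⟨fun x y hxy => ?_, fun y => ⟨b • y, ?_⟩⟩
      · have := congrArg (b • ·) hxy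
        simpa [smul_smul, hb] using this
      · simp [smul_smul, mul_comm r b, hb]
    exact (hM.bijective_of_add hsum).elim hhb hg)
  refine ⟨φ ∘ₗ W.mkQ, hφ, fun v hv => ?_, fun g hg => ?_⟩
  · have : W.mkQ v = 0 := by
      rw [Submodule.mkQ_apply, Submodule.Quotient.mk_eq_zero]
      exact ⟨0, h0, fun k => by simpa using hv k⟩
    simp only [LinearMap.comp_apply, this, map_zero]
  · have : W.mkQ (fun k => g (m k)) = 0 := by
      rw [Submodule.mkQ_apply, Submodule.Quotient.mk_eq_zero]
      exact ⟨g, hg, fun k => by simp⟩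
    simp only [LinearMap.comp_apply]
    rw [this, map_zero]

end Detector

section Detector

lemma ofList_map_pow_le {R : Type u} [CommRing R] (ys : List R) {a : ℕ} (ha : a ≠ 0) {I : Ideal R}
    (h : ∀ y ∈ ys, y ∈ I) :
    Ideal.ofList (ys.map (· ^ a)) ≤ (Ideal.ofList ys ⊓ I : Ideal R) := by
  refine Ideal.span_le.2 fun z hz => ?_
  obtain ⟨y, hy, rfl⟩ := List.mem_map.1 hz
  exact ⟨Ideal.pow_mem_of_mem (Ideal.ofList ys) (Ideal.subset_span (s := {x | x ∈ ys}) hy) a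
      (Nat.pos_of_ne_zero ha),
    Ideal.pow_mem_of_mem _ (h y hy) a (Nat.pos_of_ne_zero ha)⟩

variable {R : Type u} [CommRing R] [IsNoetherianRing R] [IsLocalRing R]
  {Λ : Type u} [Ring Λ] [Algebra R Λ] [Module.Finite R Λ] {xs : List R}

lemma sum_apply_single {S : Type u} [Ring S] {X Y : Type u} [AddCommGroup X] [Module S X]
    [AddCommGroup Y] [Module S Y] {p : ℕ} (f : (Fin p → X) →ₗ[S] Y) (v : Fin p → X) :
    ∑ k, f (Pi.single k (v k)) = f v := by
  rw [← map_sum, Finset.univ_sum_single]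

omit [Module.Finite R Λ] in
lemma isFiniteLength_of_pow_smul {C : Type u} [AddCommGroup C] [Module Λ C] [Module R C]
    [IsScalarTower R Λ C] [Module.Finite R C] (n : ℕ)
    (h : ∀ s ∈ maximalIdeal R ^ n, ∀ x : C, s • x = 0) : IsFiniteLength Λ C := by
  have := isArtinian_of_pow_smul n C h
  rw [isFiniteLength_iff_isNoetherian_isArtinian]
  exact ⟨isNoetherian_of_tower R inferInstance, isArtinian_of_tower R inferInstance⟩

lemma exists_detector (hxs : ∀ x ∈ xs, x ∈ maximalIdeal R)
    (hlen : (xs.length : WithBot ℕ∞) = ringKrullDim R)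
    (hΛ : RingTheory.Sequence.IsWeaklyRegular Λ xs)
    {M : Type u} [AddCommGroup M] [Module Λ M] [Module R M] [IsScalarTower R Λ M]
    (hM : IsLat xs Λ M) (hM' : EndLocal Λ M) :
    ∃ (A B : LMod R Λ) (b : M →ₗ[Λ] B) (π : A →ₗ[Λ] B), IsFiniteLength Λ A ∧
      IsFiniteLength Λ B ∧
      (∀ (T : LMod R Λ) (f : T →ₗ[Λ] M) (a : T →ₗ[Λ] A), b ∘ₗ f = π ∘ₗ a →
        ¬ ∃ g : M →ₗ[Λ] T, f ∘ₗ g = LinearMap.id) ∧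
      ∀ (T : LMod R Λ), IsLat xs Λ T → ∀ f : T →ₗ[Λ] M,
        (¬ ∃ g : M →ₗ[Λ] T, f ∘ₗ g = LinearMap.id) → ∃ a : T →ₗ[Λ] A, b ∘ₗ f = π ∘ₗ a := by
  have : IsNoetherianRing Λ := IsNoetherianRing.of_finite R Λ
  obtain ⟨hfin, hreg, n, hn⟩ := hM
  let ys : List R := xs.map (· ^ (n + 1))
  have hysm : ∀ y ∈ ys, y ∈ maximalIdeal R ^ (n + 1) := fun y hy => by
    obtain ⟨x, hx, rfl⟩ := List.mem_map.1 hy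
    exact Ideal.pow_mem_pow (hxs x hx) _
  have hym : ∀ y ∈ ys, y ∈ maximalIdeal R := fun y hy => Ideal.pow_le_self (by simp) (hysm y hy)
  have hystab : ∀ y ∈ ys, y ∈ stabIdeal R Λ M := fun y hy =>
    hn (Ideal.pow_le_pow_right (Nat.le_succ n) (hysm y hy))
  let J₁ := Ideal.ofList ys
  let J₂ := Ideal.ofList (ys.map (· ^ 2))
  have hJ₁ : J₁ ≤ maximalIdeal R := Ideal.span_le.2 hym
  have hJ₂ : J₂ ≤ J₁ := (ofList_map_pow_le ys two_ne_zero hym).trans inf_le_left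
  have hJ₂m : ∀ y ∈ ys.map (· ^ 2), y ∈ maximalIdeal R := fun y hy =>
    (ofList_map_pow_le ys two_ne_zero hym).trans inf_le_right (Ideal.subset_span hy)
  obtain ⟨N, hN⟩ := exists_pow_algebraMap_mem_smulTop hJ₂m
    (isWeaklyRegular_pow (isWeaklyRegular_pow hΛ (n + 1)) 2) (by simpa [ys] using hlen)
  obtain ⟨p, q, hq⟩ := Module.Finite.exists_fin' Λ M
  obtain ⟨p', q', hq'⟩ := Module.Finite.exists_fin' Λ (LinearMap.ker q)
  let m : Fin p → M := fun k => q (Pi.single k 1)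
  let c : Fin p' → Fin p → Λ := fun j => q' (Pi.single j 1)
  have hcm : ∀ j, ∑ k, c j k • m k = 0 := fun j => by
    have h1 : q (c j) = 0 := (q' (Pi.single j 1)).2
    rw [← h1, ← sum_apply_single q]
    refine Finset.sum_congr rfl fun k _ => ?_
    rw [← map_smul, ← Pi.single_smul, smul_eq_mul, mul_one]
  -- maps out of `M` from solutions of the relations
  have hmap : ∀ (T : Type u) [AddCommGroup T] [Module Λ T] (x : Fin p → T),
      (∀ j, ∑ k, c j k • x k = 0) → ∃ g : M →ₗ[Λ] T, ∀ k, g (m k) = x k := by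
    intro T _ _ x hx
    obtain ⟨g, hg⟩ := exists_factor_of_surjective hq (Fintype.linearCombination Λ x) (by
      intro y hy
      obtain ⟨z, hz⟩ := hq' ⟨y, hy⟩
      have h1 : Fintype.linearCombination Λ x ∘ₗ (LinearMap.ker q).subtype ∘ₗ q' = 0 := by
        refine LinearMap.pi_ext' fun j => LinearMap.ext_ring ?_
        simpa [Fintype.linearCombination_apply] using hx j
      have h2 := LinearMap.congr_fun h1 z
      simpa [hz] using h2)
    exact ⟨g, fun k => by simpa [m] using LinearMap.congr_fun hg (Pi.single k 1)⟩
  obtain ⟨E, _, _, e, hE, he0, he, hess⟩ := exists_injectiveHull R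
  obtain ⟨σ, hσe, hσJ, hσ⟩ := exists_trace hM' hq hJ₁ hE he
  let E' := torsionPow R E N
  have hE'fin : Module.Finite R E' := Module.Finite.iff_fg.2 (fg_torsionPow he0 hess N)
  let σ' : Fin p → M →ₗ[R] E' := fun k =>
    (σ ∘ₗ LinearMap.single R (fun _ => M) k).codRestrict E' fun x s hs => by
      rw [← map_smul, LinearMap.comp_apply]
      refine hσJ _ fun l => ?_
      rw [LinearMap.single_apply]
      by_cases hl : l = k
      · subst hl
        rw [Pi.single_eq_same]
        have := smul_mem_of_one_mem (N := M) (hN s hs) x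
        exact smulTop_le (fun s hs x => smul_mem_smulTop (hJ₂ hs) x) this
      · rw [Pi.single_eq_of_ne hl]
        exact zero_mem _
  have hσ' : ∀ v : Fin p → M, ∑ k, (σ' k (v k) : E) = σ v := fun v => by
    rw [← sum_apply_single σ]
    rfl
  let C := Coind R Λ E'
  have hCs : ∀ s ∈ maximalIdeal R ^ N, ∀ x : C, s • x = 0 := fun s hs x =>
    Coind.ext' fun μ => Subtype.ext ((x.toHom μ).2 s hs)
  let b : M →ₗ[Λ] (Fin p → C) := LinearMap.pi fun k => Coind.lift (σ' k)
  let π : (Fin p' → C) →ₗ[Λ] (Fin p → C) :=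
    LinearMap.pi fun k => ∑ j, Coind.mulLeft (c j k) ∘ₗ LinearMap.proj j
  have hπ : ∀ θ k μ, (π θ k).toHom μ = ∑ j, (θ j).toHom (c j k * μ) := fun θ k μ => by
    have h1 : π θ k = ∑ j, Coind.mulLeft (c j k) (θ j) := by
      simp [π, LinearMap.sum_apply]
    rw [h1, ← Coind.eval_apply, map_sum]
    rfl
  refine ⟨.of R Λ (Fin p' → C), .of R Λ (Fin p → C), b, π,
    isFiniteLength_of_pow_smul N fun s hs x => funext fun j => hCs s hs _,
    isFiniteLength_of_pow_smul N fun s hs x => funext fun j => hCs s hs _, ?_, ?_⟩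
  · rintro T f a hba ⟨g, hfg⟩
    have h1 : ∀ k, b (m k) = π (a (g (m k))) := fun k => by
      have h1 : f (g (m k)) = m k := LinearMap.congr_fun hfg (m k)
      have h2 : b (f (g (m k))) = π (a (g (m k))) := LinearMap.congr_fun hba (g (m k))
      rwa [h1] at h2
    have h2 : ∀ k, σ' k (m k) = ∑ j, ((c j k • a (g (m k))) j).toHom 1 := fun k => by
      have h3 : σ' k (m k) = (b (m k) k).toHom 1 := by
        change σ' k (m k) = σ' k ((1 : Λ) • m k)
        rw [one_smul]
      rw [h3, h1, hπ]
      refine Finset.sum_congr rfl fun j _ => ?_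
      rw [Pi.smul_apply, Coind.toHom_smul', mul_one, one_mul]
    have h4 : ∑ k, σ' k (m k) = 0 := by
      simp only [h2]
      rw [Finset.sum_comm]
      refine Finset.sum_eq_zero fun j _ => ?_
      have h5 : ∑ k, (c j k • a (g (m k))) j = 0 := by
        rw [← Finset.sum_apply]
        simp only [← map_smul]
        rw [← map_sum, ← map_sum, hcm, map_zero, map_zero]
        rfl
      simp only [← Coind.eval_apply]
      rw [← map_sum, h5, map_zero]
    apply he0
    rw [← hσe, ← hσ' m, ← Submodule.coe_sum, h4, Submodule.coe_zero]
  · intro T hT f hf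
    let K := smulTop Λ T J₂
    let ℓ : (Fin p → T) →ₗ[R] (Fin p' → T ⧸ K) := LinearMap.pi fun j =>
      (K.mkQ.restrictScalars R) ∘ₗ ∑ k, actionMap R Λ T (c j k) ∘ₗ LinearMap.proj k
    have hℓ : ∀ x j, ℓ x j = K.mkQ (∑ k, c j k • x k) := fun x j => by
      simp [ℓ, actionMap]
    let φ : (Fin p → T) →ₗ[R] E := σ ∘ₗ (f.restrictScalars R).compLeft (Fin p)
    have hφ : ∀ x, φ x = σ (fun k => f (x k)) := fun x => rfl
    obtain ⟨τ, hτ⟩ := exists_factor_of_ker_le hE ℓ φ (by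
      intro x hx
      obtain ⟨ψ, hψ⟩ := hmap (T ⧸ K) (fun k => K.mkQ (x k)) (fun j => by
        have h1 := congrFun hx j
        rw [hℓ, map_sum] at h1
        simpa using h1)
      obtain ⟨g, hg⟩ := exists_lift_mod_list ys hystab (N := T)
        (isWeaklyRegular_pow (isWeaklyRegular_pow hT.2.1 (n + 1)) 2) K.mkQ_surjective
        K.ker_mkQ ψ
      have hxg : ∀ k, x k - g (m k) ∈ smulTop Λ T J₁ := fun k => by
        have h1 := hg (m k)
        rw [hψ, ← map_sub] at h1
        obtain ⟨z, hz, hzk⟩ := exists_preimage_mem_smulTop K.mkQ_surjective h1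
        have h2 : x k - g (m k) - z ∈ K := by
          rw [← K.ker_mkQ, LinearMap.mem_ker, map_sub, hzk, sub_self]
        have h3 := smulTop_le (fun s hs x => smul_mem_smulTop (hJ₂ hs) x) h2
        simpa using add_mem h3 hz
      have hfg : ¬ Function.Bijective (f ∘ₗ g) := fun h => hf (by
        obtain ⟨s, hs⟩ := exists_section_of_comp_bijective h
        exact ⟨s, hs⟩)
      have h1 := hσ (f ∘ₗ g) hfg
      have h2 := hσJ (fun k => f (x k - g (m k))) fun k => map_mem_smulTop f (hxg k)
      rw [LinearMap.mem_ker, hφ, ← add_zero (0 : E)]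
      conv_rhs => 
        congr
        · rw [← h2]
        · rw [← h1]
      rw [← map_add]
      congr 1
      funext k
      simp [m])
    let ρ : Fin p' → T →ₗ[R] E' := fun j =>
      (τ ∘ₗ LinearMap.single R (fun _ => T ⧸ K) j ∘ₗ K.mkQ.restrictScalars R).codRestrict E'
        fun x s hs => by
          have : K.mkQ (s • x) = 0 := by
            rw [Submodule.mkQ_apply, Submodule.Quotient.mk_eq_zero]
            exact smul_mem_of_one_mem (hN s hs) x
          rw [← map_smul]
          simp only [LinearMap.comp_apply, LinearMap.restrictScalars_apply, this, map_zero]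
    refine ⟨LinearMap.pi fun j => Coind.lift (ρ j), LinearMap.ext fun t => funext fun k =>
      Coind.ext' fun μ => Subtype.ext ?_⟩
    simp only [LinearMap.comp_apply]
    rw [hπ, Submodule.coe_sum]
    have h1 : τ (ℓ (Pi.single k (μ • t))) = φ (Pi.single k (μ • t)) := LinearMap.congr_fun hτ _
    rw [← sum_apply_single τ] at h1
    have h2 : ∀ j, ℓ (Pi.single k (μ • t)) j = K.mkQ ((c j k * μ) • t) := fun j => by
      rw [hℓ, Finset.sum_eq_single k, Pi.single_eq_same, mul_smul]
      · intro l _ hl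
        rw [Pi.single_eq_of_ne hl, smul_zero]
      · simp
    have h3 : φ (Pi.single k (μ • t)) = σ (Pi.single k (μ • f t)) := by
      rw [hφ]
      congr 1
      funext l
      by_cases hl : l = k
      · subst hl
        simp
      · simp [Pi.single_eq_of_ne hl]
    refine Eq.trans (b := σ (Pi.single k (μ • f t))) rfl ?_
    rw [← h3, ← h1]
    refine Finset.sum_congr rfl fun j _ => ?_
    rw [h2]
    rfl

end Detector

section Sink

variable {R : Type u} [CommRing R] [IsLocalRing R] (xs : List R)
  (Λ : Type u) [Ring Λ] [Algebra R Λ]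

/-- Up to a direct summand, all modules of finite length have lattice approximations. -/
def FinApprox : Prop :=
  ∀ (C : Type u) [AddCommGroup C] [Module Λ C], IsFiniteLength Λ C →
    ∃ (C' : Type u) (_ : AddCommGroup C') (_ : Module Λ C'), HasApprox xs Λ (C × C')

variable {Λ}

/-- A right almost split map onto `M` in the category of lattices. -/
def IsSink {E M : Type u} [AddCommGroup E] [Module Λ E] [AddCommGroup M] [Module Λ M]
    (g : E →ₗ[Λ] M) : Prop :=
  (¬ ∃ s : M →ₗ[Λ] E, g ∘ₗ s = LinearMap.id) ∧ ∀ T : LMod R Λ, IsLat xs Λ T → ∀ f : T →ₗ[Λ] M,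
    (¬ ∃ s : M →ₗ[Λ] T, f ∘ₗ s = LinearMap.id) → ∃ h : T →ₗ[Λ] E, g ∘ₗ h = f

variable {xs}

lemma exists_isSink [IsNoetherianRing Λ] (hΛ : RingTheory.Sequence.IsWeaklyRegular Λ xs)
    (happ : FinApprox xs Λ) {M : Type u} [AddCommGroup M] [Module Λ M] [Module R M]
    [IsScalarTower R Λ M] (hM : IsLat xs Λ M) (A B : LMod R Λ) (b : M →ₗ[Λ] B) (π : A →ₗ[Λ] B)
    (hA : IsFiniteLength Λ A) (hB : IsFiniteLength Λ B)
    (h₁ : ∀ (T : LMod R Λ) (f : T →ₗ[Λ] M) (a : T →ₗ[Λ] A), b ∘ₗ f = π ∘ₗ a →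
        ¬ ∃ g : M →ₗ[Λ] T, f ∘ₗ g = LinearMap.id)
    (h₂ : ∀ (T : LMod R Λ), IsLat xs Λ T → ∀ f : T →ₗ[Λ] M,
        (¬ ∃ g : M →ₗ[Λ] T, f ∘ₗ g = LinearMap.id) → ∃ a : T →ₗ[Λ] A, b ∘ₗ f = π ∘ₗ a) :
    ∃ (E : LMod R Λ) (g : E →ₗ[Λ] M), IsLat xs Λ E ∧ IsSink xs g := by
  let B₁ := LinearMap.range (b.coprod π)
  let b₁ : M →ₗ[Λ] B₁ := b.codRestrict B₁ fun m => ⟨(m, 0), by simp⟩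
  let π₁ : A →ₗ[Λ] B₁ := π.codRestrict B₁ fun a => ⟨(0, a), by simp⟩
  have hB₁ : IsFiniteLength Λ B₁ := by
    rw [isFiniteLength_iff_isNoetherian_isArtinian] at hB ⊢
    obtain ⟨_, _⟩ := hB
    exact ⟨inferInstance, inferInstance⟩
  have hbπ : ∀ y : B₁, ∃ m a, b₁ m + π₁ a = y := by
    rintro ⟨_, ⟨m, a⟩, rfl⟩
    exact ⟨m, a, rfl⟩
  obtain ⟨A', _, _, XA, pA, hXA, hpA, hKA⟩ := happ A hA
  obtain ⟨B', _, _, XB, pB, hXB, hpB, L, l, hL, hl, hL2, hkl⟩ := happ B₁ hB₁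
  have hKA' := hKA.relInj hΛ
  have hKB' : RelInj xs Λ (LinearMap.ker pB) := LatResolved.relInj hΛ ⟨L, l, hL, hl, hL2, hkl⟩
  obtain ⟨b', hb'⟩ := hKB'.exists_lift hpB hM (LinearMap.inl Λ B₁ B' ∘ₗ b₁)
  obtain ⟨a', ha'⟩ := hKB'.exists_lift hpB hXA
    (LinearMap.inl Λ B₁ B' ∘ₗ π₁ ∘ₗ LinearMap.fst Λ A A' ∘ₗ pA)
  obtain ⟨F, hF⟩ := hKB'.exists_lift hpB hXB
    (LinearMap.inr Λ B₁ B' ∘ₗ LinearMap.snd Λ B₁ B' ∘ₗ pB)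
  replace hb' : ∀ m, pB (b' m) = (b₁ m, 0) := fun m => LinearMap.congr_fun hb' m
  replace ha' : ∀ m, pB (a' m) = (π₁ (pA m).1, 0) := fun m => LinearMap.congr_fun ha' m
  replace hF : ∀ m, pB (F m) = (0, (pB m).2) := fun m => LinearMap.congr_fun hF m
  have hl' : ∀ z, pB (l z) = 0 := fun z => (l z).2
  let Φ : M × XA × XB × L →ₗ[Λ] XB :=
    b'.coprod (a'.coprod (F.coprod ((LinearMap.ker pB).subtype ∘ₗ l)))
  have hΦ : ∀ m x y z, Φ (m, x, y, z) = b' m + (a' x + (F y + l z)) := fun m x y z => rfl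
  have hΦs : Function.Surjective Φ := by
    intro w
    obtain ⟨m, a, hma⟩ := hbπ (pB w).1
    obtain ⟨x, hx⟩ := hpA (a, 0)
    obtain ⟨z, hz⟩ := hl ⟨w - (b' m + (a' x + F w)), by
      rw [LinearMap.mem_ker, map_sub, map_add, map_add, hb', ha', hF, hx, sub_eq_zero]
      ext1 <;> simp [← hma]⟩
    refine ⟨(m, x, w, z), ?_⟩
    rw [hΦ, hz]
    simp only
    abel
  have hE : IsLat xs Λ (LinearMap.ker Φ) := (hM.prod (hXA.prod (hXB.prod hL))).ker hXB Φ hΦs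
  refine ⟨.of R Λ (LinearMap.ker Φ), LinearMap.fst Λ M _ ∘ₗ (LinearMap.ker Φ).subtype, hE, ?_, ?_⟩
  · rintro ⟨s, hs⟩
    let s' := (LinearMap.ker Φ).subtype ∘ₗ s
    have hs1 : ∀ m, (s' m).1 = m := fun m => LinearMap.congr_fun hs m
    refine h₁ (.of R Λ M) LinearMap.id
      (-(LinearMap.fst Λ A A' ∘ₗ pA ∘ₗ LinearMap.fst Λ XA _ ∘ₗ LinearMap.snd Λ M _ ∘ₗ s')) ?_
      ⟨LinearMap.id, rfl⟩
    refine LinearMap.ext fun m => ?_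
    have h3 : Φ (s' m) = 0 := (s m).2
    have h4 : b₁ m + π₁ (pA (s' m).2.1).1 = 0 := by
      have h5 := congrArg (fun x => (pB x).1) h3
      have h6 : s' m = ((s' m).1, (s' m).2.1, (s' m).2.2.1, (s' m).2.2.2) := rfl
      rw [h6, hΦ] at h5
      simpa [hb', ha', hF, hl', hs1] using h5
    have h5 : b m + π (pA (s' m).2.1).1 = 0 := congrArg Subtype.val h4
    simpa using eq_neg_of_add_eq_zero_left h5
  · intro T hT f hf
    obtain ⟨a, ha⟩ := h₂ T hT f hf
    obtain ⟨c, hc⟩ := hKA'.exists_lift hpA hT (LinearMap.inl Λ A A' ∘ₗ a)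
    replace hc : ∀ t, pA (c t) = (a t, 0) := fun m => LinearMap.congr_fun hc m
    have ha1 : ∀ t, b₁ (f t) = π₁ (a t) := fun t => Subtype.ext (LinearMap.congr_fun ha t)
    obtain ⟨k, hk⟩ := hkl.exists_lift hl hT ((b' ∘ₗ f - a' ∘ₗ c).codRestrict (LinearMap.ker pB)
      fun t => by
        rw [LinearMap.mem_ker, LinearMap.sub_apply, map_sub, LinearMap.comp_apply, hb',
          LinearMap.comp_apply, ha', hc, ha1, sub_self])
    replace hk : ∀ t, (l (k t) : XB) = b' (f t) - a' (c t) := fun t =>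
      congrArg Subtype.val (LinearMap.congr_fun hk t)
    refine ⟨(f.prod ((-c).prod ((0 : T →ₗ[Λ] XB).prod (-k)))).codRestrict (LinearMap.ker Φ)
      fun t => ?_, rfl⟩
    have : (f.prod ((-c).prod ((0 : T →ₗ[Λ] XB).prod (-k)))) t = (f t, -c t, 0, -k t) := rfl
    rw [LinearMap.mem_ker, this, hΦ, map_neg, map_neg, map_zero, Submodule.coe_neg, hk]
    abel

end Sink

section MinSink

variable {R : Type u} [CommRing R] [IsNoetherianRing R] [IsLocalRing R]
  [IsAdicComplete (maximalIdeal R) R]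
  {Λ : Type u} [Ring Λ] [Algebra R Λ] [Module.Finite R Λ] {xs : List R}

lemma exists_minimal_isSink (hxs : ∀ x ∈ xs, x ∈ maximalIdeal R)
    (hlen : (xs.length : WithBot ℕ∞) = ringKrullDim R)
    (hΛ : RingTheory.Sequence.IsWeaklyRegular Λ xs) (happ : FinApprox xs Λ)
    {M : Type u} [AddCommGroup M] [Module Λ M] [Module R M] [IsScalarTower R Λ M]
    (hM : IsLat xs Λ M) (hM' : EndLocal Λ M) :
    ∃ (E : LMod R Λ) (g : E →ₗ[Λ] M), IsLat xs Λ E ∧ IsSink xs g ∧ RightMinimal Λ g := by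
  have : IsNoetherianRing Λ := IsNoetherianRing.of_finite R Λ
  obtain ⟨A, B, b, π, hA, hB, h₁, h₂⟩ := exists_detector hxs hlen hΛ hM hM'
  obtain ⟨E, g, hE, hg1, hg2⟩ := exists_isSink hΛ happ hM A B b π hA hB h₁ h₂
  have := hE.1
  obtain ⟨E', p, s, g', hps, hgp, hmin⟩ := exists_rightMinimal R g
  refine ⟨E', g', hE.retract s p hps, ⟨?_, fun T hT f hf => ?_⟩, hmin⟩
  · rintro ⟨t, ht⟩
    refine hg1 ⟨s ∘ₗ t, LinearMap.ext fun m => ?_⟩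
    have h1 := LinearMap.congr_fun hps (t m)
    have h2 := LinearMap.congr_fun ht m
    simp only [LinearMap.comp_apply, LinearMap.id_apply, ← hgp] at h1 h2 ⊢
    rw [h1, h2]
  · obtain ⟨h, hh⟩ := hg2 T hT f hf
    exact ⟨p ∘ₗ h, by rw [← LinearMap.comp_assoc, hgp, hh]⟩

end MinSink

section Splitting

variable {Λ : Type u} [Ring Λ] {E M Z : Type u} [AddCommGroup E] [Module Λ E] [AddCommGroup M]
  [Module Λ M] [AddCommGroup Z] [Module Λ Z]

lemma exists_section_of_retraction {g : E →ₗ[Λ] M} (hg : Function.Surjective g)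
    (ρ : E →ₗ[Λ] LinearMap.ker g) (hρ : ∀ n : LinearMap.ker g, ρ n = n) :
    ∃ s : M →ₗ[Λ] E, g ∘ₗ s = LinearMap.id := by
  obtain ⟨s, hs⟩ := exists_factor_of_surjective hg
    (LinearMap.id - (LinearMap.ker g).subtype ∘ₗ ρ) fun x hx => by
      rw [LinearMap.mem_ker, LinearMap.sub_apply, LinearMap.comp_apply, hρ ⟨x, hx⟩]
      exact sub_self x
  refine ⟨s, LinearMap.ext fun m => ?_⟩
  obtain ⟨x, rfl⟩ := hg m
  have h1 := LinearMap.congr_fun hs x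
  simp only [LinearMap.comp_apply] at h1
  simp [h1]

lemma exists_retraction_of_section {i : Z →ₗ[Λ] E} {g : E →ₗ[Λ] M} (hi : Function.Injective i)
    (hex : Function.Exact i g) (s : M →ₗ[Λ] E) (hs : g ∘ₗ s = LinearMap.id) :
    ∃ r : E →ₗ[Λ] Z, ∀ z, r (i z) = z := by
  let e := LinearEquiv.ofInjective i hi
  have hs' : ∀ m, g (s m) = m := fun m => LinearMap.congr_fun hs m
  refine ⟨e.symm.toLinearMap ∘ₗ (LinearMap.id - s ∘ₗ g).codRestrict (LinearMap.range i)
    fun x => (hex _).1 (by simp [hs']), fun z => ?_⟩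
  have h1 : g (i z) = 0 := hex.apply_apply_eq_zero z
  rw [LinearMap.comp_apply, LinearEquiv.coe_coe, e.symm_apply_eq]
  refine Subtype.ext ?_
  change i z - s (g (i z)) = i z
  rw [h1, map_zero, sub_zero]

end Splitting

section AlmostSplit

variable {R : Type u} [CommRing R] [IsNoetherianRing R] [IsLocalRing R]
  [IsAdicComplete (maximalIdeal R) R]
  {Λ : Type u} [Ring Λ] [Algebra R Λ] [Module.Finite R Λ] {xs : List R}
  {E M Z : Type u} [AddCommGroup E] [Module Λ E] [Module R E] [IsScalarTower R Λ E]
  [AddCommGroup M] [Module Λ M] [Module R M] [IsScalarTower R Λ M]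
  [AddCommGroup Z] [Module Λ Z] [Module R Z] [IsScalarTower R Λ Z]

namespace IsSink

omit [IsNoetherianRing R] [IsAdicComplete (maximalIdeal R) R] [Module.Finite R Λ]

omit [Module R E] [IsScalarTower R Λ E] in
lemma surjective (hΛ : RingTheory.Sequence.IsWeaklyRegular Λ xs) {g : E →ₗ[Λ] M} (hg : IsSink xs g)
    (hM : IsLat xs Λ M) (hp : ¬ Module.Projective Λ M) : Function.Surjective g := by
  have := hM.1
  obtain ⟨n, q, hq⟩ := Module.Finite.exists_fin' Λ M
  obtain ⟨h, hh⟩ := hg.2 (.of R Λ (Fin n → Λ)) (IsLat.free hΛ n) q fun ⟨s, hs⟩ =>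
    hp (Module.Projective.of_split s q hs)
  intro m
  obtain ⟨x, rfl⟩ := hq m
  exact ⟨h x, LinearMap.congr_fun hh x⟩

omit [Module R E] [IsScalarTower R Λ E] [Module R M] [IsScalarTower R Λ M] in
lemma not_retraction {g : E →ₗ[Λ] M} (hg : IsSink xs g) (hs : Function.Surjective g)
    (ρ : E →ₗ[Λ] LinearMap.ker g) (hρ : ∀ n : LinearMap.ker g, ρ n = n) : False :=
  hg.1 (exists_section_of_retraction hs ρ hρ)

/-- Maps from the kernel of a minimal right almost split map which are not split monomorphisms
extend to the middle term. -/
lemma exists_extend {g : E →ₗ[Λ] M} (hg : IsSink xs g) (hmin : RightMinimal Λ g)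
    (hs : Function.Surjective g) (hM : IsLat xs Λ M) (hZ : IsLat xs Λ Z)
    (j : LinearMap.ker g →ₗ[Λ] Z) (hj : ¬ ∃ r : Z →ₗ[Λ] LinearMap.ker g, ∀ n, r (j n) = n) :
    ∃ φ : E →ₗ[Λ] Z, ∀ n : LinearMap.ker g, φ n = j n := by
  let i := (LinearMap.ker g).subtype
  have hig : ∀ n, g (i n) = 0 := fun n => n.2
  have hex : Function.Exact i g := LinearMap.exact_subtype_ker_map g
  let c := Pushout.toCoker j hig
  have hc : ∀ e, c (Pushout.inr i j e) = g e := fun e => Pushout.desc_inr _ e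
  have hexP := Pushout.exact_toCoker (j := j) hig hex
  have hinj := Pushout.inl_injective (j := j) (Submodule.subtype_injective (LinearMap.ker g))
  have hP : IsLat xs Λ (Pushout i j) :=
    hZ.extension hM (Pushout.inl i j) c hinj (Pushout.toCoker_surjective hig hs) hexP
  by_cases h : ∃ s : M →ₗ[Λ] Pushout i j, c ∘ₗ s = LinearMap.id
  · obtain ⟨s, hs⟩ := h
    obtain ⟨r, hr⟩ := exists_retraction_of_section hinj hexP s hs
    exact ⟨r ∘ₗ Pushout.inr i j, fun n => by
      rw [LinearMap.comp_apply, ← hr (j n), Pushout.condition]; rfl⟩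
  · exfalso
    obtain ⟨k, hk⟩ := hg.2 (.of R Λ (Pushout i j)) hP c h
    have hk' : ∀ w, g (k w) = c w := fun w => LinearMap.congr_fun hk w
    have hb := hmin (k ∘ₗ Pushout.inr i j) (LinearMap.ext fun e => by simp [hk', hc])
    let u := LinearEquiv.ofBijective _ hb
    have hu : ∀ e, g (u e) = g e := fun e => by
      rw [← hc e, ← hk']
      rfl
    have hu' : ∀ e, g (u.symm e) = g e := fun e => by
      rw [← hu, u.apply_symm_apply]
    refine hj ⟨(u.symm.toLinearMap ∘ₗ k ∘ₗ Pushout.inl i j).codRestrict _ fun z => ?_, fun n => ?_⟩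
    · rw [LinearMap.mem_ker]
      simp only [LinearMap.comp_apply, LinearEquiv.coe_coe]
      rw [hu', hk']
      exact hexP.apply_apply_eq_zero z
    · refine Subtype.ext (u.symm_apply_eq.2 ?_)
      simp only [LinearMap.comp_apply]
      rw [Pushout.condition]
      rfl

lemma isIndecomposable_ker [IsNoetherianRing Λ] {g : E →ₗ[Λ] M} (hg : IsSink xs g)
    (hmin : RightMinimal Λ g)
    (hs : Function.Surjective g) (hE : IsLat xs Λ E) (hM : IsLat xs Λ M) :
    IsIndecomposable Λ (LinearMap.ker g) := by
  have hN := hE.ker hM g hs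
  refine ⟨?_, fun A B hAB => ?_⟩
  · by_contra h
    rw [not_nontrivial_iff_subsingleton] at h
    exact hg.not_retraction hs 0 fun n => Subsingleton.elim _ _
  · by_contra! h
    have key : ∀ A B : Submodule Λ (LinearMap.ker g), ∀ hAB : IsCompl A B, B ≠ ⊥ →
        ∃ φ : E →ₗ[Λ] A, ∀ n : LinearMap.ker g, φ n = A.projectionOnto B hAB n := by
      intro A B hAB hB
      have hA : IsLat xs Λ A := hN.retract A.subtype (A.projectionOnto B hAB)
        (LinearMap.ext fun a => Submodule.projectionOnto_apply_left hAB a)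
      refine hg.exists_extend hmin hs hM hA _ fun ⟨r, hr⟩ => hB ((Submodule.eq_bot_iff _).2 ?_)
      intro b hb
      rw [← hr b, (Submodule.projectionOnto_apply_eq_zero_iff hAB).2 hb, map_zero]
    obtain ⟨φ, hφ⟩ := key A B hAB h.2
    obtain ⟨ψ, hψ⟩ := key B A hAB.symm h.1
    refine hg.not_retraction hs (A.subtype ∘ₗ φ + B.subtype ∘ₗ ψ) fun n => ?_
    simp only [LinearMap.add_apply, LinearMap.comp_apply, hφ, hψ]
    exact Submodule.projection_add_projection_eq_self hAB n

lemma nonempty_equiv_of_ker {g : E →ₗ[Λ] M} (hg : IsSink xs g) (hmin : RightMinimal Λ g)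
    (hs : Function.Surjective g) (hE : IsLat xs Λ E) (hM : IsLat xs Λ M) (hM' : EndLocal Λ M)
    {E' M' : Type u} [AddCommGroup E'] [Module Λ E'] [Module R E'] [IsScalarTower R Λ E']
    [AddCommGroup M'] [Module Λ M'] [Module R M'] [IsScalarTower R Λ M']
    {g' : E' →ₗ[Λ] M'} (hg' : IsSink xs g') (hmin' : RightMinimal Λ g')
    (hs' : Function.Surjective g') (hE' : IsLat xs Λ E') (hM₁ : IsLat xs Λ M')
    (hM₁' : IsIndecomposable Λ M') (ε : LinearMap.ker g ≃ₗ[Λ] LinearMap.ker g') :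
    Nonempty (M ≃ₗ[Λ] M') := by
  obtain ⟨φ, hφ⟩ := hg.exists_extend hmin hs hM hE' ((LinearMap.ker g').subtype ∘ₗ ε.toLinearMap)
    fun ⟨r, hr⟩ => hg'.not_retraction hs' (ε.toLinearMap ∘ₗ r) fun n => by
      have := hr (ε.symm n)
      simp only [LinearMap.comp_apply, LinearEquiv.coe_coe, LinearEquiv.apply_symm_apply] at this
      simp only [LinearMap.comp_apply, LinearEquiv.coe_coe]
      exact ε.symm_apply_eq.1 this.symm |>.symm
  obtain ⟨φ', hφ'⟩ := hg'.exists_extend hmin' hs' hM₁ hE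
    ((LinearMap.ker g).subtype ∘ₗ ε.symm.toLinearMap)
    fun ⟨r, hr⟩ => hg.not_retraction hs (ε.symm.toLinearMap ∘ₗ r) fun n => by
      have := hr (ε n)
      simp only [LinearMap.comp_apply, LinearEquiv.coe_coe, LinearEquiv.symm_apply_apply] at this
      simp only [LinearMap.comp_apply, LinearEquiv.coe_coe]
      exact ε.symm_apply_eq.2 this
  obtain ⟨f, hf⟩ := exists_factor_of_surjective hs (g' ∘ₗ φ) fun x hx => by
    rw [LinearMap.mem_ker, LinearMap.comp_apply, hφ ⟨x, hx⟩]
    exact (ε ⟨x, hx⟩).2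
  obtain ⟨f', hf'⟩ := exists_factor_of_surjective hs' (g ∘ₗ φ') fun x hx => by
    rw [LinearMap.mem_ker, LinearMap.comp_apply, hφ' ⟨x, hx⟩]
    exact (ε.symm ⟨x, hx⟩).2
  replace hf : ∀ x, f (g x) = g' (φ x) := fun x => LinearMap.congr_fun hf x
  replace hf' : ∀ x, f' (g' x) = g (φ' x) := fun x => LinearMap.congr_fun hf' x
  have := hM'.1
  rcases hM'.2 (f' ∘ₗ f) with h | h
  · exact ⟨LinearEquiv.ofBijective f (bijective_of_comp_bijective hM₁' h).1⟩
  · exfalso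
    obtain ⟨ψ, hψ⟩ := exists_factor_of_surjective hs (LinearMap.id - φ' ∘ₗ φ) fun x hx => by
      rw [LinearMap.mem_ker, LinearMap.sub_apply, LinearMap.comp_apply, hφ ⟨x, hx⟩]
      have := hφ' (ε ⟨x, hx⟩)
      simp only [LinearMap.comp_apply, LinearEquiv.coe_coe, Submodule.subtype_apply] at this ⊢
      rw [this, ε.symm_apply_apply]
      exact sub_self x
    have h1 : g ∘ₗ ψ = 1 - f' ∘ₗ f := LinearMap.ext fun m => by
      obtain ⟨x, rfl⟩ := hs m
      have h2 : ψ (g x) = x - φ' (φ x) := LinearMap.congr_fun hψ x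
      simp [h2, hf, hf']
    exact hg.1 (exists_section_of_comp_bijective (s := ψ) (by rw [h1]; exact h))

/-- If `Y` is a summand of the middle term of the almost split sequence ending in `M`, the left
hand term of this sequence is a summand of the middle term of the one ending in `Y`. -/
lemma exists_ker_summand [IsNoetherianRing Λ] {g : E →ₗ[Λ] M} (hg : IsSink xs g)
    (hmin : RightMinimal Λ g)
    (hs : Function.Surjective g) (hE : IsLat xs Λ E) (hM : IsLat xs Λ M)
    (hM' : IsIndecomposable Λ M) {Y : Type u} [AddCommGroup Y] [Module Λ Y]
    {F : Type u} [AddCommGroup F] [Module Λ F] [Module R F] [IsScalarTower R Λ F]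
    {gY : F →ₗ[Λ] Y} (hgY : IsSink xs gY) (hF : IsLat xs Λ F) (hY' : EndLocal Λ Y)
    (i : Y →ₗ[Λ] E) (p : E →ₗ[Λ] Y) (hpi : p ∘ₗ i = LinearMap.id) :
    ∃ (h : LinearMap.ker g →ₗ[Λ] F) (r : F →ₗ[Λ] LinearMap.ker g), r ∘ₗ h = LinearMap.id := by
  have hN := hE.ker hM g hs
  have hN' := hg.isIndecomposable_ker hmin hs hE hM
  have := hY'.1
  obtain ⟨h, hh⟩ := hgY.2 (.of R Λ (LinearMap.ker g)) hN (p ∘ₗ (LinearMap.ker g).subtype)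
    fun ⟨s, hs1⟩ => by
      have h1 : Function.Bijective ((p ∘ₗ (LinearMap.ker g).subtype) ∘ₗ s) := by
        rw [hs1]; exact Function.bijective_id
      let w := LinearEquiv.ofBijective _ (bijective_of_comp_bijective hN' h1).2
      exact hg.not_retraction hs (w.symm.toLinearMap ∘ₗ p) fun n => w.symm_apply_apply n
  replace hh : ∀ n, gY (h n) = p n := fun n => LinearMap.congr_fun hh n
  by_contra! hcon
  obtain ⟨k, hk⟩ := hg.exists_extend hmin hs hM hF h fun ⟨r, hr⟩ =>
    hcon h r (LinearMap.ext hr)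
  obtain ⟨ψ, hψ⟩ := exists_factor_of_surjective hs (p - gY ∘ₗ k) fun x hx => by
    rw [LinearMap.mem_ker, LinearMap.sub_apply, LinearMap.comp_apply, hk ⟨x, hx⟩, hh]
    exact sub_self _
  have h1 : ψ ∘ₗ (g ∘ₗ i) = 1 - gY ∘ₗ (k ∘ₗ i) := LinearMap.ext fun y => by
    have h2 := LinearMap.congr_fun hψ (i y)
    have h3 := LinearMap.congr_fun hpi y
    simp only [LinearMap.comp_apply, LinearMap.sub_apply, LinearMap.id_apply] at h2 h3
    simp [h2, h3]
  rcases hY'.2 (gY ∘ₗ (k ∘ₗ i)) with h | h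
  · exact hgY.1 (exists_section_of_comp_bijective h)
  · rw [← h1] at h
    let w := LinearEquiv.ofBijective _ (bijective_of_comp_bijective hM' h).1
    exact hg.1 ⟨i ∘ₗ w.symm.toLinearMap, LinearMap.ext fun m => w.apply_symm_apply m⟩

end IsSink

end AlmostSplit

section Countably

variable {R : Type u} [CommRing R] {Λ : Type u} [Ring Λ] [Algebra R Λ]

/-- Up to isomorphism, only countably many modules satisfy `P`. -/
def CountablyMany (P : LMod R Λ → Prop) : Prop :=
  ∃ S : Set (LMod R Λ), S.Countable ∧ (∀ M ∈ S, P M) ∧ ∀ M, P M → ∃ M' ∈ S, Nonempty (M ≃ₗ[Λ] M')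

lemma CountablyMany.of_cover {P : LMod R Λ → Prop} {ι : Type*} {T : Set ι} (hT : T.Countable)
    (r : LMod R Λ → ι → Prop) (hr : ∀ M M' i, i ∈ T → P M → P M' → r M i → r M' i →
      Nonempty (M ≃ₗ[Λ] M'))
    (h : ∀ M, P M → ∃ i ∈ T, r M i) : CountablyMany P := by
  classical
  let c : ι → LMod R Λ := fun i => if hi : ∃ M, P M ∧ r M i then hi.choose else .of R Λ PUnit
  have hc : ∀ i, (∃ M, P M ∧ r M i) → P (c i) ∧ r (c i) i := fun i hi => by
    simp only [c, dif_pos hi]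
    exact hi.choose_spec
  refine ⟨c '' (T ∩ {i | ∃ M, P M ∧ r M i}), (hT.mono Set.inter_subset_left).image c, ?_, ?_⟩
  · rintro _ ⟨i, ⟨_, hi⟩, rfl⟩
    exact (hc i hi).1
  · intro M hM
    obtain ⟨i, hi, hri⟩ := h M hM
    obtain ⟨h1, h2⟩ := hc i ⟨M, hM, hri⟩
    exact ⟨c i, ⟨i, ⟨hi, M, hM, hri⟩, rfl⟩, hr M _ i hi hM h1 hri h2⟩

lemma CountablyMany.of_iso_cover {P : LMod R Λ → Prop} {S : Set (LMod R Λ)} (hS : S.Countable)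
    (h : ∀ M, P M → ∃ M' ∈ S, Nonempty (M ≃ₗ[Λ] M')) : CountablyMany P :=
  .of_cover hS (fun M M' => Nonempty (M ≃ₗ[Λ] M'))
    (fun _ _ _ _ _ _ ⟨e⟩ ⟨e'⟩ => ⟨e.trans e'.symm⟩) h

lemma CountablyMany.mono {P Q : LMod R Λ → Prop} (hP : CountablyMany P) (h : ∀ M, Q M → P M) :
    CountablyMany Q := by
  obtain ⟨S, hS, -, hS'⟩ := hP
  exact .of_iso_cover hS fun M hM => hS' M (h M hM)

lemma CountablyMany.biUnion {ι : Type*} {T : Set ι} (hT : T.Countable) {P : ι → LMod R Λ → Prop}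
    (hP : ∀ i ∈ T, CountablyMany (P i)) : CountablyMany fun M => ∃ i ∈ T, P i M := by
  have : ∀ i, ∃ S : Set (LMod R Λ), i ∈ T → S.Countable ∧
      ∀ M, P i M → ∃ M' ∈ S, Nonempty (M ≃ₗ[Λ] M') := fun i => by
    by_cases hi : i ∈ T
    · obtain ⟨S, h1, -, h2⟩ := hP i hi
      exact ⟨S, fun _ => ⟨h1, h2⟩⟩
    · exact ⟨∅, fun h => absurd h hi⟩
  choose S hS using this
  refine .of_iso_cover (hT.biUnion fun i hi => (hS i hi).1) ?_
  rintro M ⟨i, hi, hM⟩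
  obtain ⟨M', h1, h2⟩ := (hS i hi).2 M hM
  exact ⟨M', Set.mem_biUnion hi h1, h2⟩

lemma CountablyMany.or {P Q : LMod R Λ → Prop} (hP : CountablyMany P) (hQ : CountablyMany Q) :
    CountablyMany fun M => P M ∨ Q M := by
  obtain ⟨S, h1, -, h2⟩ := hP
  obtain ⟨S', h1', -, h2'⟩ := hQ
  refine .of_iso_cover (h1.union h1') ?_
  rintro M (hM | hM)
  · obtain ⟨M', h3, h4⟩ := h2 M hM
    exact ⟨M', Or.inl h3, h4⟩
  · obtain ⟨M', h3, h4⟩ := h2' M hM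
    exact ⟨M', Or.inr h3, h4⟩

end Countably

section Reach

variable {R : Type u} [CommRing R] [IsLocalRing R]
  {Λ : Type u} [Ring Λ] [Algebra R Λ] (xs : List R)

/-- `M` is an indecomposable lattice. -/
def IndecLat (M : LMod R Λ) : Prop := IsLat xs Λ M ∧ IsIndecomposable Λ M

variable (R Λ) in
/-- All indecomposable lattices have minimal right almost split maps. -/
def HasSinks : Prop :=
  ∀ M : LMod R Λ, IndecLat xs M → ∃ (E : LMod R Λ) (g : E →ₗ[Λ] M), IsLat xs Λ E ∧
    IsSink xs g ∧ RightMinimal Λ g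

/-- `Y` is a direct summand of the source of a minimal right almost split map onto `M`. -/
def ARArrow (Y M : LMod R Λ) : Prop :=
  ∃ (E : LMod R Λ) (g : E →ₗ[Λ] M) (i : Y →ₗ[Λ] E) (p : E →ₗ[Λ] Y), IsLat xs Λ E ∧ IsSink xs g ∧
    RightMinimal Λ g ∧ p ∘ₗ i = LinearMap.id

/-- The indecomposable lattices reached from those satisfying `P` by chains of at most `k` arrows
ending in non-projective lattices. -/
def Reach (P : LMod R Λ → Prop) : ℕ → LMod R Λ → Prop
  | 0, M => IndecLat xs M ∧ P M
  | k + 1, M => Reach P k M ∨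
      (IndecLat xs M ∧ ¬ Module.Projective Λ M) ∧ ∃ Y, Reach P k Y ∧ ARArrow xs Y M

variable {xs}

lemma Reach.indecLat {P : LMod R Λ → Prop} {k : ℕ} {M : LMod R Λ} (h : Reach xs P k M) :
    IndecLat xs M := by
  induction k with
  | zero => exact h.1
  | succ k ih => exact h.elim ih fun h => h.1.1

lemma Reach.of_le {P : LMod R Λ → Prop} {k l : ℕ} (hkl : k ≤ l) {M : LMod R Λ}
    (h : Reach xs P k M) : Reach xs P l M := by
  induction hkl with
  | refl => exact h
  | step _ ih => exact Or.inl ih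

lemma ARArrow.of_equiv {Y Y' M : LMod R Λ} (h : ARArrow xs Y M) (e : Y ≃ₗ[Λ] Y') :
    ARArrow xs Y' M := by
  obtain ⟨E, g, i, p, h1, h2, h3, h4⟩ := h
  refine ⟨E, g, i ∘ₗ e.symm.toLinearMap, e.toLinearMap ∘ₗ p, h1, h2, h3, LinearMap.ext fun y => ?_⟩
  have := LinearMap.congr_fun h4 (e.symm y)
  simp only [LinearMap.comp_apply, LinearMap.id_apply] at this
  simp [this]

variable [IsNoetherianRing R] [IsAdicComplete (maximalIdeal R) R] [Module.Finite R Λ]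

lemma countablyMany_projective :
    CountablyMany fun M : LMod R Λ => IndecLat xs M ∧ Module.Projective Λ M := by
  have : IsNoetherianRing Λ := IsNoetherianRing.of_finite R Λ
  obtain ⟨l, hl, hs⟩ := hasDecomposition R (Λ := Λ) Λ
  refine .of_iso_cover (S := Summand.obj '' {x | x ∈ l}) (l.finite_toSet.image _).countable ?_
  rintro M ⟨⟨hM, hM'⟩, hP⟩
  have := hM.1
  have hloc := hM'.endLocal R
  obtain ⟨n, q, hq⟩ := Module.Finite.exists_fin' Λ M
  obtain ⟨s, hqs⟩ := Module.projective_lifting_property q LinearMap.id hq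
  obtain ⟨k, -, hk⟩ := hloc.exists_bijective_of_sum (List.finRange n)
    (fun k => (q ∘ₗ LinearMap.single Λ (fun _ => Λ) k) ∘ₗ (LinearMap.proj k ∘ₗ s)) (by
      have : ((List.finRange n).map fun k =>
          (q ∘ₗ LinearMap.single Λ (fun _ => Λ) k) ∘ₗ (LinearMap.proj k ∘ₗ s)).sum =
          (LinearMap.id : M →ₗ[Λ] M) := by
        rw [← List.ofFn_eq_map, List.sum_ofFn, ← hqs]
        refine LinearMap.ext fun m => ?_
        rw [LinearMap.sum_apply, LinearMap.comp_apply, ← sum_apply_single q]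
        rfl
      rw [this]
      exact Function.bijective_id)
  obtain ⟨x, hx, h1, -⟩ := hloc.exists_summand hk hl hs
  exact ⟨x.obj, ⟨x, hx, rfl⟩, ⟨LinearEquiv.ofBijective _ h1⟩⟩

lemma countablyMany_arArrow (hΛ : RingTheory.Sequence.IsWeaklyRegular Λ xs)
    (hsink : HasSinks R Λ xs) {Y : LMod R Λ} (hY : IndecLat xs Y) :
    CountablyMany fun M : LMod R Λ =>
      (IndecLat xs M ∧ ¬ Module.Projective Λ M) ∧ ARArrow xs Y M := by
  have : IsNoetherianRing Λ := IsNoetherianRing.of_finite R Λ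
  obtain ⟨F, gY, hF, hgY, -⟩ := hsink Y hY
  have := hF.1
  have := hY.1.1
  have hYl := hY.2.endLocal R
  obtain ⟨l, hl, hs⟩ := hasDecomposition R (Λ := Λ) F
  refine .of_cover (T := {x | x ∈ l}) l.finite_toSet.countable (fun M x =>
    ∃ (E : LMod R Λ) (g : E →ₗ[Λ] M), IsLat xs Λ E ∧ IsSink xs g ∧ RightMinimal Λ g ∧
      Nonempty (LinearMap.ker g ≃ₗ[Λ] x.obj)) ?_ ?_
  · rintro M M' x - ⟨⟨⟨hM, hM1⟩, hM2⟩, -⟩ ⟨⟨⟨hM', hM1'⟩, hM2'⟩, -⟩ ⟨E, g, hE, hg, hgm, ⟨e⟩⟩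
      ⟨E', g', hE', hg', hgm', ⟨e'⟩⟩
    have := hM.1
    exact hg.nonempty_equiv_of_ker hgm (hg.surjective hΛ hM hM2) hE hM (hM1.endLocal R) hg' hgm'
      (hg'.surjective hΛ hM' hM2') hE' hM' hM1' (e.trans e'.symm)
  · rintro M ⟨⟨⟨hM, hM1⟩, hM2⟩, E, g, i, p, hE, hg, hgm, hpi⟩
    have hsurj := hg.surjective hΛ hM hM2
    obtain ⟨h, r, hrh⟩ := hg.exists_ker_summand hgm hsurj hE hM hM1 hgY hF hYl i p hpi
    have := (hE.ker hM g hsurj).1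
    obtain ⟨x, hx, h1, -⟩ := ((hg.isIndecomposable_ker hgm hsurj hE hM).endLocal R).exists_summand
      (i := h) (p := r) (by rw [hrh]; exact Function.bijective_id) hl hs
    exact ⟨x, hx, E, g, hE, hg, hgm, ⟨LinearEquiv.ofBijective _ h1⟩⟩

lemma CountablyMany.reach (hΛ : RingTheory.Sequence.IsWeaklyRegular Λ xs)
    (hsink : HasSinks R Λ xs) {P : LMod R Λ → Prop}
    (hP : CountablyMany fun M => IndecLat xs M ∧ P M) (k : ℕ) : CountablyMany (Reach xs P k) := by
  induction k with
  | zero => exact hP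
  | succ k ih =>
    refine ih.or ?_
    obtain ⟨S, hS, hS1, hS2⟩ := ih
    refine (CountablyMany.biUnion hS fun Y hY =>
      countablyMany_arArrow hΛ hsink (hS1 Y hY).indecLat).mono ?_
    rintro M ⟨hM, Y, hY, hYM⟩
    obtain ⟨Y', hY', ⟨e⟩⟩ := hS2 Y hY
    exact ⟨Y', hY', hM, hYM.of_equiv e⟩

end Reach

section HaradaSai

variable {R : Type u} [CommRing R] {Λ : Type u} [Ring Λ] [Algebra R Λ]

/-- `h` is a map between modules satisfying `P`, preceded by `k` non-isomorphisms between such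
modules. -/
def RadChain (P : LMod R Λ → Prop) : ℕ → ∀ {A B : LMod R Λ}, (A →ₗ[Λ] B) → Prop
  | 0, A, B, _ => P A ∧ P B
  | k + 1, A, B, h => P A ∧ ∃ (C : LMod R Λ) (f : A →ₗ[Λ] C) (g : C →ₗ[Λ] B),
      ¬ Function.Bijective f ∧ RadChain P k g ∧ h = g ∘ₗ f

lemma RadChain.left {P : LMod R Λ → Prop} {k : ℕ} {A B : LMod R Λ} {h : A →ₗ[Λ] B}
    (H : RadChain P k h) : P A := by
  cases k <;> exact H.1

lemma RadChain.right {P : LMod R Λ → Prop} {k : ℕ} {A B : LMod R Λ} {h : A →ₗ[Λ] B}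
    (H : RadChain P k h) : P B := by
  induction k generalizing A with
  | zero => exact H.2
  | succ k ih =>
    obtain ⟨_, C, f, g, -, hg, -⟩ := H
    exact ih hg

lemma RadChain.split {P : LMod R Λ → Prop} {a b : ℕ} {A D : LMod R Λ} {h : A →ₗ[Λ] D}
    (H : RadChain P (b + 1 + a) h) : ∃ (B C : LMod R Λ) (f : A →ₗ[Λ] B) (φ : B →ₗ[Λ] C)
      (g : C →ₗ[Λ] D), RadChain P a f ∧ ¬ Function.Bijective φ ∧ RadChain P b g ∧
      h = g ∘ₗ φ ∘ₗ f := by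
  induction a generalizing A with
  | zero =>
    obtain ⟨hA, C, f, g, hf, hg, rfl⟩ := H
    exact ⟨A, C, LinearMap.id, f, g, ⟨hA, hA⟩, hf, hg, rfl⟩
  | succ a ih =>
    obtain ⟨hA, A', r, h', hr, hh', rfl⟩ := H
    obtain ⟨B, C, f, φ, g, hf, hφ, hg, rfl⟩ := ih hh'
    exact ⟨B, C, f ∘ₗ r, φ, g, ⟨hA, A', r, f, hr, hf, rfl⟩, hφ, hg, rfl⟩

lemma isCompl_range_ker {A B D : Type u} [AddCommGroup A] [Module Λ A] [AddCommGroup B]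
    [Module Λ B] [AddCommGroup D] [Module Λ D] (f : A →ₗ[Λ] B) (g : B →ₗ[Λ] D)
    (h₁ : LinearMap.ker (g ∘ₗ f) ≤ LinearMap.ker f)
    (h₂ : LinearMap.range g ≤ LinearMap.range (g ∘ₗ f)) :
    IsCompl (LinearMap.range f) (LinearMap.ker g) := by
  constructor
  · rw [Submodule.disjoint_def]
    rintro _ ⟨a, rfl⟩ ha
    exact h₁ (x := a) ha
  · rw [codisjoint_iff, eq_top_iff]
    intro b _
    obtain ⟨a, ha⟩ := h₂ ⟨b, rfl⟩
    rw [← sub_add_cancel b (f a), add_comm]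
    refine Submodule.add_mem_sup ⟨a, rfl⟩ ?_
    rw [LinearMap.mem_ker, map_sub, ← ha]
    exact sub_self _

lemma ker_comp_le_of_length_le {A B D : Type u} [AddCommGroup A] [Module Λ A] [AddCommGroup B]
    [Module Λ B] [AddCommGroup D] [Module Λ D] (f : A →ₗ[Λ] B) (g : B →ₗ[Λ] D)
    (hB : IsFiniteLength Λ B)
    (h : Module.length Λ (LinearMap.range f) ≤ Module.length Λ (LinearMap.range (g ∘ₗ f))) :
    LinearMap.ker (g ∘ₗ f) ≤ LinearMap.ker f := by
  let θ : LinearMap.range f →ₗ[Λ] LinearMap.range (g ∘ₗ f) :=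
    g.restrict (by rintro _ ⟨a, rfl⟩; exact ⟨a, rfl⟩)
  have hθ : Function.Surjective θ := by
    rintro ⟨_, a, rfl⟩
    exact ⟨⟨f a, a, rfl⟩, rfl⟩
  have h1 := Module.length_eq_add_of_exact (LinearMap.ker θ).subtype θ
    (Submodule.subtype_injective _) hθ (LinearMap.exact_subtype_ker_map θ)
  have hfin : Module.length Λ (LinearMap.range f) ≠ ⊤ := ne_top_of_le_ne_top
    (Module.length_ne_top_iff.2 hB)
    (Module.length_le_of_injective (LinearMap.range f).subtype (Submodule.subtype_injective _))
  have h2 : Module.length Λ (LinearMap.ker θ) = 0 := by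
    have hfin' : Module.length Λ (LinearMap.range (g ∘ₗ f)) ≠ ⊤ :=
      ne_top_of_le_ne_top hfin (h1 ▸ le_add_self)
    rw [h1] at h
    have h3 : Module.length Λ (LinearMap.ker θ) + Module.length Λ (LinearMap.range (g ∘ₗ f)) ≤
      0 + Module.length Λ (LinearMap.range (g ∘ₗ f)) := by rwa [zero_add]
    exact nonpos_iff_eq_zero.1 ((ENat.add_le_add_iff_right hfin').1 h3)
  rw [Module.length_eq_zero_iff] at h2
  intro a ha
  have h3 : (⟨f a, a, rfl⟩ : LinearMap.range f) ∈ LinearMap.ker θ := Subtype.ext ha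
  have h4 : (⟨_, h3⟩ : LinearMap.ker θ) = 0 := Subsingleton.elim _ _
  exact congrArg (fun x => x.1.1) h4

lemma eq_of_le_of_length_le {D : Type u} [AddCommGroup D] [Module Λ D] (hD : IsFiniteLength Λ D)
    {K K' : Submodule Λ D} (hK : K ≤ K') (h : Module.length Λ K' ≤ Module.length Λ K) :
    K = K' := by
  obtain ⟨_, _⟩ := isFiniteLength_iff_isNoetherian_isArtinian.1 hD
  by_contra hne
  have := Submodule.height_strictMono (lt_of_le_of_ne hK hne)
  rw [Module.length_submodule, Module.length_submodule] at h
  exact absurd this (not_lt.2 h)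

/-- The lemma of Harada and Sai. -/
lemma RadChain.length_range {P : LMod R Λ → Prop} {L : ℕ}
    (hP : ∀ M : LMod R Λ, P M → IsIndecomposable Λ M ∧ Module.length Λ M ≤ L) (b : ℕ)
    {A B : LMod R Λ} {h : A →ₗ[Λ] B} (H : RadChain P (2 ^ b - 1) h) :
    h = 0 ∨ Module.length Λ (LinearMap.range h) + b ≤ L := by
  induction b generalizing A B with
  | zero =>
    right
    simpa using (Module.length_le_of_injective (LinearMap.range h).subtype
      (Submodule.subtype_injective _)).trans (hP B H.right).2
  | succ b ih =>
    have he : 2 ^ (b + 1) - 1 = (2 ^ b - 1) + 1 + (2 ^ b - 1) := by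
      have := Nat.one_le_two_pow (n := b)
      omega
    rw [he] at H
    obtain ⟨C, D, f, φ, g, hf, hφ, hg, rfl⟩ := H.split
    by_contra! hcon
    obtain ⟨hne, hlt⟩ := hcon
    have hfin : ∀ {X : LMod R Λ}, P X → IsFiniteLength Λ X := fun {X} hX =>
      Module.length_ne_top_iff.1 (ne_top_of_le_ne_top (ENat.natCast_ne_top L) (hP X hX).2)
    have hle : (L : ℕ∞) ≤ Module.length Λ (LinearMap.range (g ∘ₗ φ ∘ₗ f)) + b := by
      rw [Nat.cast_succ, ← add_assoc] at hlt
      exact Order.le_of_lt_add_one hlt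
    have hf' := (ih hf).resolve_left fun h => hne (by simp [h])
    have hg' := (ih hg).resolve_left fun h => hne (by simp [h])
    have cancel : ∀ {x y : ℕ∞}, x + b ≤ L → (L : ℕ∞) ≤ y + b → x ≤ y := fun h h' =>
      (ENat.add_le_add_iff_right (ENat.natCast_ne_top b)).1 (h.trans h')
    have h₁ := cancel hf' hle
    have h₂ := cancel hg' hle
    have hk := ker_comp_le_of_length_le f (g ∘ₗ φ) (hfin hf.right) h₁
    have hr : LinearMap.range g ≤ LinearMap.range (g ∘ₗ φ ∘ₗ f) :=
      (eq_of_le_of_length_le (hfin hg.right) (LinearMap.range_comp_le_range _ _) h₂).ge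
    have hc₁ := isCompl_range_ker f (g ∘ₗ φ) hk ((LinearMap.range_comp_le_range _ _).trans hr)
    have hc₂ := isCompl_range_ker (φ ∘ₗ f) g
      ((show LinearMap.ker (g ∘ₗ φ ∘ₗ f) ≤ LinearMap.ker f from hk).trans
        (LinearMap.ker_le_ker_comp f φ)) hr
    have hf0 : f ≠ 0 := fun h => hne (by simp [h])
    have hφf0 : φ ∘ₗ f ≠ 0 := fun h => hne (by simp [h])
    have h3 := ((hP C hf.right).1.2 _ _ hc₁).resolve_left fun h => hf0 (LinearMap.range_eq_bot.1 h)
    have h4 := ((hP D hg.left).1.2 _ _ hc₂).resolve_left fun h =>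
      hφf0 (LinearMap.range_eq_bot.1 h)
    refine hφ ⟨Function.Injective.of_comp (f := g) (LinearMap.ker_eq_bot.1 h3), fun c => ?_⟩
    have h5 := hc₂.sup_eq_top
    rw [h4, sup_bot_eq] at h5
    obtain ⟨a, ha⟩ := LinearMap.range_eq_top.1 h5 c
    exact ⟨f a, ha⟩

lemma RadChain.eq_zero {P : LMod R Λ → Prop} {L : ℕ}
    (hP : ∀ M : LMod R Λ, P M → IsIndecomposable Λ M ∧ Module.length Λ M ≤ L)
    {A B : LMod R Λ} {h : A →ₗ[Λ] B} (H : RadChain P (2 ^ L - 1) h) : h = 0 := by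
  refine (H.length_range hP L).elim id fun hle => ?_
  have h1 : Module.length Λ (LinearMap.range h) + L ≤ 0 + L := by rwa [zero_add]
  have h2 := nonpos_iff_eq_zero.1
    ((ENat.add_le_add_iff_right (ENat.natCast_ne_top L)).1 h1)
  rw [Module.length_eq_zero_iff] at h2
  exact LinearMap.range_eq_bot.1 (Submodule.subsingleton_iff_eq_bot.1 h2)

end HaradaSai

section

open RingTheory.Sequence Pointwise

section Reduction

variable {R : Type u} [CommRing R] [IsLocalRing R] [IsNoetherianRing R]
  {Λ : Type u} [Ring Λ] [Algebra R Λ] [Module.Finite R Λ]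
  {M : Type u} [AddCommGroup M] [Module Λ M] [Module R M] [IsScalarTower R Λ M]
  {N : Type u} [AddCommGroup N] [Module Λ N] [Module R N] [IsScalarTower R Λ N]

omit [IsNoetherianRing R] [Module R M] [IsScalarTower R Λ M] in
lemma surjective_of_sub_mem_smulTop [Module.Finite Λ N] {J : Ideal R} (hJ : J ≤ maximalIdeal R)
    (f : M →ₗ[Λ] N) (h : ∀ n, ∃ m, n - f m ∈ smulTop Λ N J) : Function.Surjective f := by
  have : Module.Finite R N := Module.Finite.trans Λ N
  have key : (⊤ : Submodule R N) ≤ (LinearMap.range f).restrictScalars R := by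
    refine Submodule.le_of_le_smul_of_le_jacobson_bot (I := J) Module.Finite.fg_top
      (hJ.trans (maximalIdeal_le_jacobson ⊥)) fun n _ => ?_
    obtain ⟨m, hm⟩ := h n
    rw [← add_sub_cancel (f m) n]
    exact Submodule.add_mem_sup ⟨m, rfl⟩ hm
  exact fun n => key (x := n) trivial

/-- The map induced by `f` modulo `J`. -/
def redMap (J : Ideal R) (f : M →ₗ[Λ] N) : (M ⧸ smulTop Λ M J) →ₗ[Λ] N ⧸ smulTop Λ N J :=
  (smulTop Λ M J).mapQ (smulTop Λ N J) f fun _ => map_mem_smulTop f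

variable {xs : List R} (hxs : ∀ x ∈ xs, x ∈ maximalIdeal R)

/-- The `e`-th powers of a sequence generate this ideal. -/
def powIdeal (xs : List R) (e : ℕ) : Ideal R := Ideal.ofList (xs.map (· ^ e))

include hxs in
omit [IsNoetherianRing R] in
lemma powIdeal_le {e : ℕ} (he : e ≠ 0) : powIdeal xs e ≤ maximalIdeal R := by
  refine Ideal.span_le.2 fun y hy => ?_
  obtain ⟨x, hx, rfl⟩ := List.mem_map.1 hy
  exact Ideal.pow_mem_of_mem _ (hxs x hx) _ (Nat.pos_of_ne_zero he)

omit [IsLocalRing R] [IsNoetherianRing R] in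
lemma powIdeal_anti {e e' : ℕ} (h : e ≤ e') : powIdeal xs e' ≤ powIdeal xs e := by
  refine Ideal.span_le.2 fun y hy => ?_
  obtain ⟨x, hx, rfl⟩ := List.mem_map.1 hy
  exact Ideal.mem_of_dvd _ (pow_dvd_pow x h) (Ideal.subset_span (List.mem_map.2 ⟨x, hx, rfl⟩))

include hxs in
omit [IsNoetherianRing R] [Module.Finite R Λ] in
lemma exists_lift_red {n : ℕ} (hb : maximalIdeal R ^ n ≤ stabIdeal R Λ M) (hN : IsLat xs Λ N)
    (φ : (M ⧸ smulTop Λ M (powIdeal xs ((n + 1) * 2))) →ₗ[Λ]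
      N ⧸ smulTop Λ N (powIdeal xs ((n + 1) * 2))) :
    ∃ f : M →ₗ[Λ] N, ∀ m b, φ (Submodule.Quotient.mk m) = Submodule.Quotient.mk b →
      b - f m ∈ smulTop Λ N (powIdeal xs (n + 1)) := by
  have hmap : (xs.map (· ^ (n + 1))).map (· ^ 2) = xs.map (· ^ ((n + 1) * 2)) := by
    simp [Function.comp_def, pow_mul]
  obtain ⟨f, hf⟩ := exists_lift_mod_list (M := M) (N := N) (Λ := Λ) (xs.map (· ^ (n + 1)))
    (by
      intro y hy
      obtain ⟨x, hx, rfl⟩ := List.mem_map.1 hy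
      exact hb (Ideal.pow_le_pow_right n.le_succ (Ideal.pow_mem_pow (hxs x hx) _)))
    (hmap ▸ isWeaklyRegular_pow hN.2.1 _) (Submodule.mkQ_surjective _)
    ((Submodule.ker_mkQ (smulTop Λ N (powIdeal xs ((n + 1) * 2)))).trans (by
      rw [hmap]; rfl)) (φ ∘ₗ Submodule.mkQ _)
  refine ⟨f, fun m b hmb => ?_⟩
  have h1 := hf m
  rw [LinearMap.comp_apply, Submodule.mkQ_apply, hmb, Submodule.mkQ_apply,
    ← Submodule.Quotient.mk_sub] at h1
  obtain ⟨x, hx, hx'⟩ := exists_preimage_mem_smulTop (Submodule.mkQ_surjective _) h1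
  have h2 := (Submodule.Quotient.eq _).1 hx'.symm
  have h3 : smulTop Λ N (powIdeal xs ((n + 1) * 2)) ≤ smulTop Λ N (powIdeal xs (n + 1)) :=
    smulTop_le fun s hs x => smul_mem_smulTop (powIdeal_anti (by lia) hs) x
  have := add_mem (h3 h2) hx
  simpa using this

include hxs in
omit [IsNoetherianRing R] in
lemma nontrivial_red [Module.Finite Λ M] [Nontrivial M] {e : ℕ} (he : e ≠ 0) :
    Nontrivial (M ⧸ smulTop Λ M (powIdeal xs e)) := by
  by_contra h
  rw [not_nontrivial_iff_subsingleton, Submodule.Quotient.subsingleton_iff] at h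
  have := surjective_of_sub_mem_smulTop (powIdeal_le hxs he) (0 : M →ₗ[Λ] M)
    (fun m => ⟨0, h ▸ trivial⟩)
  obtain ⟨m, hm⟩ := exists_ne (0 : M)
  obtain ⟨a, ha⟩ := this m
  exact hm ha.symm

include hxs in
lemma endLocal_red {n : ℕ} (hb : maximalIdeal R ^ n ≤ stabIdeal R Λ M) (hM : IsLat xs Λ M)
    (hM' : EndLocal Λ M) :
    EndLocal Λ (M ⧸ smulTop Λ M (powIdeal xs ((n + 1) * 2))) := by
  have := hM.1
  have := hM'.1
  have : IsNoetherianRing Λ := IsNoetherianRing.of_finite R Λ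
  have key : ∀ (u : Module.End Λ (M ⧸ smulTop Λ M (powIdeal xs ((n + 1) * 2)))) (f : M →ₗ[Λ] M),
      (∀ m b, u (Submodule.Quotient.mk m) = Submodule.Quotient.mk b →
      b - f m ∈ smulTop Λ M (powIdeal xs (n + 1))) → Function.Bijective f →
      Function.Bijective u := fun u f huf hf => by
    refine OrzechProperty.bijective_of_surjective_endomorphism u
      (surjective_of_sub_mem_smulTop (powIdeal_le hxs n.succ_ne_zero) u fun c => ?_)
    obtain ⟨m, rfl⟩ := Submodule.Quotient.mk_surjective _ c
    obtain ⟨a, rfl⟩ := hf.2 m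
    refine ⟨Submodule.Quotient.mk a, ?_⟩
    obtain ⟨b, hb⟩ := Submodule.Quotient.mk_surjective _ (u (Submodule.Quotient.mk a))
    rw [← hb, ← Submodule.Quotient.mk_sub, ← neg_sub, Submodule.Quotient.mk_neg]
    exact neg_mem (map_mem_smulTop (Submodule.mkQ _) (huf a b hb.symm))
  refine ⟨nontrivial_red hxs (by lia), fun u => ?_⟩
  obtain ⟨f, hf⟩ := exists_lift_red hxs hb hM u
  refine (hM'.2 f).imp (key u f hf) (key (1 - u) (1 - f) fun m b hmb => ?_)
  obtain ⟨b', hb'⟩ := Submodule.Quotient.mk_surjective _ (u (Submodule.Quotient.mk m))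
  have h1 := hf m b' hb'.symm
  rw [LinearMap.sub_apply, ← hb', Module.End.one_apply, ← Submodule.Quotient.mk_sub] at hmb
  have h2 := (Submodule.Quotient.eq _).1 hmb
  have h3 : smulTop Λ M (powIdeal xs ((n + 1) * 2)) ≤ smulTop Λ M (powIdeal xs (n + 1)) :=
    smulTop_le fun s hs x => smul_mem_smulTop (powIdeal_anti (by lia) hs) x
  have := neg_mem (add_mem (h3 h2) h1)
  convert this using 1
  simp only [LinearMap.sub_apply, Module.End.one_apply]
  abel

include hxs in
lemma bijective_of_bijective_redMap {n : ℕ} (hb : maximalIdeal R ^ n ≤ stabIdeal R Λ N)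
    (hM : IsLat xs Λ M) (hN : IsLat xs Λ N) (hM' : IsIndecomposable Λ M)
    [Nontrivial N] {f : M →ₗ[Λ] N}
    (h : Function.Bijective (redMap (powIdeal xs ((n + 1) * 2)) f)) : Function.Bijective f := by
  have := hN.1
  have : IsNoetherianRing Λ := IsNoetherianRing.of_finite R Λ
  let e := LinearEquiv.ofBijective _ h
  obtain ⟨g, hg⟩ := exists_lift_red hxs hb hM e.symm.toLinearMap
  have hs : Function.Surjective (f ∘ₗ g) := by
    refine surjective_of_sub_mem_smulTop (powIdeal_le hxs n.succ_ne_zero) _ fun m => ⟨m, ?_⟩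
    obtain ⟨b, hb⟩ := Submodule.Quotient.mk_surjective _ (e.symm (Submodule.Quotient.mk m))
    have h1 := map_mem_smulTop f (hg m b hb.symm)
    have h2 := congrArg e hb
    rw [LinearEquiv.apply_symm_apply] at h2
    have h3 := (Submodule.Quotient.eq _).1 (h2.symm.trans
      (Submodule.mapQ_apply _ _ f (h := fun _ => map_mem_smulTop f) b))
    have h4 : smulTop Λ N (powIdeal xs ((n + 1) * 2)) ≤ smulTop Λ N (powIdeal xs (n + 1)) :=
      smulTop_le fun s hs x => smul_mem_smulTop (powIdeal_anti (by lia) hs) x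
    have := add_mem (h4 h3) h1
    simpa using this
  exact (bijective_of_comp_bijective hM'
    (OrzechProperty.bijective_of_surjective_endomorphism _ hs)).2

end Reduction

end

section Bounded

variable {R : Type u} [CommRing R] [IsLocalRing R] [IsNoetherianRing R]
  {Λ : Type u} [Ring Λ] [Algebra R Λ] [Module.Finite R Λ] {xs : List R}

/-- The stable endomorphisms of `M` are killed by the `n`-th power of the maximal ideal, and `M` is
generated by `n` elements. -/
def Bounded (n : ℕ) (M : LMod R Λ) : Prop :=
  maximalIdeal R ^ n ≤ stabIdeal R Λ M ∧ ∃ q : (Fin n → Λ) →ₗ[Λ] M, Function.Surjective q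

/-- The reduction of `M` modulo `J`. -/
def LMod.red (J : Ideal R) (M : LMod R Λ) : LMod R Λ := .of R Λ (M ⧸ smulTop Λ M J)

lemma exists_length_red_le (hxs : ∀ x ∈ xs, x ∈ maximalIdeal R)
    (hlen : (xs.length : WithBot ℕ∞) = ringKrullDim R)
    (hΛ : RingTheory.Sequence.IsWeaklyRegular Λ xs) (n : ℕ) {e : ℕ} (he : e ≠ 0) :
    ∃ L : ℕ, ∀ M : LMod R Λ, Bounded n M → Module.length Λ (M.red (powIdeal xs e)) ≤ L := by
  obtain ⟨k, hk⟩ := exists_pow_algebraMap_mem_smulTop (Λ := Λ) (zs := xs.map (· ^ e))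
    (fun y hy => powIdeal_le hxs he (Ideal.subset_span hy)) (isWeaklyRegular_pow hΛ e) (by simpa)
  let C := (Fin n → Λ) ⧸ smulTop Λ (Fin n → Λ) (powIdeal xs e)
  have : Module.Finite R C := Module.Finite.trans Λ C
  have hC : IsFiniteLength Λ C := by
    refine isFiniteLength_of_pow_smul (R := R) k fun s hs c => ?_
    obtain ⟨c, rfl⟩ := Submodule.Quotient.mk_surjective _ c
    rw [← Submodule.Quotient.mk_smul]
    exact (Submodule.Quotient.mk_eq_zero _).2 (smul_mem_of_one_mem (hk s hs) c)
  refine ⟨(Module.length Λ C).toNat, fun M hM => ?_⟩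
  obtain ⟨q, hq⟩ := hM.2
  rw [ENat.natCast_toNat (Module.length_ne_top_iff.2 hC)]
  refine Module.length_le_of_surjective (redMap (powIdeal xs e) q) fun c => ?_
  obtain ⟨m, rfl⟩ := Submodule.Quotient.mk_surjective _ c
  obtain ⟨a, rfl⟩ := hq m
  exact ⟨Submodule.Quotient.mk a, rfl⟩

variable [IsAdicComplete (maximalIdeal R) R]

/-- If `M` cannot be reached in few steps, then there is a long chain of non-isomorphisms between
bounded lattices ending at `M` with non-zero composition modulo the powers. -/
lemma exists_radChain (hxs : ∀ x ∈ xs, x ∈ maximalIdeal R)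
    (hΛ : RingTheory.Sequence.IsWeaklyRegular Λ xs) (hsink : HasSinks R Λ xs) {n L : ℕ}
    (hL : ∀ M : LMod R Λ, Bounded n M →
      Module.length Λ (M.red (powIdeal xs ((n + 1) * 2))) ≤ L)
    {M : LMod R Λ} (hM : IndecLat xs M) (k j : ℕ)
    (hk : ¬ Reach xs (fun M => ¬ Bounded n M ∨ Module.Projective Λ M) (j + k) M) :
    ∃ (Z : LMod R Λ) (c : Λ →ₗ[Λ] Z) (h : Z →ₗ[Λ] M), IndecLat xs Z ∧
      ¬ Reach xs (fun M => ¬ Bounded n M ∨ Module.Projective Λ M) j Z ∧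
      h (c 1) ∉ smulTop Λ M (powIdeal xs ((n + 1) * 2)) ∧
      RadChain (A := Z.red _) (B := M.red _)
        (fun X : LMod R Λ => IsIndecomposable Λ X ∧ Module.length Λ X ≤ L) k
        (redMap (powIdeal xs ((n + 1) * 2)) h) := by
  have : IsNoetherianRing Λ := IsNoetherianRing.of_finite R Λ
  have hb : ∀ Z : LMod R Λ, IndecLat xs Z → ∀ i,
      ¬ Reach xs (fun M => ¬ Bounded n M ∨ Module.Projective Λ M) i Z →
      Bounded n Z ∧ ¬ Module.Projective Λ Z := fun Z hZ i hi => by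
    by_contra h
    exact hi (Reach.of_le i.zero_le ⟨hZ, by tauto⟩)
  have hP : ∀ Z : LMod R Λ, IndecLat xs Z → Bounded n Z →
      IsIndecomposable Λ (Z.red (powIdeal xs ((n + 1) * 2))) ∧
      Module.length Λ (Z.red (powIdeal xs ((n + 1) * 2))) ≤ L := fun Z hZ hZ' => by
    have := hZ.1.1
    exact ⟨(endLocal_red hxs hZ'.1 hZ.1 (hZ.2.endLocal R)).isIndecomposable, hL Z hZ'⟩
  induction k generalizing j with
  | zero =>
    have hb' := (hb M hM _ hk).1
    have : Module.Finite Λ M := hM.1.1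
    have := hM.2.1
    have hnt := nontrivial_red (Λ := Λ) (M := M) hxs (e := (n + 1) * 2) (by lia)
    obtain ⟨x, hx⟩ := exists_ne (0 : M ⧸ smulTop Λ M (powIdeal xs ((n + 1) * 2)))
    obtain ⟨m, rfl⟩ := Submodule.Quotient.mk_surjective _ x
    refine ⟨M, LinearMap.toSpanSingleton Λ M m, LinearMap.id, hM, hk, fun h => hx ?_,
      hP M hM hb', hP M hM hb'⟩
    rw [Submodule.Quotient.mk_eq_zero]
    simpa using h
  | succ k ih =>
    obtain ⟨Z, c, h, hZ, hZ', hc, hch⟩ := ih (j + 1) (by rwa [add_assoc, add_comm 1])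
    obtain ⟨hZb, hZp⟩ := hb Z hZ _ hZ'
    have := hZ.1.1
    have := hZ.2.1
    obtain ⟨E, g, hE, hg, hmin⟩ := hsink Z hZ
    have hgs := hg.surjective hΛ hZ.1 hZp
    obtain ⟨c', hc'⟩ := Module.projective_lifting_property g c hgs
    have := hE.1
    obtain ⟨l, hl, hs⟩ := hasDecomposition R (Λ := Λ) E
    obtain ⟨x, hx, hxc⟩ : ∃ x ∈ l,
        h (g (x.inc (x.proj (c' 1)))) ∉ smulTop Λ M (powIdeal xs ((n + 1) * 2)) := by
      by_contra! hcon
      apply hc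
      have h1 : c 1 = g ((l.map Summand.idem).sum (c' 1)) := by
        rw [hs]; exact (LinearMap.congr_fun hc' 1).symm
      have h2 : ∀ l' : List (Summand R Λ E), (∀ x ∈ l', x ∈ l) →
          h (g ((l'.map Summand.idem).sum (c' 1))) ∈
            smulTop Λ M (powIdeal xs ((n + 1) * 2)) := fun l' hl' => by
        induction l' with
        | nil => simp
        | cons a l' ih' =>
          rw [List.map_cons, List.sum_cons, LinearMap.add_apply, map_add, map_add]
          exact add_mem (hcon a (hl' a List.mem_cons_self))
            (ih' fun x hx => hl' x (List.mem_cons_of_mem _ hx))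
      rw [h1]
      exact h2 l fun x hx => hx
    have hX : IndecLat xs x.obj := ⟨hE.retract x.inc x.proj x.proj_inc, hl x hx⟩
    have hXr : ¬ Reach xs (fun M => ¬ Bounded n M ∨ Module.Projective Λ M) j x.obj := fun hr =>
      hZ' (Or.inr ⟨⟨hZ, hZp⟩, x.obj, hr, E, g, x.inc, x.proj, hE, hg, hmin, x.proj_inc⟩)
    refine ⟨x.obj, x.proj ∘ₗ c', h ∘ₗ g ∘ₗ x.inc, hX, hXr, hxc, hP _ hX (hb _ hX _ hXr).1,
      Z.red _, redMap _ (g ∘ₗ x.inc), redMap _ h, fun hbij => ?_, hch, ?_⟩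
    · have h1 := bijective_of_bijective_redMap hxs hZb.1 hX.1 hZ.1 hX.2 hbij
      let e := LinearEquiv.ofBijective _ h1
      exact hg.1 ⟨x.inc ∘ₗ e.symm.toLinearMap, LinearMap.ext fun z => e.apply_symm_apply z⟩
    · refine LinearMap.ext fun y => ?_
      obtain ⟨y, rfl⟩ := Submodule.Quotient.mk_surjective _ y
      rfl

theorem exists_reach (hxs : ∀ x ∈ xs, x ∈ maximalIdeal R)
    (hlen : (xs.length : WithBot ℕ∞) = ringKrullDim R)
    (hΛ : RingTheory.Sequence.IsWeaklyRegular Λ xs) (hsink : HasSinks R Λ xs) (n : ℕ) :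
    ∃ N, ∀ M : LMod R Λ, IndecLat xs M →
      Reach xs (fun M => ¬ Bounded n M ∨ Module.Projective Λ M) N M := by
  obtain ⟨L, hL⟩ := exists_length_red_le hxs hlen hΛ n (e := (n + 1) * 2) (by lia)
  refine ⟨2 ^ L - 1, fun M hM => ?_⟩
  by_contra hcon
  obtain ⟨Z, c, h, -, -, hc, hch⟩ := exists_radChain hxs hΛ hsink hL hM (2 ^ L - 1) 0
    (by rwa [zero_add])
  have h0 := LinearMap.congr_fun (hch.eq_zero fun _ h => h) (Submodule.Quotient.mk (c 1))
  exact hc ((Submodule.Quotient.mk_eq_zero _).1 h0)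

end Bounded

section LengthBounds

lemma smul_eq_zero_of_length_le {R : Type u} [CommRing R] [IsLocalRing R] (n : ℕ) {X : Type u}
    [AddCommGroup X] [Module R X] (h : Module.length R X ≤ n) :
    ∀ s ∈ maximalIdeal R ^ n, ∀ x : X, s • x = 0 := by
  suffices H : maximalIdeal R ^ n • (⊤ : Submodule R X) = ⊥ from fun s hs x =>
    (Submodule.mem_bot R).1 (H ▸ Submodule.smul_mem_smul hs trivial)
  have hfl := Module.length_ne_top_iff.1 (ne_top_of_le_ne_top (ENat.natCast_ne_top n) h)
  obtain ⟨_, _⟩ := isFiniteLength_iff_isNoetherian_isArtinian.1 hfl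
  have key : ∀ (n : ℕ) (K : Submodule R X), Module.length R K ≤ n →
      maximalIdeal R ^ n • K = ⊥ := fun n => by
    induction n with
    | zero =>
      intro K hK
      rw [Nat.cast_zero, nonpos_iff_eq_zero, Module.length_eq_zero_iff,
        Submodule.subsingleton_iff_eq_bot] at hK
      rw [hK, Submodule.smul_bot]
    | succ n ih =>
      intro K hK
      rcases eq_or_ne K ⊥ with rfl | hne
      · exact Submodule.smul_bot _
      rw [pow_succ, Submodule.mul_smul]
      refine ih _ ?_
      have hlt : maximalIdeal R • K < K := lt_of_le_of_ne Submodule.smul_le_right fun he =>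
        hne (Submodule.eq_bot_of_le_smul_of_le_jacobson_bot (maximalIdeal R) K
          (IsNoetherian.noetherian K) he.ge (maximalIdeal_le_jacobson ⊥))
      have h1 := Submodule.height_strictMono hlt
      rw [← Module.length_submodule, ← Module.length_submodule] at h1
      exact Order.lt_add_one_iff_of_not_isMax (by simp) |>.1 (h1.trans_le hK)
  exact key n ⊤ (by rwa [Module.length_top])

lemma exists_generators {R : Type u} [CommRing R] {X : Type u} [AddCommGroup X] [Module R X]
    [IsNoetherian R X] [IsArtinian R X] {Λ : Type u} [Ring Λ] {M : Type u} [AddCommGroup M]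
    [Module Λ M] (D : Submodule Λ M → Submodule R X)
    (hD : ∀ K, K ≠ ⊤ → ∃ v, D (K ⊔ Submodule.span Λ {v}) < D K) (n : ℕ) (K : Submodule Λ M)
    (hK : Module.length R (D K) ≤ n) :
    ∃ v : Fin n → M, K ⊔ Submodule.span Λ (Set.range v) = ⊤ := by
  induction n generalizing K with
  | zero =>
    refine ⟨0, ?_⟩
    by_contra hne
    obtain ⟨v, hv⟩ := hD K fun h => hne (by rw [h, top_sup_eq])
    rw [Nat.cast_zero, nonpos_iff_eq_zero, Module.length_eq_zero_iff,
      Submodule.subsingleton_iff_eq_bot] at hK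
    exact not_lt_bot (hK ▸ hv)
  | succ n ih =>
    by_cases hne : K = ⊤
    · exact ⟨0, by rw [hne, top_sup_eq]⟩
    obtain ⟨v, hv⟩ := hD K hne
    have h1 := Submodule.height_strictMono hv
    rw [← Module.length_submodule, ← Module.length_submodule] at h1
    obtain ⟨w, hw⟩ := ih (K ⊔ Submodule.span Λ {v})
      (Order.lt_add_one_iff_of_not_isMax (by simp) |>.1 (h1.trans_le hK))
    refine ⟨Fin.cons v w, ?_⟩
    rw [Fin.range_cons, Set.insert_eq, Submodule.span_union, ← sup_assoc, hw]

end LengthBounds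

section HLength

variable {R : Type u} [CommRing R] [IsLocalRing R] [IsNoetherianRing R]
  {Λ : Type u} [Ring Λ] [Algebra R Λ] [Module.Finite R Λ] {xs : List R}
  {M : Type u} [AddCommGroup M] [Module Λ M] [Module R M] [IsScalarTower R Λ M]
  {N : Type u} [AddCommGroup N] [Module Λ N] [Module R N] [IsScalarTower R Λ N]

omit [IsNoetherianRing R] [IsLocalRing R] [Module.Finite R Λ] in
lemma smul_stableHom_eq_zero {s : R} (hs : s ∈ stabIdeal R Λ M) (x : stableHom R Λ M N) :
    s • x = 0 := by
  obtain ⟨f, rfl⟩ := Submodule.Quotient.mk_surjective _ x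
  refine (Submodule.Quotient.mk_eq_zero (projTrivial R Λ M N) (x := s • f)).2 ?_
  have h : s • f = f ∘ₗ (s • LinearMap.id) :=
    LinearMap.ext fun m => (LinearMap.map_smul_of_tower f s m).symm
  rw [h]
  exact (mem_stabIdeal.1 hs).comp_left f

omit [IsLocalRing R] in
lemma finite_stableHom [Module.Finite Λ M] [Module.Finite Λ N] :
    Module.Finite R (stableHom R Λ M N) := by
  have : Module.Finite R (M →ₗ[Λ] N) := finite_linearMap R Λ M
  exact Module.Finite.quotient R (projTrivial R Λ M N)

lemma isArtinian_stableHom (hM : IsLat xs Λ M) [Module.Finite Λ N] :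
    IsArtinian R (stableHom R Λ M N) := by
  have := hM.1
  have : Module.Finite R (stableHom R Λ M N) := finite_stableHom
  obtain ⟨k, hk⟩ := hM.2.2
  exact isArtinian_of_pow_smul k _ fun s hs x => smul_stableHom_eq_zero (hk hs) x

lemma exists_hLength_eq (hM : IsLat xs Λ M) [Module.Finite Λ N] :
    ∃ t : ℕ, hLength R Λ M N = (t : WithBot ℕ∞) := by
  have := hM.1
  have : IsArtinian R (stableHom R Λ M (M × N)) := isArtinian_stableHom hM
  have : Module.Finite R (stableHom R Λ M (M × N)) := finite_stableHom
  obtain ⟨t, ht⟩ := ENat.ne_top_iff_exists.1 (Module.length_ne_top (R := R)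
    (M := stableHom R Λ M (M × N)))
  exact ⟨t, (Module.coe_length R _).symm.trans (congrArg _ ht.symm)⟩

omit [IsNoetherianRing R] [Module.Finite R Λ] in
lemma pow_le_stabIdeal_of_hLength_le {n : ℕ} (h : hLength R Λ M N ≤ (n : WithBot ℕ∞)) :
    maximalIdeal R ^ n ≤ stabIdeal R Λ M := by
  intro s hs
  have hl : Module.length R (stableHom R Λ M (M × N)) ≤ n := by
    have h1 := (Module.coe_length R (stableHom R Λ M (M × N))).trans_le h
    exact_mod_cast h1
  have h1 := smul_eq_zero_of_length_le n hl s hs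
    (Submodule.Quotient.mk (p := projTrivial R Λ M (M × N)) (LinearMap.inl Λ M N))
  have h2 : FactorsThroughProjective Λ (s • LinearMap.inl Λ M N) :=
    (Submodule.Quotient.mk_eq_zero (projTrivial R Λ M (M × N))).1 h1
  rw [mem_stabIdeal]
  convert h2.comp_left (LinearMap.fst Λ M N) using 1
  ext m
  simp

variable [IsAdicComplete (maximalIdeal R) R]

variable (R) in
include R in
omit [Module R M] [IsScalarTower R Λ M] in
lemma eq_zero_of_factorsThroughProjective (hM : IsIndecomposable Λ M)
    (hp : ¬ Module.Projective Λ M) {T : Type u} [AddCommGroup T] [Module Λ T] [IsSimpleModule Λ T]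
    {f : M →ₗ[Λ] T} (hf : FactorsThroughProjective Λ f) : f = 0 := by
  have : IsNoetherianRing Λ := IsNoetherianRing.of_finite R Λ
  have := IsSimpleModule.nontrivial Λ T
  obtain ⟨t, ht⟩ := exists_ne (0 : T)
  obtain ⟨a, ha⟩ := hf.lift (IsSimpleModule.toSpanSingleton_surjective Λ ht)
  obtain ⟨l, hl, hs⟩ := hasDecomposition R (Λ := Λ) Λ
  have key : ∀ x ∈ l, (LinearMap.toSpanSingleton Λ T t) ∘ₗ x.idem ∘ₗ a = 0 := fun x hx => by
    let a' := x.proj ∘ₗ a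
    let π := LinearMap.toSpanSingleton Λ T t ∘ₗ x.inc
    by_contra hne
    have hne' : π ∘ₗ a' ≠ 0 := hne
    have hsurj := LinearMap.surjective_of_ne_zero hne'
    have hproj : Module.Projective Λ x.obj := Module.Projective.of_split x.inc x.proj x.proj_inc
    obtain ⟨s, hs⟩ := Module.projective_lifting_property (π ∘ₗ a') π hsurj
    have hfin : Module.Finite Λ x.obj := Module.Finite.of_surjective x.proj fun y =>
      ⟨x.inc y, LinearMap.congr_fun x.proj_inc y⟩
    have hloc := (hl x hx).endLocal R
    have := hloc.1
    have hb : Function.Bijective (a' ∘ₗ s) := by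
      refine (hloc.2 (a' ∘ₗ s)).resolve_right fun hb => hne' ?_
      have : π = 0 := LinearMap.ext fun z => by
        obtain ⟨y, rfl⟩ := hb.2 z
        have := LinearMap.congr_fun hs y
        simp only [LinearMap.comp_apply] at this
        simp [this]
      rw [this, LinearMap.zero_comp]
    exact hp (Module.Projective.of_equiv
      (LinearEquiv.ofBijective s (bijective_of_comp_bijective hM hb).1))
  have h2 : ∀ l' : List (Summand R Λ Λ), (∀ x ∈ l', x ∈ l) →
      (LinearMap.toSpanSingleton Λ T t) ∘ₗ (l'.map Summand.idem).sum ∘ₗ a = 0 := fun l' hl' => by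
    induction l' with
    | nil => ext; simp
    | cons x l' ih =>
      rw [List.map_cons, List.sum_cons, LinearMap.add_comp, LinearMap.comp_add,
        key x (hl' x List.mem_cons_self), ih fun x hx => hl' x (List.mem_cons_of_mem _ hx),
        add_zero]
  have h3 := h2 l fun x hx => hx
  rw [hs] at h3
  rw [← ha]
  exact h3

variable {ι : Type u} {Sfam : ι → Type u} [∀ i, AddCommGroup (Sfam i)]
  [∀ i, Module Λ (Sfam i)] {G : Type u} [AddCommGroup G] [Module Λ G] [Module R G]
  [IsScalarTower R Λ G] {α : G →ₗ[Λ] ∀ i, Sfam i}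

/-- The stable classes of the maps `M → M × G` whose composition with `α` vanishes on `K`. -/
def vanishing (α : G →ₗ[Λ] ∀ i, Sfam i) (K : Submodule Λ M) :
    Submodule R (stableHom R Λ M (M × G)) :=
  Submodule.map (projTrivial R Λ M (M × G)).mkQ
    { carrier := {f | ∀ m ∈ K, α (f m).2 = 0}
      add_mem' := fun hf hg m hm => by simp [hf m hm, hg m hm]
      zero_mem' := fun m _ => by simp
      smul_mem' := fun r f hf m hm => by
        rw [LinearMap.smul_apply, Prod.smul_snd, ← algebraMap_smul Λ r, map_smul, hf m hm,
          smul_zero] }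

theorem bounded_of_hLength_le (hsimple : ∀ i, IsSimpleModule Λ (Sfam i))
    (hS : ∀ (T : Type u) (_ : AddCommGroup T) (_ : Module Λ T),
      IsSimpleModule Λ T → ∃ i, Nonempty (T ≃ₗ[Λ] Sfam i))
    (hG : IsLat xs Λ G) (hα : Function.Surjective α) (hker : RelInj xs Λ (LinearMap.ker α))
    {M : LMod R Λ} (hM : IndecLat xs M) (hp : ¬ Module.Projective Λ M) {n : ℕ}
    (h : hLength R Λ M G ≤ (n : WithBot ℕ∞)) : Bounded n M := by
  classical
  refine ⟨pow_le_stabIdeal_of_hLength_le h, ?_⟩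
  have := hM.1.1
  have := hG.1
  have : IsArtinian R (stableHom R Λ M (M × G)) := isArtinian_stableHom hM.1
  have : Module.Finite R (stableHom R Λ M (M × G)) := finite_stableHom
  have hl : Module.length R (stableHom R Λ M (M × G)) ≤ n := by
    have h1 := (Module.coe_length R (stableHom R Λ M (M × G))).trans_le h
    exact_mod_cast h1
  have hz : ∀ f : M →ₗ[Λ] (M × G), FactorsThroughProjective Λ f → ∀ m, α (f m).2 = 0 :=
    fun f hf m => funext fun i => by
      have := eq_zero_of_factorsThroughProjective R hM.2 hp
        (hf.comp_left (LinearMap.proj i ∘ₗ α ∘ₗ LinearMap.snd Λ M G))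
      exact LinearMap.congr_fun this m
  obtain ⟨v, hv⟩ := exists_generators (R := R) (vanishing (M := M) α) (fun K hK => by
    obtain ⟨K', hK', hle⟩ := (eq_top_or_exists_le_coatom K).resolve_left hK
    obtain ⟨v, hv⟩ : ∃ v, v ∉ K' := by
      by_contra! hcon
      exact hK'.1 (eq_top_iff.2 fun x _ => hcon x)
    obtain ⟨i, ⟨e⟩⟩ := hS (M ⧸ K') _ _ (isSimpleModule_iff_isCoatom.2 hK')
    obtain ⟨ψ, hψ⟩ := hker.exists_lift hα hM.1
      (LinearMap.single Λ Sfam i ∘ₗ e.toLinearMap ∘ₗ K'.mkQ)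
    have hψ' : ∀ m, α (ψ m) = 0 ↔ m ∈ K' := fun m => by
      have := LinearMap.congr_fun hψ m
      simp only [LinearMap.comp_apply] at this
      rw [this]
      simp
    refine ⟨v, lt_of_le_of_ne (Submodule.map_mono fun f hf m hm => hf m (le_sup_left (a := K) hm))
      fun heq => hv ?_⟩
    have hmem : Submodule.Quotient.mk (p := projTrivial R Λ M (M × G)) (LinearMap.inr Λ M G ∘ₗ ψ) ∈
        vanishing (R := R) α K := ⟨_, fun m hm => (hψ' m).2 (hle hm), rfl⟩
    rw [← heq] at hmem
    obtain ⟨f, hf, hfe⟩ := hmem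
    have h1 := hz _ ((Submodule.Quotient.eq (projTrivial R Λ M (M × G))).1 hfe) v
    have h2 := hf v (Submodule.mem_sup_right (Submodule.mem_span_singleton_self v))
    rw [← hψ']
    rw [LinearMap.sub_apply, Prod.snd_sub, map_sub, h2, zero_sub, neg_eq_zero] at h1
    exact h1) n ⊥ 
    ((Module.length_le_of_injective _ (Submodule.subtype_injective _)).trans hl)
  refine ⟨Fintype.linearCombination Λ v, ?_⟩
  rw [← LinearMap.range_eq_top, Fintype.range_linearCombination, ← hv, bot_sup_eq]

end HLength

lemma exists_seq_of_not_countablyMany {R : Type u} [CommRing R] {Λ : Type u} [Ring Λ] [Algebra R Λ]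
    {P : LMod R Λ → Prop} (h : ¬ CountablyMany P) :
    ∃ Z : ℕ → LMod R Λ, (∀ n, P (Z n)) ∧ ∀ m n, m ≠ n → IsEmpty (Z m ≃ₗ[Λ] Z n) := by
  let s : Setoid {M // P M} := ⟨fun M M' => Nonempty (M.1 ≃ₗ[Λ] M'.1),
    fun M => ⟨.refl Λ M.1⟩, fun ⟨e⟩ => ⟨e.symm⟩, fun ⟨e⟩ ⟨e'⟩ => ⟨e.trans e'⟩⟩
  rcases finite_or_infinite (Quotient s) with hs | hs
  · refine absurd (.of_iso_cover (S := Set.range fun q : Quotient s => q.out.1)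
      (Set.countable_range _) fun M hM => ⟨_, ⟨⟦⟨M, hM⟩⟧, rfl⟩, ?_⟩) h
    exact Setoid.symm (Quotient.mk_out (⟨M, hM⟩ : {M // P M}))
  · let f := Infinite.natEmbedding (Quotient s)
    refine ⟨fun n => (f n).out.1, fun n => (f n).out.2, fun m n hmn => ⟨fun e => hmn ?_⟩⟩
    exact f.injective (Quotient.out_equiv_out.1 (⟨e⟩ : Nonempty _))

/-- If the `R`-order `Λ` has uncountably many isomorphism classes of
indecomposable `Λ`-lattices, then `Λ` has strongly unbounded lattice type. -/
theorem strongly_unbounded_of_uncountable_lat_type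
    (R : Type u) [CommRing R] [IsNoetherianRing R] [IsLocalRing R]
    [IsAdicComplete (maximalIdeal R) R]
    (d : ℕ) (hdim : ringKrullDim R = (d : WithBot ℕ∞))
    (hCM : IsMCM R R)
    (ω : Type u) [AddCommGroup ω] [Module R ω] (hω : IsCanonicalModule R ω)
    (Λ : Type u) [Ring Λ] [Algebra R Λ] [Module.Finite R Λ]
    (hord : IsLattice R Λ ω Λ)
    (ι : Type u) [Fintype ι] (Sfam : ι → Type u) [∀ i, AddCommGroup (Sfam i)]
    [∀ i, Module Λ (Sfam i)]
    (G : Type u) [AddCommGroup G] [Module Λ G] [Module R G] [IsScalarTower R Λ G]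
    (α : G →ₗ[Λ] ∀ i, Sfam i) (happrox : IsSimplesApprox R Λ ω ι Sfam G α)
    (κ : Type u) [Uncountable κ] (F : κ → Type u) [∀ x, AddCommGroup (F x)]
    [∀ x, Module Λ (F x)] [∀ x, Module R (F x)] [∀ x, IsScalarTower R Λ (F x)]
    (hF : ∀ x, IsLattice R Λ ω (F x) ∧ IsIndecomposable Λ (F x))
    (hpairwise : ∀ x y : κ, x ≠ y → IsEmpty (F x ≃ₗ[Λ] F y)) :
    StronglyUnboundedLatType R Λ ω G := by
  obtain ⟨hsimple, -, hS, hGlat, hα, ⟨t, ht⟩, -⟩ := happrox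
  obtain ⟨xs, hxs, hreg, hlen⟩ := hord.2.1
  have hΛ := hreg.toIsWeaklyRegular
  have : IsNoetherianRing Λ := IsNoetherianRing.of_finite R Λ
  have hG := hGlat.isLat hxs hlen hΛ
  have hker := latResolved_of_hasLatInjRes hord hΛ hxs hlen t _ ht
  have hsink : HasSinks R Λ xs := fun M hM => by
    have := hM.1.1
    exact exists_minimal_isSink hxs hlen hΛ
      (fun C _ _ hC => exists_hasApprox_prod hΛ hS ⟨.of R Λ G, α, hG, hα, hker⟩ hC)
      hM.1 (hM.2.endLocal R)
  by_cases hinf : {t | InfManyIndecLatticesOfHLength R Λ ω G t}.Infinite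
  · exact ⟨_, Nat.nth_strictMono hinf, fun i => Nat.nth_mem_of_infinite hinf i⟩
  obtain ⟨n, hn⟩ := (Set.not_infinite.1 hinf).bddAbove
  have hcount : ∀ t ∈ Set.Ioi n, CountablyMany fun M : LMod R Λ =>
      IndecLat xs M ∧ hLength R Λ M G = (t : WithBot ℕ∞) := fun t ht => by
    by_contra hcon
    obtain ⟨Z, hZ, hZ'⟩ := exists_seq_of_not_countablyMany hcon
    refine (Set.mem_Ioi.1 ht).not_ge (hn ⟨fun n => Z n, inferInstance, inferInstance,
      inferInstance, inferInstance, fun n => ⟨?_, (hZ n).1.2, (hZ n).2⟩, hZ'⟩)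
    have := (hZ n).1.2.1
    exact (hZ n).1.1.isLattice hxs hlen hord
  have hbase : CountablyMany fun M : LMod R Λ =>
      IndecLat xs M ∧ (¬ Bounded n M ∨ Module.Projective Λ M) := by
    refine ((CountablyMany.biUnion (Set.to_countable _) hcount).or
      (countablyMany_projective (xs := xs))).mono ?_
    rintro M ⟨hM, hM'⟩
    by_cases hp : Module.Projective Λ M
    · exact Or.inr ⟨hM, hp⟩
    have := hG.1
    obtain ⟨t, ht⟩ := exists_hLength_eq hM.1 (N := G)
    refine Or.inl ⟨t, Set.mem_Ioi.2 (not_le.1 fun hle => hM'.resolve_right hp ?_), hM, ht⟩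
    exact bounded_of_hLength_le hsimple hS hG hα (hker.relInj hΛ) hM hp
      (ht.trans_le (by exact_mod_cast hle))
  obtain ⟨N, hN⟩ := exists_reach hxs hlen hΛ hsink n
  obtain ⟨S, hSc, -, hS'⟩ := CountablyMany.reach hΛ hsink hbase N
  have hx : ∀ x, ∃ M ∈ S, Nonempty (F x ≃ₗ[Λ] M) := fun x =>
    hS' (.of R Λ (F x)) (hN _ ⟨(hF x).1.isLat hxs hlen hΛ, (hF x).2⟩)
  choose c hcS hc using hx
  have := hSc.to_subtype
  have hinj : Function.Injective fun x => (⟨c x, hcS x⟩ : S) := fun x y hxy => by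
    by_contra hne
    obtain ⟨e⟩ := hc x
    obtain ⟨e'⟩ := hc y
    have h := congrArg Subtype.val hxy
    simp only at h
    rw [← h] at e'
    exact (hpairwise x y hne).false (e.trans e'.symm)
  exact (not_countable_iff.2 ‹Uncountable κ› hinj.countable).elim

end BT
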